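/- The satisfiability problem for RoCTL* is decidable: there is an algorithm (a computable function) that, given a RoCTL* formula φ, decides whether there exist a RoCTL-structure M and a fullpath σ through M such that M,σ ⊨ φ. -/

import Mathlib

/-! STATEMENT 9: satisfiability of RoCTL* is decidable. -/

namespace Stmt9
/-- A structure: a set of worlds `W`, a binary accessibility relation and a
valuation assigning to each world the set of atoms true there. -/
structure KStruct (V : Type) (W : Type) where
  rel : W → W → Prop
  val : W → Set V

variable {V W W' : Type}

/-- The accessibility relation is serial. -/
def KStruct.Serial (M : KStruct V W) : Prop := ∀ w, ∃ v, M.rel w v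

/-- `σ` is a fullpath through `M`. -/
def IsFullpath (M : KStruct V W) (σ : ℕ → W) : Prop := ∀ i, M.rel (σ i) (σ (i + 1))

/-- The suffix `σ≥n` of a fullpath. -/
def suffix (σ : ℕ → W) (n : ℕ) : ℕ → W := fun i => σ (i + n)

/-- A fullpath is failure-free iff the violation atom is false at all
positions `i > 0`. -/
def FailureFree (M : KStruct V W) (viol : V) (σ : ℕ → W) : Prop :=
  ∀ i, 0 < i → viol ∉ M.val (σ i)

/-- A RoCTL-structure: serial, and every world starts some failure-free fullpath. -/
def IsRoCTL (M : KStruct V W) (viol : V) : Prop :=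
  M.Serial ∧ ∀ w, ∃ σ, IsFullpath M σ ∧ σ 0 = w ∧ FailureFree M viol σ

/-- `π` is a deviation from `σ`: for some `i`, `π≤i = σ≤i` and `π≥(i+1)` is
failure-free. -/
def IsDeviation (M : KStruct V W) (viol : V) (σ π : ℕ → W) : Prop :=
  ∃ i, (∀ j ≤ i, π j = σ j) ∧ FailureFree M viol (suffix π (i + 1))

/-- RoCTL* formulas: atoms, ¬, ∧, U, N, A, O, ▲. -/
inductive Form (V : Type) : Type where
  | atom : V → Form V
  | neg : Form V → Form V
  | conj : Form V → Form V → Form V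
  | untl : Form V → Form V → Form V
  | next : Form V → Form V
  | fall : Form V → Form V
  | oblig : Form V → Form V
  | robust : Form V → Form V

/-- Truth of a RoCTL* formula on a fullpath. -/
def sat (M : KStruct V W) (viol : V) : Form V → (ℕ → W) → Prop
  | .atom p, σ => p ∈ M.val (σ 0)
  | .neg φ, σ => ¬ sat M viol φ σ
  | .conj φ ψ, σ => sat M viol φ σ ∧ sat M viol ψ σ
  | .untl φ ψ, σ => ∃ i, sat M viol ψ (suffix σ i) ∧ ∀ j < i, sat M viol φ (suffix σ j)
  | .next φ, σ => sat M viol φ (suffix σ 1)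
  | .fall φ, σ => ∀ π, IsFullpath M π → π 0 = σ 0 → sat M viol φ π
  | .oblig φ, σ => ∀ π, IsFullpath M π → π 0 = σ 0 → FailureFree M viol π → sat M viol φ π
  | .robust φ, σ => sat M viol φ σ ∧
      ∀ π, IsFullpath M π → IsDeviation M viol σ π → sat M viol φ π

/-- RoCTL* formulas have atoms ranging over `V \ {viol}`. -/
def ViolFree (viol : V) : Form V → Prop
  | .atom p => p ≠ viol
  | .neg φ => ViolFree viol φ
  | .conj φ ψ => ViolFree viol φ ∧ ViolFree viol ψ
  | .untl φ ψ => ViolFree viol φ ∧ ViolFree viol ψ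
  | .next φ => ViolFree viol φ
  | .fall φ => ViolFree viol φ
  | .oblig φ => ViolFree viol φ
  | .robust φ => ViolFree viol φ
/-- An injective coding of RoCTL* formulas (atoms over ℕ, violation atom `0`)
as natural numbers. -/
def enc : Form ℕ → ℕ
  | .atom p => Nat.pair 0 p
  | .neg φ => Nat.pair 1 (enc φ)
  | .conj φ ψ => Nat.pair 2 (Nat.pair (enc φ) (enc ψ))
  | .untl φ ψ => Nat.pair 3 (Nat.pair (enc φ) (enc ψ))
  | .next φ => Nat.pair 4 (enc φ)
  | .fall φ => Nat.pair 5 (enc φ)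
  | .oblig φ => Nat.pair 6 (enc φ)
  | .robust φ => Nat.pair 7 (enc φ)

end Stmt9

namespace Stmt9

/-! ## Classifiers (deterministic automata used as right congruences) -/

structure Clf (A S : Type) where
  ini : S
  step : S → A → S

/-- State reached at time `k` when started at time `i`. -/
def Clf.run {A S : Type} (C : Clf A S) (x : ℕ → A) (i : ℕ) : ℕ → S
  | 0 => C.ini
  | k + 1 => if i ≤ k then C.step (C.run x i k) (x k) else C.ini

theorem Clf.run_of_le {A S : Type} (C : Clf A S) (x : ℕ → A) {i k : ℕ} (h : k ≤ i) :
    C.run x i k = C.ini := by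
  cases k with
  | zero => rfl
  | succ k => simp only [Clf.run]; rw [if_neg (by omega)]

theorem Clf.run_succ {A S : Type} (C : Clf A S) (x : ℕ → A) {i k : ℕ} (h : i ≤ k) :
    C.run x i (k + 1) = C.step (C.run x i k) (x k) := by
  simp only [Clf.run]; rw [if_pos h]

theorem Clf.run_congr {A S : Type} (C : Clf A S) (x y : ℕ → A) (i k : ℕ)
    (h : ∀ j, i ≤ j → j < k → x j = y j) : C.run x i k = C.run y i k := by
  induction k with
  | zero => rfl
  | succ k ih =>
    by_cases hk : i ≤ k
    · rw [C.run_succ x hk, C.run_succ y hk, ih (fun j h1 h2 => h j h1 (by omega)),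
        h k hk (by omega)]
    · rw [C.run_of_le x (by omega), C.run_of_le y (by omega)]

theorem Clf.run_shift {A S : Type} (C : Clf A S) (x : ℕ → A) (n i k : ℕ) :
    C.run (fun j => x (j + n)) i k = C.run x (i + n) (k + n) := by
  induction k with
  | zero => rw [C.run_of_le x (by omega)]; rfl
  | succ k ih =>
    by_cases hk : i ≤ k
    · rw [C.run_succ _ hk, ih, show k + 1 + n = (k + n) + 1 by omega, C.run_succ x (by omega)]
    · rw [C.run_of_le x (by omega), C.run_of_le _ (by omega)]

theorem Clf.run_merge {A S : Type} (C : Clf A S) (x : ℕ → A) {i j k l : ℕ} (hi : i ≤ k)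
    (hj : j ≤ k) (hl : k ≤ l) (h : C.run x i k = C.run x j k) : C.run x i l = C.run x j l := by
  induction l, hl using Nat.le_induction with
  | base => exact h
  | succ l hl ih => rw [C.run_succ x (by omega), C.run_succ x (by omega), ih]

/-- `x` is cut into blocks: the first one of class `s`, all others of class `m`. -/
def Clf.HasType {A S : Type} (C : Clf A S) (x : ℕ → A) (s m : S) : Prop :=
  ∃ c : ℕ → ℕ, StrictMono c ∧ 0 < c 0 ∧ C.run x 0 (c 0) = s ∧
    ∀ a, C.run x (c a) (c (a + 1)) = m

def Clf.Recog {A S : Type} (C : Clf A S) (K : Set (ℕ → A)) : Prop :=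
  ∀ x y s m, C.HasType x s m → C.HasType y s m → x ∈ K → y ∈ K

theorem ultra_finite {S : Type} [Finite S] (U : Ultrafilter ℕ) (f : ℕ → S) :
    ∃ s, ∀ᶠ k in U, f k = s := by
  have h : (⋃ s ∈ (Set.univ : Set S), f ⁻¹' {s}) ∈ U := by
    have : (⋃ s ∈ (Set.univ : Set S), f ⁻¹' {s}) = Set.univ := by
      ext k; simp
    rw [this]; exact Filter.univ_mem
  rw [Ultrafilter.finite_biUnion_mem_iff Set.finite_univ] at h
  obtain ⟨s, -, hs⟩ := h
  exact ⟨s, hs⟩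

theorem ultra_gt {P : ℕ → Prop} (h : ∀ᶠ k in (Filter.hyperfilter ℕ : Filter ℕ), P k) (N : ℕ) :
    ∃ k, N < k ∧ P k := by
  have h2 : ∀ᶠ k in (Filter.hyperfilter ℕ : Filter ℕ), N < k :=
    (Filter.eventually_gt_atTop N).filter_mono
      Nat.hyperfilter_le_atTop
  exact (h2.and h).exists

theorem Clf.exists_type {A S Z : Type} [Finite S] [Finite Z] (C : Clf A S) (x : ℕ → A)
    (col : ℕ → Z) :
    ∃ (c : ℕ → ℕ) (m : S) (z : Z), StrictMono c ∧ 0 < c 0 ∧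
      (∀ a, C.run x (c a) (c (a + 1)) = m) ∧ ∀ a, col (c a) = z := by
  choose l hl using fun i => ultra_finite (Filter.hyperfilter ℕ) (fun k => C.run x i k)
  obtain ⟨s, hs⟩ := ultra_finite (Filter.hyperfilter ℕ) l
  obtain ⟨z, hz⟩ := ultra_finite (Filter.hyperfilter ℕ) col
  obtain ⟨x0, -, hx0⟩ := ultra_gt hs 0
  obtain ⟨m, hm⟩ := ultra_finite (Filter.hyperfilter ℕ) (fun k => C.run x x0 k)
  choose nx hnx using fun N => ultra_gt ((hs.and hz).and hm) N
  have hZ : ∀ i, ∃ t, l i = s → ∀ k, t ≤ k → C.run x i k = C.run x x0 k := by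
    intro i
    by_cases hi : l i = s
    · obtain ⟨k, hk, h1, h2⟩ := ultra_gt ((hl i).and (hl x0)) (max i x0)
      refine ⟨k, fun _ k' hk' => C.run_merge x (by omega) (by omega) hk' ?_⟩
      rw [h1, h2, hi, hx0]
    · exact ⟨0, fun h => absurd h hi⟩
  choose t ht using hZ
  let c : ℕ → ℕ := fun n => Nat.rec (nx 0) (fun _ p => nx (max p (t p))) n
  have hc : ∀ n, c (n + 1) = nx (max (c n) (t (c n))) := fun n => rfl
  have hJ : ∀ n, (l (c n) = s ∧ col (c n) = z) ∧ C.run x x0 (c n) = m := by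
    intro n
    cases n with
    | zero => exact (hnx 0).2
    | succ n => rw [hc]; exact (hnx _).2
  have hlt : ∀ n, max (c n) (t (c n)) < c (n + 1) := by
    intro n; rw [hc]; exact (hnx _).1
  refine ⟨c, m, z, strictMono_nat_of_lt_succ fun n => ?_, (hnx 0).1, fun a => ?_,
    fun a => (hJ a).1.2⟩
  · have := hlt n; omega
  · have := hlt a
    rw [ht (c a) (hJ a).1.1 _ (by omega)]
    exact (hJ (a + 1)).2

theorem Clf.exists_hasType {A S : Type} [Finite S] (C : Clf A S) (x : ℕ → A) :
    ∃ s m, C.HasType x s m := by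
  obtain ⟨c, m, -, h1, h2, h3, -⟩ := C.exists_type x (fun _ => ())
  exact ⟨_, m, c, h1, h2, rfl, h3⟩

/-- The type of a suffix. -/
theorem Clf.hasType_shift {A S : Type} (C : Clf A S) (x : ℕ → A) (c : ℕ → ℕ) (hc : StrictMono c)
    (m : S) (hm : ∀ a, C.run x (c a) (c (a + 1)) = m) (j a : ℕ) (hj : j < c a) :
    C.HasType (fun i => x (i + j)) (C.run x j (c a)) m := by
  have hge : ∀ b, j < c (a + b) := fun b => lt_of_lt_of_le hj (hc.monotone (by omega))
  refine ⟨fun b => c (a + b) - j, ?_, ?_, ?_, ?_⟩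
  · intro b b' hb
    have := hc (show a + b < a + b' by omega)
    have := hge b
    show c (a + b) - j < c (a + b') - j
    omega
  · have := hge 0; show 0 < c (a + 0) - j; omega
  · have := hge 0
    show C.run _ 0 (c (a + 0) - j) = _
    rw [C.run_shift]
    congr 1
    · omega
    · simp only [Nat.add_zero] at *; omega
  · intro b
    have h1 := hge b
    have h2 := hge (b + 1)
    show C.run _ (c (a + b) - j) (c (a + (b + 1)) - j) = _
    rw [C.run_shift, ← hm (a + b)]
    congr 1
    · omega
    · rw [← Nat.add_assoc] at h2 ⊢; omega

theorem Clf.Recog.compl {A S : Type} {C : Clf A S} {K : Set (ℕ → A)} (h : C.Recog K) :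
    C.Recog Kᶜ := fun x y s m hx hy hxK hyK => hxK (h y x s m hy hx hyK)

theorem Clf.Recog.inter {A S : Type} {C : Clf A S} {K K' : Set (ℕ → A)} (h : C.Recog K)
    (h' : C.Recog K') : C.Recog (K ∩ K') :=
  fun x y s m hx hy hxK => ⟨h x y s m hx hy hxK.1, h' x y s m hx hy hxK.2⟩

/-- Pulling back along letter maps and simulations. -/
theorem Clf.Recog.sim {A A' S S' : Type} {C : Clf A S} {C' : Clf A' S'} {K : Set (ℕ → A)}
    (h : C.Recog K) (g : A' → A) (p : S' → S) (h0 : p C'.ini = C.ini)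
    (h1 : ∀ s a, p (C'.step s a) = C.step (p s) (g a)) :
    C'.Recog {x | (fun i => g (x i)) ∈ K} := by
  have hrun : ∀ x i k, p (C'.run x i k) = C.run (fun i => g (x i)) i k := by
    intro x i k
    induction k with
    | zero => exact h0
    | succ k ih =>
      by_cases hk : i ≤ k
      · rw [C'.run_succ x hk, C.run_succ _ hk, h1, ih]
      · rw [C'.run_of_le x (by omega), C.run_of_le _ (by omega), h0]
  have ht : ∀ x s m, C'.HasType x s m → C.HasType (fun i => g (x i)) (p s) (p m) := by
    rintro x s m ⟨c, h1, h2, h3, h4⟩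
    exact ⟨c, h1, h2, by rw [← h3, hrun], fun a => by rw [← h4 a, hrun]⟩
  intro x y s m hx hy hxK
  exact h _ _ _ _ (ht _ _ _ hx) (ht _ _ _ hy) hxK

/-! ### Composition -/

def Clf.comp {A S Q SJ : Type} (C : Clf A S) (CJ : Clf ((Q → Prop) × A) SJ) :
    Clf A (S × ((S → Q → Prop) → SJ)) where
  ini := (C.ini, fun _ => CJ.ini)
  step := fun s a => (C.step s.1 a,
    fun v => CJ.step (s.2 (fun t => v (C.step t a))) (v (C.step C.ini a), a))

theorem Clf.comp_run_fst {A S Q SJ : Type} (C : Clf A S) (CJ : Clf ((Q → Prop) × A) SJ)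
    (x : ℕ → A) (i k : ℕ) : ((C.comp CJ).run x i k).1 = C.run x i k := by
  induction k with
  | zero => rfl
  | succ k ih =>
    by_cases hk : i ≤ k
    · rw [Clf.run_succ _ x hk, C.run_succ x hk, ← ih]; rfl
    · rw [Clf.run_of_le _ x (by omega), C.run_of_le x (by omega)]; rfl

theorem Clf.comp_run_snd {A S Q SJ : Type} (C : Clf A S) (CJ : Clf ((Q → Prop) × A) SJ)
    (x : ℕ → A) (i k : ℕ) (v : S → Q → Prop) :
    ((C.comp CJ).run x i k).2 v = CJ.run (fun j => (v (C.run x j k), x j)) i k := by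
  induction k generalizing v with
  | zero => rfl
  | succ k ih =>
    by_cases hk : i ≤ k
    · rw [Clf.run_succ _ x hk, CJ.run_succ _ hk]
      show CJ.step (((C.comp CJ).run x i k).2 _) _ = _
      rw [ih]
      congr 1
      · apply CJ.run_congr
        intro j h1 h2
        rw [C.run_succ x (by omega)]
      · rw [C.run_succ x (le_refl k), C.run_of_le x (le_refl k)]
    · rw [Clf.run_of_le _ x (by omega), CJ.run_of_le _ (by omega)]; rfl

/-- The word of verdicts. -/
def verd {A Q : Type} (K : Q → Set (ℕ → A)) (x : ℕ → A) : ℕ → (Q → Prop) × A :=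
  fun i => (fun q => (fun j => x (j + i)) ∈ K q, x i)

theorem Clf.comp_recog {A S Q SJ : Type} (C : Clf A S) (CJ : Clf ((Q → Prop) × A) SJ)
    (K : Q → Set (ℕ → A)) (hK : ∀ q, C.Recog (K q)) (J : Set (ℕ → (Q → Prop) × A))
    (hJ : CJ.Recog J) : (C.comp CJ).Recog {x | verd K x ∈ J} := by
  intro x y s m hx hy hxJ
  let v : S → Q → Prop := fun t q => ∃ z ∈ K q, C.HasType z t m.1
  have key : ∀ x, (C.comp CJ).HasType x s m → CJ.HasType (verd K x) (s.2 v) (m.2 v) := by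
    rintro x ⟨c, hc, h0, h1, h2⟩
    have hv : ∀ j a, j < c a → (v (C.run x j (c a)), x j) = verd K x j := by
      intro j a hj
      have hm : ∀ a, C.run x (c a) (c (a + 1)) = m.1 := by
        intro a; rw [← C.comp_run_fst CJ, h2]
      have ht := C.hasType_shift x c hc m.1 hm j a hj
      simp only [verd, Prod.mk.injEq, and_true]
      funext q
      apply propext
      constructor
      · rintro ⟨z, hz, hzt⟩
        exact hK q _ _ _ _ hzt ht hz
      · intro hz
        exact ⟨_, hz, ht⟩
    refine ⟨c, hc, h0, ?_, fun a => ?_⟩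
    · rw [← h1, C.comp_run_snd]
      apply CJ.run_congr
      intro j _ hj
      rw [hv j 0 hj]
    · rw [← h2 a, C.comp_run_snd]
      apply CJ.run_congr
      intro j _ hj
      rw [hv j _ hj]
  exact hJ _ _ _ _ (key x hx) (key y hy) hxJ

end Stmt9

namespace Stmt9

/-! ## Determinization into parity automata -/

/-- `p` is the least colour occurring infinitely often. -/
def ParLim (c : ℕ → ℕ) (p : ℕ) : Prop :=
  (∀ N, ∃ k, N ≤ k ∧ c k = p) ∧ ∃ N, ∀ k, N ≤ k → p ≤ c k

theorem ParLim.unique {c : ℕ → ℕ} {p q : ℕ} (h : ParLim c p) (h' : ParLim c q) : p = q := by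
  obtain ⟨h1, N, h2⟩ := h
  obtain ⟨h3, N', h4⟩ := h'
  obtain ⟨k, hk, e⟩ := h1 N'
  obtain ⟨k', hk', e'⟩ := h3 N
  have := h2 k' hk'
  have := h4 k hk
  omega

namespace Clf
section det
variable {A S : Type} (C : Clf A S) (x : ℕ → A)

/-- `z` is the oldest start point in its class at time `k`. -/
def IsRep (k z : ℕ) : Prop := z ≤ k ∧ ∀ j, j < z → C.run x j k ≠ C.run x z k

def Fst (k : ℕ) (s : S) (z : ℕ) : Prop := C.IsRep x k z ∧ C.run x z k = s

def Evt (k z y : ℕ) : Prop :=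
  z < y ∧ C.IsRep x (k + 1) z ∧ (C.IsRep x k y ∨ y = k + 1) ∧
    C.run x z (k + 1) = C.run x y (k + 1)

noncomputable def idx (k z : ℕ) : ℕ := Set.ncard {s | ∃ z', z' < z ∧ C.Fst x k s z'}

variable {C x}

theorem IsRep.pred {k z : ℕ} (h : C.IsRep x (k + 1) z) (hz : z ≤ k) : C.IsRep x k z := by
  refine ⟨hz, fun j hj e => h.2 j hj ?_⟩
  exact C.run_merge x (by omega) hz (by omega) e

theorem IsRep.eq {k z z' : ℕ} (h : C.IsRep x k z) (h' : C.IsRep x k z')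
    (e : C.run x z k = C.run x z' k) : z = z' := by
  rcases lt_trichotomy z z' with hl | hl | hl
  · exact absurd e (h'.2 z hl)
  · exact hl
  · exact absurd e.symm (h.2 z' hl)

theorem exists_rep {k y : ℕ} (hy : y ≤ k) :
    ∃ z, z ≤ y ∧ C.IsRep x k z ∧ C.run x z k = C.run x y k := by
  classical
  have hex : ∃ z, C.run x z k = C.run x y k := ⟨y, rfl⟩
  refine ⟨Nat.find hex, Nat.find_min' hex rfl, ⟨(Nat.find_min' hex rfl).trans hy, ?_⟩,
    Nat.find_spec hex⟩
  intro j hj e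
  exact Nat.find_min hex hj (e.trans (Nat.find_spec hex))

/-- A representative which dies causes an event. -/
theorem evt_of_die {k y : ℕ} (h : C.IsRep x k y ∨ y = k + 1) (hn : ¬ C.IsRep x (k + 1) y) :
    ∃ z, C.Evt x k z y := by
  have hy : y ≤ k + 1 := by
    rcases h with h | h
    · have := h.1; omega
    · omega
  obtain ⟨z, hz, hr, e⟩ := exists_rep (C := C) (x := x) hy
  refine ⟨z, lt_of_le_of_ne hz ?_, hr, h, e⟩
  rintro rfl
  exact hn hr

theorem Evt.die {k z y : ℕ} (h : C.Evt x k z y) : ¬ C.IsRep x (k + 1) y :=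
  fun h' => h'.2 z h.1 h.2.2.2

theorem Evt.le {k z y : ℕ} (h : C.Evt x k z y) : y ≤ k + 1 := by
  rcases h.2.2.1 with h | h
  · have := h.1; omega
  · omega

theorem not_rep_mono {k y : ℕ} (hy : y ≤ k) (h : ¬ C.IsRep x k y) {l : ℕ} (hl : k ≤ l) :
    ¬ C.IsRep x l y := by
  induction l, hl using Nat.le_induction with
  | base => exact h
  | succ l hl ih => exact fun h' => ih (h'.pred (by omega))

theorem idx_lt [Finite S] {k z z' : ℕ} (hz : C.IsRep x k z) (hz' : C.IsRep x k z') (h : z < z') :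
    C.idx x k z < C.idx x k z' := by
  apply Set.ncard_lt_ncard _ (Set.toFinite _)
  refine ⟨?_, ?_⟩
  · rintro s ⟨w, hw, hs⟩
    exact ⟨w, by omega, hs⟩
  · intro hs
    obtain ⟨w, hw, hs⟩ := hs (show C.run x z k ∈ _ from ⟨z, h, hz, rfl⟩)
    have := hs.1.eq hz hs.2
    omega

theorem idx_le_card [Finite S] (k z : ℕ) : C.idx x k z ≤ Nat.card S := by
  have := Set.ncard_le_card {s | ∃ z', z' < z ∧ C.Fst x k s z'}
  exact this

theorem idx_succ_le [Finite S] {k z : ℕ} (hz : z ≤ k) : C.idx x (k + 1) z ≤ C.idx x k z := by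
  refine le_trans (Set.ncard_le_ncard (t := Set.image (fun s => C.step s (x k))
    {s | ∃ z', z' < z ∧ C.Fst x k s z'}) ?_ (Set.toFinite _)) (Set.ncard_image_le (Set.toFinite _))
  rintro t ⟨w, hw, hr, ht⟩
  refine ⟨C.run x w k, ⟨w, hw, hr.pred (by omega), rfl⟩, ?_⟩
  rw [← ht, C.run_succ x (by omega)]

theorem idx_le_succ [Finite S] {k z : ℕ} (hz : z ≤ k)
    (h : ∀ w, w < z → C.IsRep x k w → C.IsRep x (k + 1) w) :
    C.idx x k z ≤ C.idx x (k + 1) z := by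
  have hinj : Set.InjOn (fun s => C.step s (x k)) {s | ∃ z', z' < z ∧ C.Fst x k s z'} := by
    rintro s ⟨w, hw, hr, rfl⟩ s' ⟨w', hw', hr', rfl⟩ e
    simp only at e
    rw [← C.run_succ x hr.1, ← C.run_succ x hr'.1] at e
    rw [(h w hw hr).eq (h w' hw' hr') e]
  unfold idx
  rw [← hinj.ncard_image]
  apply Set.ncard_le_ncard _ (Set.toFinite _)
  rintro _ ⟨s, ⟨w, hw, hr, rfl⟩, rfl⟩
  exact ⟨w, hw, h w hw hr, by rw [C.run_succ x hr.1]⟩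

theorem Evt.idx_lt_of [Finite S] {k z y : ℕ} (h : C.Evt x k z y) (hy : C.IsRep x k y) :
    C.idx x (k + 1) z < C.idx x k y := by
  have hz : z ≤ k := by have := h.1; have := hy.1; omega
  exact lt_of_le_of_lt (idx_succ_le hz) (idx_lt (h.2.1.pred hz) hy h.1)

theorem evt_infinite [Finite S] (N : ℕ) : ∃ k, N ≤ k ∧ ∃ z y, C.Evt x k z y := by
  by_contra hcon
  push Not at hcon
  have hrep : ∀ y, N < y → ∀ k, y ≤ k → C.IsRep x k y := by
    intro y hy k hk
    induction k, hk using Nat.le_induction with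
    | base =>
      by_contra hn
      obtain ⟨y', rfl⟩ : ∃ y', y = y' + 1 := ⟨y - 1, by omega⟩
      obtain ⟨z, hz⟩ := evt_of_die (Or.inr rfl) hn
      exact hcon y' (by omega) z _ hz
    | succ k hk ih =>
      by_contra hn
      obtain ⟨z, hz⟩ := evt_of_die (Or.inl ih) hn
      exact hcon k (by omega) z _ hz
  choose l hl using fun i => ultra_finite (Filter.hyperfilter ℕ) (fun k => C.run x i k)
  obtain ⟨a, b, hab, e⟩ := Finite.exists_ne_map_eq_of_infinite (fun i => l (i + N + 1))
  obtain ⟨k, hk, h1, h2⟩ := ultra_gt ((hl (a + N + 1)).and (hl (b + N + 1))) (a + b + N + 1)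
  have := (hrep (a + N + 1) (by omega) k (by omega)).eq (hrep (b + N + 1) (by omega) k (by omega))
    (h1.trans (e.trans h2.symm))
  omega

/-- Events into a fixed representative, with a fixed flag, give the type of the word. -/
theorem hasType_of_evt (z : ℕ) (u m : S)
    (h : ∀ N, ∃ k, N ≤ k ∧ ∃ y, C.Evt x k z y ∧ C.run x 0 y = u ∧ C.run x z y = m) :
    C.HasType x u m := by
  have hb : ∀ y, ∃ K, ∀ k, K ≤ k → ¬ C.Evt x k z y := by
    intro y
    by_cases he : ∃ k, C.Evt x k z y
    · obtain ⟨k0, h0⟩ := he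
      refine ⟨k0 + 1, fun k hk h' => ?_⟩
      have h1 := not_rep_mono h0.le h0.die hk
      rcases h'.2.2.1 with h2 | h2
      · exact h1 h2
      · have := h0.le; omega
    · push Not at he
      exact ⟨0, fun k _ => he k⟩
  choose K hK using hb
  have hy : ∀ N, ∃ y k, N < y ∧ C.Evt x k z y ∧ C.run x 0 y = u ∧ C.run x z y = m := by
    intro N
    obtain ⟨k, hk, y, h1, h2⟩ := h ((Finset.range (N + 1)).sup K)
    refine ⟨y, k, ?_, h1, h2⟩
    by_contra hn
    exact hK y k (le_trans (Finset.le_sup (f := K) (Finset.mem_range.2 (by omega))) hk) h1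
  choose f g hf he hu hm using hy
  let c : ℕ → ℕ := fun n => Nat.rec 0 (fun _ N => max (f N) (g N + 1)) n
  have hc : ∀ n, c (n + 1) = max (f (c n)) (g (c n) + 1) := fun n => rfl
  refine ⟨fun n => f (c n), strictMono_nat_of_lt_succ fun n => ?_, ?_, hu _, fun a => ?_⟩
  · have := hf (c (n + 1))
    rw [hc n] at this ⊢
    omega
  · have := hf (c 0); show 0 < f (c 0); omega
  · have h1 := hf (c (a + 1))
    have h2 := hc a
    have h3 := (he (c a))
    have h4 := h3.1
    show C.run x (f (c a)) (f (c (a + 1))) = m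
    rw [← hm (c (a + 1))]
    exact (C.run_merge x (k := g (c a) + 1) (by have := h3.2.1.1; omega) h3.le (by omega)
      h3.2.2.2).symm

/-- Semantic colour of step `k`. -/
noncomputable def colour (C : Clf A S) (x : ℕ → A) (Acc : S → S → Prop) (k : ℕ) : ℕ :=
  open Classical in
  if ∃ z y, C.Evt x k z y then
    2 * sInf {j | ∃ z y, C.Evt x k z y ∧ C.idx x (k + 1) z = j} +
      if ∃ z y, C.Evt x k z y ∧
        C.idx x (k + 1) z = sInf {j | ∃ z y, C.Evt x k z y ∧ C.idx x (k + 1) z = j} ∧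
        Acc (C.run x 0 y) (C.run x z y) then 0 else 1
  else 2 * Nat.card S + 2

theorem colour_spec [Finite S] (L : Set (ℕ → A)) (hL : C.Recog L) :
    ∃ p, (Even p ↔ x ∈ L) ∧
      ParLim (C.colour x (fun u m => ∃ w ∈ L, C.HasType w u m)) p := by
  classical
  set Acc : S → S → Prop := fun u m => ∃ w ∈ L, C.HasType w u m with hAcc
  -- least index with infinitely many events
  have hj : ∃ j, ∀ N, ∃ k, N ≤ k ∧ ∃ z y, C.Evt x k z y ∧ C.idx x (k + 1) z = j := by
    by_contra hcon
    push Not at hcon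
    choose N hN using hcon
    obtain ⟨k, hk, z, y, he⟩ := evt_infinite (C := C) (x := x)
      ((Finset.range (Nat.card S + 1)).sup N)
    exact hN (C.idx x (k + 1) z) k (le_trans (Finset.le_sup (f := N)
      (Finset.mem_range.2 (by have := idx_le_card (C := C) (x := x) (k + 1) z; omega))) hk)
      z y he rfl
  set j := Nat.find hj with hjd
  have hj1 := Nat.find_spec hj
  rw [← hjd] at hj1
  have hj2 : ∃ N, ∀ k, N ≤ k → ∀ z y, C.Evt x k z y → j ≤ C.idx x (k + 1) z := by
    have : ∀ i, ∃ N, i < j → ∀ k, N ≤ k → ∀ z y, C.Evt x k z y → C.idx x (k + 1) z ≠ i := by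
      intro i
      by_cases hi : i < j
      · have := Nat.find_min hj hi
        push Not at this
        obtain ⟨N, hN⟩ := this
        exact ⟨N, fun _ => hN⟩
      · exact ⟨0, fun h => absurd h hi⟩
    choose N hN using this
    refine ⟨(Finset.range j).sup N, fun k hk z y he => ?_⟩
    by_contra hlt
    exact hN _ (by omega) k (le_trans (Finset.le_sup (f := N)
      (Finset.mem_range.2 (by omega))) hk) z y he rfl
  obtain ⟨N, hN⟩ := hj2
  obtain ⟨k0, hk0, z, y0, he0, hi0⟩ := hj1 N
  -- z is permanent
  have hperm : ∀ k, k0 + 1 ≤ k → z ≤ k ∧ C.IsRep x k z ∧ C.idx x k z = j := by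
    intro k hk
    induction k, hk using Nat.le_induction with
    | base => exact ⟨he0.2.1.1, he0.2.1, hi0⟩
    | succ k hk ih =>
      obtain ⟨h1, h2, h3⟩ := ih
      have hs : ∀ w, w ≤ z → C.IsRep x k w → C.IsRep x (k + 1) w := by
        intro w hw hr
        by_contra hn
        obtain ⟨z', he⟩ := evt_of_die (Or.inl hr) hn
        have h4 := he.idx_lt_of hr
        have h5 := hN k (by omega) _ _ he
        have h6 : C.idx x k w ≤ C.idx x k z := by
          rcases eq_or_lt_of_le hw with rfl | hw
          · exact le_refl _
          · exact (idx_lt hr h2 hw).le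
        omega
      refine ⟨by omega, hs z le_rfl h2, le_antisymm ?_ ?_⟩
      · rw [← h3]; exact idx_succ_le h1
      · rw [← h3]; exact idx_le_succ h1 (fun w hw => hs w hw.le)
  have hz : ∀ k, k0 ≤ k → ∀ z' y, C.Evt x k z' y → C.idx x (k + 1) z' = j → z' = z := by
    intro k hk z' y he hi
    obtain ⟨-, h2, h3⟩ := hperm (k + 1) (by omega)
    rcases lt_trichotomy z' z with h | h | h
    · have := idx_lt he.2.1 h2 h; omega
    · exact h
    · have := idx_lt h2 he.2.1 h; omega
  -- all late flags agree with membership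
  have hflag : ∃ K, ∀ k, K ≤ k → ∀ y, C.Evt x k z y →
      (Acc (C.run x 0 y) (C.run x z y) ↔ x ∈ L) := by
    by_contra hcon
    push Not at hcon
    have : ∃ um : S × S, ∀ N, ∃ k, N ≤ k ∧ ∃ y, C.Evt x k z y ∧ C.run x 0 y = um.1 ∧
        C.run x z y = um.2 ∧ ¬ (Acc um.1 um.2 ↔ x ∈ L) := by
      by_contra hc2
      push Not at hc2
      choose N hN using hc2
      cases nonempty_fintype S
      obtain ⟨k, hk, y, he, hne⟩ := hcon (Finset.univ.sup N)
      have := hN (C.run x 0 y, C.run x z y) k (le_trans (Finset.le_sup (f := N)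
        (Finset.mem_univ _)) hk) y he rfl rfl
      rcases hne with ⟨h1, h2⟩ | ⟨h1, h2⟩
      · exact h2 (this.1 h1)
      · exact h1 (this.2 h2)
    obtain ⟨⟨u, m⟩, hum⟩ := this
    have ht : C.HasType x u m := by
      apply hasType_of_evt z
      intro N
      obtain ⟨k, hk, y, h1, h2, h3, -⟩ := hum N
      exact ⟨k, hk, y, h1, h2, h3⟩
    obtain ⟨-, -, -, -, -, -, hne⟩ := hum 0
    apply hne
    constructor
    · rintro ⟨w, hw, hwt⟩
      exact hL _ _ _ _ hwt ht hw
    · intro hx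
      exact ⟨x, hx, ht⟩
  obtain ⟨K, hK⟩ := hflag
  have hjc : j ≤ Nat.card S := by rw [← hi0]; exact idx_le_card _ _
  -- the infimum
  have hinf : ∀ k, max k0 K ≤ k → (∃ z y, C.Evt x k z y) →
      j ≤ sInf {j | ∃ z y, C.Evt x k z y ∧ C.idx x (k + 1) z = j} := by
    intro k hk ⟨z', y', he⟩
    have hne : {j | ∃ z y, C.Evt x k z y ∧ C.idx x (k + 1) z = j}.Nonempty := ⟨_, z', y', he, rfl⟩
    obtain ⟨z2, y2, he2, e⟩ := Nat.sInf_mem hne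
    rw [← e]
    exact hN k (by omega) _ _ he2
  have hcol1 : ∀ k, max k0 K ≤ k →
      (∃ z y, C.Evt x k z y ∧ C.idx x (k + 1) z = j) →
      C.colour x Acc k = 2 * j + if x ∈ L then 0 else 1 := by
    rintro k hk ⟨z', y', he, hi⟩
    have hs : sInf {j | ∃ z y, C.Evt x k z y ∧ C.idx x (k + 1) z = j} = j :=
      le_antisymm (Nat.sInf_le ⟨z', y', he, hi⟩) (hinf k hk ⟨z', y', he⟩)
    unfold colour
    rw [if_pos ⟨z', y', he⟩, hs]
    congr 1
    have hz' := hz k (by omega) z' y' he hi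
    subst hz'
    have : (∃ z y, C.Evt x k z y ∧ C.idx x (k + 1) z = j ∧ Acc (C.run x 0 y) (C.run x z y)) ↔
        x ∈ L := by
      constructor
      · rintro ⟨z2, y2, he2, hi2, ha⟩
        have := hz k (by omega) z2 y2 he2 hi2
        subst this
        exact (hK k (by omega) _ he2).1 ha
      · intro hx
        exact ⟨z', y', he, hi, (hK k (by omega) _ he).2 hx⟩
    simp only [this]
  refine ⟨2 * j + if x ∈ L then 0 else 1, ?_, ?_, ?_⟩
  · split_ifs with h
    · simp [h]
    · simp [h]
  · intro M
    obtain ⟨k, hk, h⟩ := hj1 (max M (max k0 K))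
    exact ⟨k, by omega, hcol1 k (by omega) h⟩
  · refine ⟨max k0 K, fun k hk => ?_⟩
    by_cases h : ∃ z y, C.Evt x k z y ∧ C.idx x (k + 1) z = j
    · rw [hcol1 k hk h]
    · by_cases h2 : ∃ z y, C.Evt x k z y
      · have h3 := hinf k hk h2
        have h4 : sInf {j | ∃ z y, C.Evt x k z y ∧ C.idx x (k + 1) z = j} ≠ j := by
          intro e
          obtain ⟨z', y', he⟩ := h2
          have := Nat.sInf_mem (s := {j | ∃ z y, C.Evt x k z y ∧ C.idx x (k + 1) z = j})
            ⟨_, z', y', he, rfl⟩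
          rw [e] at this
          exact h this
        unfold colour
        rw [if_pos h2]
        split_ifs <;> omega
      · unfold colour
        rw [if_neg h2]
        split_ifs <;> omega

end det
end Clf
end Stmt9

namespace Stmt9
namespace Clf
section det2
variable {A S : Type} (C : Clf A S)

abbrev Tab (S : Type) := Set (S × S × Prop × S × S)

abbrev DSt (S : Type) := Tab S × S × Fin (2 * Nat.card S + 3)

def tab (x : ℕ → A) (k : ℕ) : Tab S := {q | ∃ z z', C.Fst x k q.1 z ∧ C.Fst x k q.2.1 z' ∧
  q.2.2.1 = (z < z') ∧ q.2.2.2.1 = C.run x 0 z' ∧ q.2.2.2.2 = C.run x z z'}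

def tpres (T : Tab S) (s : S) : Prop := ∃ b u m, (s, s, b, u, m) ∈ T
def told (T : Tab S) (s s' : S) : Prop := ∃ u m, (s, s', True, u, m) ∈ T
def tsurv (T : Tab S) (a : A) (s : S) : Prop :=
  tpres T s ∧ ∀ s', told T s' s → C.step s' a ≠ C.step s a
def tfresh (T : Tab S) (a : A) : Prop := ∀ s, tpres T s → C.step s a ≠ C.ini

def tstep (T : Tab S) (u0 : S) (a : A) : Tab S := {q |
  (∃ s s', C.tsurv T a s ∧ C.tsurv T a s' ∧ q.1 = C.step s a ∧ q.2.1 = C.step s' a ∧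
    (s, s', q.2.2) ∈ T) ∨
  (C.tfresh T a ∧ ∃ s, C.tsurv T a s ∧ q = (C.step s a, C.ini, True, C.step u0 a, C.step s a)) ∨
  (C.tfresh T a ∧ ∃ s u, C.tsurv T a s ∧ (∃ b m, (s, s, b, u, m) ∈ T) ∧
    q = (C.ini, C.step s a, False, u, C.ini)) ∨
  (C.tfresh T a ∧ q = (C.ini, C.ini, False, C.step u0 a, C.ini))}

/-- index and flags of events -/
def tevt (T : Tab S) (u0 : S) (a : A) (j : ℕ) (u m : S) : Prop :=
  ∃ s, C.tsurv T a s ∧ Set.ncard {t | told (C.tstep T u0 a) t (C.step s a)} = j ∧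
    ((∃ s', C.step s' a = C.step s a ∧ (s, s', True, u, m) ∈ T) ∨
      (C.step s a = C.ini ∧ u = C.step u0 a ∧ m = C.ini))

noncomputable def tcol (Acc : S → S → Prop) (T : Tab S) (u0 : S) (a : A) : ℕ :=
  open Classical in
  if ∃ j u m, C.tevt T u0 a j u m then
    2 * sInf {j | ∃ u m, C.tevt T u0 a j u m} +
      if ∃ u m, C.tevt T u0 a (sInf {j | ∃ u m, C.tevt T u0 a j u m}) u m ∧ Acc u m then 0 else 1
  else 2 * Nat.card S + 2

variable {C} (x : ℕ → A)

theorem pres_iff (k : ℕ) (s : S) : tpres (C.tab x k) s ↔ ∃ z, C.Fst x k s z := by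
  constructor
  · rintro ⟨b, u, m, z, z', h, -⟩; exact ⟨z, h⟩
  · rintro ⟨z, h⟩; exact ⟨_, _, _, z, z, h, h, rfl, rfl, rfl⟩

theorem Fst.eq {k : ℕ} {s : S} {z z' : ℕ} (h : C.Fst x k s z) (h' : C.Fst x k s z') : z = z' :=
  h.1.eq h'.1 (h.2.trans h'.2.symm)

theorem old_iff (k : ℕ) (s s' : S) :
    told (C.tab x k) s s' ↔ ∃ z z', C.Fst x k s z ∧ C.Fst x k s' z' ∧ z < z' := by
  constructor
  · rintro ⟨u, m, z, z', h, h', hb, -⟩; exact ⟨z, z', h, h', of_eq_true hb.symm⟩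
  · rintro ⟨z, z', h, h', hb⟩; exact ⟨_, _, z, z', h, h', (eq_true hb).symm, rfl, rfl⟩

theorem surv_iff {k : ℕ} {s : S} {z : ℕ} (h : C.Fst x k s z) :
    C.tsurv (C.tab x k) (x k) s ↔ C.IsRep x (k + 1) z := by
  have hz := h.1.1
  constructor
  · rintro ⟨-, h2⟩
    refine ⟨by omega, fun j hj e => ?_⟩
    obtain ⟨w, hw, hr, e'⟩ := exists_rep (C := C) (x := x) (k := k) (y := j) (by omega)
    refine h2 (C.run x w k) ((old_iff x k _ _).2 ⟨w, z, ⟨hr, rfl⟩, h, by omega⟩) ?_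
    rw [← h.2, e', ← C.run_succ x (by omega), ← C.run_succ x hz, e]
  · intro hr
    refine ⟨(pres_iff x k s).2 ⟨z, h⟩, fun s' ho e => ?_⟩
    obtain ⟨w, z', hw, hz', hlt⟩ := (old_iff x k _ _).1 ho
    obtain rfl := h.eq x hz'
    apply hr.2 w hlt
    rw [C.run_succ x hw.1.1, C.run_succ x hz, hw.2, h.2, e]

theorem fresh_iff (k : ℕ) : C.tfresh (C.tab x k) (x k) ↔ C.IsRep x (k + 1) (k + 1) := by
  constructor
  · intro h
    refine ⟨le_rfl, fun j hj e => ?_⟩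
    obtain ⟨w, hw, hr, e'⟩ := exists_rep (C := C) (x := x) (k := k) (y := j) (by omega)
    refine h _ ((pres_iff x k _).2 ⟨w, hr, rfl⟩) ?_
    rw [e', ← C.run_succ x (by omega), e, C.run_of_le x le_rfl]
  · intro hr s hs e
    obtain ⟨z, hz⟩ := (pres_iff x k s).1 hs
    have := hz.1.1
    apply hr.2 z (by omega)
    rw [C.run_succ x this, hz.2, e, C.run_of_le x le_rfl]

theorem fst_succ (k : ℕ) (t : S) (z : ℕ) : C.Fst x (k + 1) t z ↔
    (∃ s, C.Fst x k s z ∧ C.tsurv (C.tab x k) (x k) s ∧ t = C.step s (x k)) ∨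
    (z = k + 1 ∧ C.tfresh (C.tab x k) (x k) ∧ t = C.ini) := by
  constructor
  · rintro ⟨hr, rfl⟩
    by_cases hz : z ≤ k
    · left
      have h1 : C.Fst x k (C.run x z k) z := ⟨hr.pred hz, rfl⟩
      exact ⟨_, h1, (surv_iff x h1).2 hr, C.run_succ x hz⟩
    · right
      have := hr.1
      obtain rfl : z = k + 1 := by omega
      exact ⟨rfl, (fresh_iff x k).2 hr, C.run_of_le x le_rfl⟩
  · rintro (⟨s, h1, h2, rfl⟩ | ⟨rfl, h2, rfl⟩)
    · exact ⟨(surv_iff x h1).1 h2, by rw [C.run_succ x h1.1.1, h1.2]⟩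
    · exact ⟨(fresh_iff x k).1 h2, C.run_of_le x le_rfl⟩

theorem tab_succ (k : ℕ) :
    C.tab x (k + 1) = C.tstep (C.tab x k) (C.run x 0 k) (x k) := by
  ext ⟨t, t', b, u, m⟩
  constructor
  · rintro ⟨z, z', h, h', hb, hu, hm⟩
    simp only at h h' hb hu hm
    rw [fst_succ] at h h'
    rcases h with ⟨s, h1, h2, rfl⟩ | ⟨rfl, h2, rfl⟩ <;>
    rcases h' with ⟨s', h1', h2', rfl⟩ | ⟨rfl, h2', rfl⟩
    · exact Or.inl ⟨s, s', h2, h2', rfl, rfl, z, z', h1, h1', hb, hu, hm⟩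
    · refine Or.inr (Or.inl ⟨h2', s, h2, ?_⟩)
      have := h1.1.1
      rw [hb, hu, hm, C.run_succ x (by omega), C.run_succ x this, h1.2]
      simp [this]
    · refine Or.inr (Or.inr (Or.inl ⟨h2, s', u, h2', ?_, ?_⟩))
      · exact ⟨_, _, z', z', h1', h1', rfl, hu, rfl⟩
      · have := h1'.1.1
        rw [hb, hm, C.run_of_le x (by omega)]
        simp; omega
    · refine Or.inr (Or.inr (Or.inr ⟨h2, ?_⟩))
      rw [hb, hu, hm, C.run_of_le x le_rfl, C.run_succ x (by omega)]
      simp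
  · rintro (⟨s, s', h, h', e1, e2, z, z', h1, h1', hb, hu, hm⟩ | ⟨hf, s, h, e⟩ |
      ⟨hf, s, u', h, ⟨b', m', z, z', h1, h1', hb, hu, hm⟩, e⟩ | ⟨hf, e⟩)
    · simp only at e1 e2 h1 h1' hb hu hm
      subst e1 e2
      exact ⟨z, z', (fst_succ x k _ _).2 (Or.inl ⟨s, h1, h, rfl⟩),
        (fst_succ x k _ _).2 (Or.inl ⟨s', h1', h', rfl⟩), hb, hu, hm⟩
    · obtain ⟨z, h1⟩ := (pres_iff x k s).1 h.1
      have := h1.1.1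
      simp only [Prod.mk.injEq] at e
      obtain ⟨rfl, rfl, rfl, rfl, rfl⟩ := e
      refine ⟨z, k + 1, (fst_succ x k _ _).2 (Or.inl ⟨s, h1, h, rfl⟩),
        (fst_succ x k _ _).2 (Or.inr ⟨rfl, hf, rfl⟩), ?_, ?_, ?_⟩
      · simp; omega
      · rw [C.run_succ x (by omega)]
      · simp only; rw [C.run_succ x this, h1.2]
    · simp only at h1 h1' hb hu hm
      obtain rfl := h1.eq x h1'
      have := h1.1.1
      simp only [Prod.mk.injEq] at e
      obtain ⟨rfl, rfl, rfl, rfl, rfl⟩ := e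
      refine ⟨k + 1, z, (fst_succ x k _ _).2 (Or.inr ⟨rfl, hf, rfl⟩),
        (fst_succ x k _ _).2 (Or.inl ⟨s, h1, h, rfl⟩), ?_, hu, ?_⟩
      · simp; omega
      · simp only; rw [C.run_of_le x (by omega)]
    · simp only [Prod.mk.injEq] at e
      obtain ⟨rfl, rfl, rfl, rfl, rfl⟩ := e
      refine ⟨k + 1, k + 1, (fst_succ x k _ _).2 (Or.inr ⟨rfl, hf, rfl⟩),
        (fst_succ x k _ _).2 (Or.inr ⟨rfl, hf, rfl⟩), ?_, ?_, ?_⟩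
      · simp
      · rw [C.run_succ x (by omega)]
      · simp only; rw [C.run_of_le x (by omega)]

theorem idx_tab {k : ℕ} {t : S} {z : ℕ} (h : C.Fst x k t z) :
    Set.ncard {s | told (C.tab x k) s t} = C.idx x k z := by
  unfold idx
  congr 1
  ext s
  simp only [Set.mem_ofPred_eq]
  rw [old_iff]
  constructor
  · rintro ⟨w, z', hw, hz', hl⟩
    obtain rfl := h.eq x hz'
    exact ⟨w, hl, hw⟩
  · rintro ⟨w, hl, hw⟩
    exact ⟨w, z, hw, h, hl⟩

theorem evt_tab (k : ℕ) (j : ℕ) (u m : S) :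
    C.tevt (C.tab x k) (C.run x 0 k) (x k) j u m ↔
      ∃ z y, C.Evt x k z y ∧ C.idx x (k + 1) z = j ∧ C.run x 0 y = u ∧ C.run x z y = m := by
  constructor
  · rintro ⟨s, hs, hj, h⟩
    obtain ⟨z, hz⟩ := (pres_iff x k s).1 hs.1
    have hz' : C.Fst x (k + 1) (C.step s (x k)) z :=
      (fst_succ x k _ _).2 (Or.inl ⟨s, hz, hs, rfl⟩)
    rw [← tab_succ, idx_tab x hz'] at hj
    have hzk := hz.1.1
    rcases h with ⟨s', e, z2, y, h1, h2, h3, h4, h5⟩ | ⟨h1, h2, h3⟩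
    · simp only at h1 h2 h3 h4 h5
      obtain rfl := hz.eq x h1
      refine ⟨z, y, ⟨of_eq_true h3.symm, hz'.1, Or.inl h2.1, ?_⟩, hj, h4.symm, h5.symm⟩
      rw [hz'.2, C.run_succ x h2.1.1, h2.2, e]
    · refine ⟨z, k + 1, ⟨by omega, hz'.1, Or.inr rfl, ?_⟩, hj, ?_, ?_⟩
      · rw [hz'.2, h1, C.run_of_le x le_rfl]
      · rw [h2, C.run_succ x (by omega)]
      · rw [hz'.2, h1, h3]
  · rintro ⟨z, y, ⟨hlt, hr, hy, e⟩, hj, hu, hm⟩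
    have hzk : z ≤ k := by
      rcases hy with hy | hy
      · have := hy.1; omega
      · omega
    have hz : C.Fst x k (C.run x z k) z := ⟨hr.pred hzk, rfl⟩
    have hz' : C.Fst x (k + 1) (C.step (C.run x z k) (x k)) z :=
      ⟨hr, C.run_succ x hzk⟩
    refine ⟨_, (surv_iff x hz).2 hr, ?_, ?_⟩
    · rw [← tab_succ, idx_tab x hz', hj]
    · rcases hy with hy | rfl
      · left
        refine ⟨C.run x y k, ?_, z, y, hz, ⟨hy, rfl⟩, (eq_true hlt).symm, hu.symm, hm.symm⟩
        rw [← C.run_succ x hzk, ← C.run_succ x hy.1, e]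
      · right
        rw [← C.run_succ x hzk, e, C.run_of_le x le_rfl]
        refine ⟨rfl, ?_, ?_⟩
        · rw [← hu, C.run_succ x (by omega)]
        · rw [← hm, e, C.run_of_le x le_rfl]

theorem tcol_eq (Acc : S → S → Prop) (k : ℕ) :
    C.tcol Acc (C.tab x k) (C.run x 0 k) (x k) = C.colour x Acc k := by
  have h1 : (∃ j u m, C.tevt (C.tab x k) (C.run x 0 k) (x k) j u m) ↔ ∃ z y, C.Evt x k z y := by
    simp only [evt_tab]
    constructor
    · rintro ⟨j, u, m, z, y, h, -⟩; exact ⟨z, y, h⟩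
    · rintro ⟨z, y, h⟩; exact ⟨_, _, _, z, y, h, rfl, rfl, rfl⟩
  have h2 : ∀ j, (∃ u m, C.tevt (C.tab x k) (C.run x 0 k) (x k) j u m) ↔
      ∃ z y, C.Evt x k z y ∧ C.idx x (k + 1) z = j := by
    intro j
    simp only [evt_tab]
    constructor
    · rintro ⟨u, m, z, y, h, h', -⟩; exact ⟨z, y, h, h'⟩
    · rintro ⟨z, y, h, h'⟩; exact ⟨_, _, z, y, h, h', rfl, rfl⟩
  have h3 : ∀ j, (∃ u m, C.tevt (C.tab x k) (C.run x 0 k) (x k) j u m ∧ Acc u m) ↔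
      ∃ z y, C.Evt x k z y ∧ C.idx x (k + 1) z = j ∧ Acc (C.run x 0 y) (C.run x z y) := by
    intro j
    simp only [evt_tab]
    constructor
    · rintro ⟨u, m, ⟨z, y, h, h', rfl, rfl⟩, ha⟩; exact ⟨z, y, h, h', ha⟩
    · rintro ⟨z, y, h, h', ha⟩; exact ⟨_, _, ⟨z, y, h, h', rfl, rfl⟩, ha⟩
  unfold tcol colour
  have hs : {j | ∃ u m, C.tevt (C.tab x k) (C.run x 0 k) (x k) j u m} =
      {j | ∃ z y, C.Evt x k z y ∧ C.idx x (k + 1) z = j} := by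
    ext j; exact h2 j
  rw [hs]
  classical
  exact if_congr h1 (congrArg _ (if_congr (h3 _) rfl rfl)) rfl

end det2

/-- The deterministic parity automaton. -/
noncomputable def dauto {A S : Type} (C : Clf A S) (Acc : S → S → Prop) : Clf A (DSt S) where
  ini := ({q | q.1 = C.ini ∧ q.2.1 = C.ini ∧ q.2.2.1 = False ∧ q.2.2.2.1 = C.ini ∧
    q.2.2.2.2 = C.ini}, C.ini, 0)
  step := fun d a => (C.tstep d.1 d.2.1 a, C.step d.2.1 a, Fin.ofNat _ (C.tcol Acc d.1 d.2.1 a))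

theorem dauto_run {A S : Type} (C : Clf A S) (Acc : S → S → Prop) (x : ℕ → A) (k : ℕ) :
    ((C.dauto Acc).run x 0 k).1 = C.tab x k ∧ ((C.dauto Acc).run x 0 k).2.1 = C.run x 0 k := by
  induction k with
  | zero =>
    refine ⟨?_, rfl⟩
    ext ⟨t, t', b, u, m⟩
    show (t = C.ini ∧ t' = C.ini ∧ b = False ∧ u = C.ini ∧ m = C.ini) ↔ _
    have hr : C.IsRep x 0 0 := ⟨le_rfl, fun j hj => absurd hj (by omega)⟩
    constructor
    · rintro ⟨rfl, rfl, rfl, rfl, rfl⟩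
      exact ⟨0, 0, ⟨hr, rfl⟩, ⟨hr, rfl⟩, by simp, rfl, rfl⟩
    · rintro ⟨z, z', ⟨h1, h2⟩, ⟨h3, h4⟩, hb, hu, hm⟩
      obtain rfl : z = 0 := by have := h1.1; omega
      obtain rfl : z' = 0 := by have := h3.1; omega
      simp only at h2 h4 hb hu hm
      exact ⟨h2.symm, h4.symm, by simp [hb], hu, hm⟩
  | succ k ih =>
    rw [Clf.run_succ _ x (Nat.zero_le k), C.run_succ x (Nat.zero_le k), tab_succ, ← ih.1, ← ih.2]
    exact ⟨rfl, rfl⟩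

theorem colour_lt {A S : Type} [Finite S] (C : Clf A S) (Acc : S → S → Prop) (x : ℕ → A) (k : ℕ) :
    C.colour x Acc k < 2 * Nat.card S + 3 := by
  unfold colour
  by_cases h : ∃ z y, C.Evt x k z y
  · rw [if_pos h]
    obtain ⟨z, y, he⟩ := h
    have : sInf {j | ∃ z y, C.Evt x k z y ∧ C.idx x (k + 1) z = j} ≤ Nat.card S :=
      le_trans (Nat.sInf_le ⟨z, y, he, rfl⟩) (idx_le_card _ _)
    split_ifs <;> omega
  · rw [if_neg h]; omega

theorem determinize {A S : Type} [Finite S] (C : Clf A S) (L : Set (ℕ → A)) (hL : C.Recog L) :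
    ∃ (D : Clf A (DSt S)) (pr : DSt S → ℕ), ∀ x, ∃ p, (Even p ↔ x ∈ L) ∧
      ParLim (fun k => pr (D.run x 0 k)) p := by
  refine ⟨C.dauto (fun u m => ∃ w ∈ L, C.HasType w u m), fun d => d.2.2, fun x => ?_⟩
  set Acc : S → S → Prop := fun u m => ∃ w ∈ L, C.HasType w u m
  obtain ⟨p, h1, h2, N, h3⟩ := colour_spec (C := C) (x := x) L hL
  have hcol : ∀ k, (((C.dauto Acc).run x 0 (k + 1)).2.2 : ℕ) = C.colour x Acc k := by
    intro k
    rw [Clf.run_succ _ x (Nat.zero_le k), ← tcol_eq, ← (dauto_run C Acc x k).1,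
      ← (dauto_run C Acc x k).2]
    show C.tcol Acc _ _ _ % _ = _
    apply Nat.mod_eq_of_lt
    rw [(dauto_run C Acc x k).1, (dauto_run C Acc x k).2, tcol_eq]
    exact colour_lt C Acc x k
  refine ⟨p, h1, fun M => ?_, N + 1, fun k hk => ?_⟩
  · obtain ⟨k, hk, e⟩ := h2 M
    exact ⟨k + 1, by omega, (hcol k).trans e⟩
  · obtain ⟨k, rfl⟩ : ∃ k', k = k' + 1 := ⟨k - 1, by omega⟩
    have := h3 k (by omega)
    exact le_trans this (hcol k).ge

end Clf
end Stmt9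

namespace Stmt9

/-! ## Positional determinacy of finite parity games -/

theorem ParLim.shift {c : ℕ → ℕ} {p : ℕ} (h : ParLim c p) (n : ℕ) :
    ParLim (fun k => c (k + n)) p := by
  obtain ⟨h1, N, h2⟩ := h
  refine ⟨fun M => ?_, N, fun k hk => h2 _ (by omega)⟩
  obtain ⟨k, hk, e⟩ := h1 (M + n)
  exact ⟨k - n, by omega, by show c (k - n + n) = p; rw [Nat.sub_add_cancel (by omega)]; exact e⟩

section game
variable {U : Type} (own : U → Bool) (R : U → U → Prop)

def AttN (i : Bool) (X T : Set U) : ℕ → U → Prop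
  | 0, v => v ∈ T
  | n + 1, v => v ∈ T ∨ (v ∈ X ∧ own v = i ∧ ∃ v' ∈ X, R v v' ∧ AttN i X T n v') ∨
      (v ∈ X ∧ own v ≠ i ∧ ∀ v' ∈ X, R v v' → AttN i X T n v')

variable {own R}

theorem attN_succ {i : Bool} {X T : Set U} (n : ℕ) :
    ∀ {v : U}, AttN own R i X T n v → AttN own R i X T (n + 1) v := by
  induction n with
  | zero => intro v h; exact Or.inl h
  | succ n ih =>
    intro v h
    rcases h with h | ⟨h1, h2, v', h3, h4, h5⟩ | ⟨h1, h2, h3⟩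
    · exact Or.inl h
    · exact Or.inr (Or.inl ⟨h1, h2, v', h3, h4, ih h5⟩)
    · exact Or.inr (Or.inr ⟨h1, h2, fun v' h h' => ih (h3 v' h h')⟩)

theorem attN_mono {i : Bool} {X T : Set U} {n m : ℕ} (hnm : n ≤ m) {v : U}
    (h : AttN own R i X T n v) : AttN own R i X T m v := by
  induction m, hnm using Nat.le_induction with
  | base => exact h
  | succ m _ ih => exact attN_succ m ih

theorem attractor [Finite U] (own : U → Bool) (R : U → U → Prop) (i : Bool) (X T : Set U)
    (hT : T ⊆ X) :
    ∃ (A : Set U) (s : U → U) (rk : U → ℕ), T ⊆ A ∧ A ⊆ X ∧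
      (∀ v ∈ A, v ∉ T → own v = i → R v (s v) ∧ s v ∈ A ∧ rk (s v) < rk v) ∧
      (∀ v ∈ A, v ∉ T → own v ≠ i → ∀ v' ∈ X, R v v' → v' ∈ A ∧ rk v' < rk v) ∧
      (∀ v ∈ X, v ∉ A → own v = i → ∀ v' ∈ X, R v v' → v' ∉ A) ∧
      (∀ v ∈ X, v ∉ A → own v ≠ i → ∃ v' ∈ X, R v v' ∧ v' ∉ A) := by
  classical
  cases nonempty_fintype U
  let A : Set U := {v | ∃ n, AttN own R i X T n v}
  let rk : U → ℕ := fun v => if h : ∃ n, AttN own R i X T n v then Nat.find h else 0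
  have hrk : ∀ v, v ∈ A → AttN own R i X T (rk v) v := by
    intro v hv
    show AttN own R i X T (if h : ∃ n, AttN own R i X T n v then Nat.find h else 0) v
    have hv' : ∃ n, AttN own R i X T n v := hv
    rw [dif_pos hv']; exact Nat.find_spec hv'
  have hrk2 : ∀ v n, AttN own R i X T n v → rk v ≤ n := by
    intro v n hv
    show (if h : ∃ n, AttN own R i X T n v then Nat.find h else 0) ≤ n
    rw [dif_pos ⟨n, hv⟩]; exact Nat.find_min' _ hv
  have hkey : ∀ v, v ∈ A → v ∉ T → ∃ n, rk v = n + 1 ∧ AttN own R i X T (n + 1) v := by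
    intro v hv hvT
    have := hrk v hv
    cases hn : rk v with
    | zero => rw [hn] at this; exact absurd this hvT
    | succ n => rw [hn] at this; exact ⟨n, rfl, this⟩
  have hs : ∀ v, ∃ v', v ∈ A → v ∉ T → own v = i → R v v' ∧ v' ∈ A ∧ rk v' < rk v := by
    intro v
    by_cases h : v ∈ A ∧ v ∉ T ∧ own v = i
    · obtain ⟨h1, h2, h3⟩ := h
      obtain ⟨n, hn, ha⟩ := hkey v h1 h2
      rcases ha with h | ⟨-, -, v', h4, h5, h6⟩ | ⟨-, h4, -⟩
      · exact absurd h h2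
      · exact ⟨v', fun _ _ _ => ⟨h5, ⟨n, h6⟩, by have := hrk2 _ _ h6; omega⟩⟩
      · exact absurd h3 h4
    · exact ⟨v, fun h1 h2 h3 => absurd ⟨h1, h2, h3⟩ h⟩
  choose s hs using hs
  refine ⟨A, s, rk, fun v hv => ⟨0, hv⟩, ?_, hs, ?_, ?_, ?_⟩
  · rintro v ⟨n, hn⟩
    cases n with
    | zero => exact hT hn
    | succ n =>
      rcases hn with h | ⟨h, -⟩ | ⟨h, -⟩
      · exact hT h
      · exact h
      · exact h
  · intro v h1 h2 h3 v' h4 h5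
    obtain ⟨n, hn, ha⟩ := hkey v h1 h2
    rcases ha with h | ⟨-, h, -⟩ | ⟨-, -, h⟩
    · exact absurd h h2
    · exact absurd h h3
    · have := h v' h4 h5
      exact ⟨⟨n, this⟩, by have := hrk2 _ _ this; omega⟩
  · rintro v h1 h2 h3 v' h4 h5 ⟨n, h6⟩
    exact h2 ⟨n + 1, Or.inr (Or.inl ⟨h1, h3, v', h4, h5, h6⟩)⟩
  · intro v h1 h2 h3
    by_contra hcon
    push Not at hcon
    refine h2 ⟨Finset.univ.sup rk + 1, Or.inr (Or.inr ⟨h1, h3, fun v' h4 h5 => ?_⟩)⟩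
    exact attN_mono (Finset.le_sup (f := rk) (Finset.mem_univ v')) (hrk v' (hcon v' h4 h5))

/-- Along a consistent play inside `X` starting in the attractor, the target is reached. -/
theorem attractor_reach {i : Bool} {X T A : Set U} {s : U → U} {rk : U → ℕ}
    (h1 : ∀ v ∈ A, v ∉ T → own v = i → R v (s v) ∧ s v ∈ A ∧ rk (s v) < rk v)
    (h2 : ∀ v ∈ A, v ∉ T → own v ≠ i → ∀ v' ∈ X, R v v' → v' ∈ A ∧ rk v' < rk v)
    (c : ℕ → U) (hX : ∀ k, c k ∈ X) (hR : ∀ k, R (c k) (c (k + 1)))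
    (hc : ∀ k, c k ∈ A → c k ∉ T → own (c k) = i → c (k + 1) = s (c k)) :
    ∀ (n k : ℕ), rk (c k) ≤ n → c k ∈ A → ∃ k', k ≤ k' ∧ c k' ∈ T := by
  intro n
  induction n with
  | zero =>
    intro k hk hA
    by_cases hT : c k ∈ T
    · exact ⟨k, le_rfl, hT⟩
    · by_cases ho : own (c k) = i
      · have := (h1 _ hA hT ho).2.2; omega
      · have := (h2 _ hA hT ho _ (hX (k + 1)) (hR k)).2; omega
  | succ n ih =>
    intro k hk hA
    by_cases hT : c k ∈ T
    · exact ⟨k, le_rfl, hT⟩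
    · have : c (k + 1) ∈ A ∧ rk (c (k + 1)) < rk (c k) := by
        by_cases ho : own (c k) = i
        · rw [hc k hA hT ho]; exact (h1 _ hA hT ho).2
        · exact h2 _ hA hT ho _ (hX (k + 1)) (hR k)
      obtain ⟨k', hk', h⟩ := ih (k + 1) (by omega) this.1
      exact ⟨k', by omega, h⟩

variable (own R)

/-- `w` assigns the winner and `s` is a positional winning strategy for both players, on `X`. -/
structure Solves (pr : U → ℕ) (X : Set U) (w : U → Bool) (s : U → U) : Prop where
  mine : ∀ v ∈ X, own v = w v → R v (s v) ∧ s v ∈ X ∧ w (s v) = w v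
  other : ∀ v ∈ X, own v ≠ w v → ∀ v' ∈ X, R v v' → w v' = w v
  win : ∀ c : ℕ → U, (∀ k, c k ∈ X) → (∀ k, R (c k) (c (k + 1))) →
    (∀ k, own (c k) = w (c k) → c (k + 1) = s (c k)) → ∀ p, ParLim (fun k => pr (c k)) p →
    (Even p ↔ w (c 0) = true)

variable {own R}

theorem Solves.const {pr : U → ℕ} {X : Set U} {w : U → Bool} {s : U → U}
    (mine : ∀ v ∈ X, own v = w v → R v (s v) ∧ s v ∈ X ∧ w (s v) = w v)
    (other : ∀ v ∈ X, own v ≠ w v → ∀ v' ∈ X, R v v' → w v' = w v)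
    (c : ℕ → U) (hX : ∀ k, c k ∈ X) (hR : ∀ k, R (c k) (c (k + 1)))
    (hc : ∀ k, own (c k) = w (c k) → c (k + 1) = s (c k)) (k : ℕ) : w (c k) = w (c 0) := by
  induction k with
  | zero => rfl
  | succ k ih =>
    rw [← ih]
    by_cases ho : own (c k) = w (c k)
    · rw [hc k ho]; exact (mine _ (hX k) ho).2.2
    · exact other _ (hX k) ho _ (hX (k + 1)) (hR k)

theorem zielonka [Finite U] (own : U → Bool) (R : U → U → Prop) (pr : U → ℕ) :
    ∀ (n : ℕ) (X : Set U), X.ncard ≤ n → (∀ v ∈ X, ∃ v' ∈ X, R v v') →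
      ∃ w s, Solves own R pr X w s := by
  classical
  intro n
  induction n with
  | zero =>
    intro X hX _
    have : X = ∅ := (Set.ncard_eq_zero (Set.toFinite _)).1 (by omega)
    subst this
    exact ⟨fun _ => true, id, fun v hv => absurd hv (by simp), fun v hv => absurd hv (by simp),
      fun c hc => absurd (hc 0) (by simp)⟩
  | succ n ih =>
    intro X hXn htot
    by_cases hne : X.Nonempty
    swap
    · exact ih X (by rw [Set.not_nonempty_iff_eq_empty.1 hne]; simp) htot
    -- minimal colour
    obtain ⟨v0, hv0, hmin⟩ := Set.exists_min_image X pr (Set.toFinite _) hne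
    set p := pr v0 with hp
    set i : Bool := decide (Even p) with hi
    have hip : ∀ b : Bool, b = i → (Even p ↔ b = true) := by
      rintro _ rfl; simp [hi]
    let N : Set U := {v | v ∈ X ∧ pr v = p}
    obtain ⟨A, sA, rA, hNA, hAX, hA1, hA2, hA3, hA4⟩ :=
      attractor own R i X N (fun v hv => hv.1)
    have hv0A : v0 ∈ A := hNA ⟨hv0, rfl⟩
    obtain ⟨w1, s1, H1⟩ := ih (X \ A)
      (by
        have : (X \ A).ncard < X.ncard := Set.ncard_lt_ncard
          ⟨Set.sdiff_subset, fun h => (h hv0).2 hv0A⟩ (Set.toFinite _)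
        omega)
      (by
        rintro v ⟨hv, hvA⟩
        by_cases ho : own v = i
        · obtain ⟨v', hv', hr⟩ := htot v hv
          exact ⟨v', ⟨hv', hA3 v hv hvA ho v' hv' hr⟩, hr⟩
        · obtain ⟨v', hv', hr, hn⟩ := hA4 v hv hvA ho
          exact ⟨v', ⟨hv', hn⟩, hr⟩)
    by_cases hY : ∀ v ∈ X \ A, w1 v = i
    · -- player i wins everywhere
      choose sX hsX using htot
      let s : U → U := fun v => if h : v ∈ N then sX v h.1 else if v ∈ A then sA v else s1 v
      refine ⟨fun _ => i, s, ?_, fun _ _ _ _ _ _ => rfl, ?_⟩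
      · intro v hv ho
        by_cases h1 : v ∈ N
        · have e : s v = sX v h1.1 := dif_pos h1
          rw [e]; exact ⟨(hsX v h1.1).2, (hsX v h1.1).1, rfl⟩
        · by_cases h2 : v ∈ A
          · have e : s v = sA v := by simp only [s]; rw [dif_neg h1, if_pos h2]
            rw [e]; exact ⟨(hA1 v h2 h1 ho).1, hAX (hA1 v h2 h1 ho).2.1, rfl⟩
          · have e : s v = s1 v := by simp only [s]; rw [dif_neg h1, if_neg h2]
            rw [e]
            have := H1.mine v ⟨hv, h2⟩ (by rw [hY v ⟨hv, h2⟩, ho])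
            exact ⟨this.1, this.2.1.1, rfl⟩
      · intro c hX hR hc q hq
        by_cases hinf : ∀ M, ∃ k, M ≤ k ∧ c k ∈ A
        · -- colour p infinitely often
          have hqp : q = p := by
            apply hq.unique
            refine ⟨fun M => ?_, 0, fun k _ => hmin _ (hX k)⟩
            obtain ⟨k, hk, hkA⟩ := hinf M
            obtain ⟨k', hk', h⟩ := attractor_reach hA1 hA2 c hX hR
              (by
                intro k h1 h2 h3
                rw [hc k h3]
                simp only [s]; rw [dif_neg h2, if_pos h1]) _ k le_rfl hkA
            exact ⟨k', by omega, h.2⟩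
          rw [hqp]; exact hip _ rfl
        · push Not at hinf
          obtain ⟨M, hM⟩ := hinf
          have := H1.win (fun k => c (k + M)) (fun k => ⟨hX _, hM _ (by omega)⟩)
            (fun k => by
              have := hR (k + M)
              rwa [show k + M + 1 = k + 1 + M by omega] at this)
            (fun k ho => by
              have hkX : c (k + M) ∈ X \ A := ⟨hX _, hM _ (by omega)⟩
              have := hc (k + M) (by rw [ho, hY _ hkX])
              rw [show k + M + 1 = k + 1 + M by omega] at this
              rw [this]
              simp only [s]
              rw [dif_neg (fun h => hkX.2 (hNA h)), if_neg hkX.2]) q (hq.shift M)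
          rw [this]
          rw [hY _ ⟨hX _, hM _ (by omega)⟩]
    · -- the opponent wins somewhere
      push Not at hY
      obtain ⟨y0, hy0, hy0i⟩ := hY
      let Y : Set U := {v | v ∈ X \ A ∧ w1 v ≠ i}
      obtain ⟨B, sB, rB, hYB, hBX, hB1, hB2, hB3, hB4⟩ :=
        attractor own R (!i) X Y (fun v hv => hv.1.1)
      have hb : ∀ b : Bool, b ≠ i ↔ b = !i := by intro b; cases b <;> cases i <;> simp
      have hb' : ∀ b : Bool, b ≠ (!i) ↔ b = i := by intro b; cases b <;> cases i <;> simp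
      obtain ⟨w2, s2, H2⟩ := ih (X \ B)
        (by
          have : (X \ B).ncard < X.ncard := Set.ncard_lt_ncard
            ⟨Set.sdiff_subset, fun h => (h hy0.1).2 (hYB ⟨hy0, hy0i⟩)⟩ (Set.toFinite _)
          omega)
        (by
          rintro v ⟨hv, hvA⟩
          by_cases ho : own v = !i
          · obtain ⟨v', hv', hr⟩ := htot v hv
            exact ⟨v', ⟨hv', hB3 v hv hvA ho v' hv' hr⟩, hr⟩
          · obtain ⟨v', hv', hr, hn⟩ := hB4 v hv hvA ho
            exact ⟨v', ⟨hv', hn⟩, hr⟩)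
      let w : U → Bool := fun v => if v ∈ B then !i else w2 v
      let s : U → U := fun v => if v ∈ Y then s1 v else if v ∈ B then sB v else s2 v
      have hwB : ∀ v, v ∈ B → w v = !i := fun v h => if_pos h
      have hwn : ∀ v, v ∉ B → w v = w2 v := fun v h => if_neg h
      have hsY : ∀ v, v ∈ Y → s v = s1 v := fun v h => if_pos h
      have hsB : ∀ v, v ∈ B → v ∉ Y → s v = sB v := fun v h h' => by
        simp only [s]; rw [if_neg h', if_pos h]
      have hs2 : ∀ v, v ∉ B → s v = s2 v := fun v h => by
        simp only [s]; rw [if_neg (fun h' => h (hYB h')), if_neg h]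
      have hYmine : ∀ v ∈ Y, own v = !i → R v (s1 v) ∧ s1 v ∈ Y := by
        intro v hv ho
        have := H1.mine v hv.1 (by rw [ho, (hb _).1 hv.2])
        exact ⟨this.1, this.2.1, by rw [this.2.2]; exact hv.2⟩
      have hYother : ∀ v ∈ Y, own v ≠ !i → ∀ v' ∈ X, R v v' → v' ∈ Y := by
        intro v hv ho v' hv' hr
        have h1 : v' ∉ A := hA3 v hv.1.1 hv.1.2 ((hb' _).1 ho) v' hv' hr
        refine ⟨⟨hv', h1⟩, ?_⟩
        rw [H1.other v hv.1 (by rw [(hb _).1 hv.2]; exact ho) v' ⟨hv', h1⟩ hr]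
        exact hv.2
      have mine : ∀ v ∈ X, own v = w v → R v (s v) ∧ s v ∈ X ∧ w (s v) = w v := by
        intro v hv ho
        by_cases hvB : v ∈ B
        · rw [hwB v hvB] at ho ⊢
          by_cases hvY : v ∈ Y
          · rw [hsY v hvY]
            obtain ⟨h1, h2⟩ := hYmine v hvY ho
            exact ⟨h1, h2.1.1, hwB _ (hYB h2)⟩
          · rw [hsB v hvB hvY]
            obtain ⟨h1, h2, -⟩ := hB1 v hvB hvY ho
            exact ⟨h1, hBX h2, hwB _ h2⟩
        · rw [hwn v hvB] at ho ⊢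
          rw [hs2 v hvB]
          obtain ⟨h1, h2, h3⟩ := H2.mine v ⟨hv, hvB⟩ ho
          exact ⟨h1, h2.1, by rw [hwn _ h2.2, h3]⟩
      have other : ∀ v ∈ X, own v ≠ w v → ∀ v' ∈ X, R v v' → w v' = w v := by
        intro v hv ho v' hv' hr
        by_cases hvB : v ∈ B
        · rw [hwB v hvB] at ho ⊢
          by_cases hvY : v ∈ Y
          · exact hwB _ (hYB (hYother v hvY ho v' hv' hr))
          · exact hwB _ (hB2 v hvB hvY ho v' hv' hr).1
        · rw [hwn v hvB] at ho ⊢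
          by_cases hvB' : v' ∈ B
          · rw [hwB _ hvB']
            by_contra hne
            have h1 : w2 v = i := (hb' _).1 (fun h => hne h.symm)
            rw [h1] at ho
            exact hB3 v hv hvB ((hb _).1 ho) v' hv' hr hvB'
          · rw [hwn _ hvB']
            exact H2.other v ⟨hv, hvB⟩ ho v' ⟨hv', hvB'⟩ hr
      refine ⟨w, s, mine, other, ?_⟩
      intro c hX hR hc q hq
      have hconst := Solves.const (pr := pr) mine other c hX hR hc
      by_cases hin : ∃ k, c k ∈ B
      · obtain ⟨k, hk⟩ := hin
        have hw0 : w (c 0) = !i := by rw [← hconst k]; exact hwB _ hk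
        obtain ⟨M, -, hM⟩ := attractor_reach hB1 hB2 c hX hR
          (by
            intro k h1 h2 h3
            rw [hc k (by rw [h3, hwB _ h1]), hsB _ h1 h2]) _ k le_rfl hk
        have hY' : ∀ k, c (k + M) ∈ Y := by
          intro k
          induction k with
          | zero => simpa using hM
          | succ k ih =>
            rw [show k + 1 + M = k + M + 1 by omega]
            by_cases ho : own (c (k + M)) = !i
            · rw [hc (k + M) (by rw [ho, hwB _ (hYB ih)]), hsY _ ih]
              exact (hYmine _ ih ho).2
            · exact hYother _ ih ho _ (hX _) (hR _)
        have := H1.win (fun k => c (k + M)) (fun k => (hY' k).1)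
            (fun k => by
              have := hR (k + M)
              rwa [show k + M + 1 = k + 1 + M by omega] at this)
            (fun k ho => by
              have hkY := hY' k
              have := hc (k + M) (by rw [ho, hwB _ (hYB hkY), (hb _).1 hkY.2])
              rw [show k + M + 1 = k + 1 + M by omega] at this
              rw [this, hsY _ hkY]) q (hq.shift M)
        rw [this, hw0]
        rw [(hb _).1 (hY' 0).2]
      · push Not at hin
        have := H2.win c (fun k => ⟨hX k, hin k⟩) hR
          (fun k ho => by rw [hc k (by rw [ho, hwn _ (hin k)]), hs2 _ (hin k)]) q hq
        rw [this, hwn _ (hin 0)]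

end game
end Stmt9

namespace Stmt9

/-! ## The language of correct branches -/

section branch
variable {Λ Q : Type} (has : Λ → Q → Prop) (rng : Set Λ) (a0 : Λ)

def brBad (y : (Q → Prop) × (Λ × Option Q)) : Prop := y.2.1 ∉ rng ∨ ∃ q, y.1 q ∧ ¬ has y.2.1 q
def brPend (y : (Q → Prop) × (Λ × Option Q)) : Prop := ∃ q, y.2.2 = some q ∧ has y.2.1 q ∧ ¬ y.1 q

def brJ : Set (ℕ → (Q → Prop) × (Λ × Option Q)) := {y | (y 0).2.1 = a0 ∧
  (∀ i, ¬ brBad has rng (y i)) ∧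
  ∀ i, brPend has (y i) → ∃ j, i < j ∧ (y j).2.2 ≠ none}

abbrev BrSt (Λ : Type) := Option Λ × Prop × Prop × Prop

open Classical in
noncomputable def brClf : Clf ((Q → Prop) × (Λ × Option Q)) (BrSt Λ) where
  ini := (none, False, False, False)
  step := fun s y => (some (s.1.getD y.2.1), s.2.1 ∨ brBad has rng y,
    (y.2.2 = none ∧ s.2.2.1) ∨ brPend has y, s.2.2.2 ∨ y.2.2 ≠ none)

variable (y : ℕ → (Q → Prop) × (Λ × Option Q))

theorem brClf_first (i k : ℕ) (h : i < k) :
    ((brClf has rng).run y i k).1 = some (y i).2.1 := by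
  induction k, h using Nat.le_induction with
  | base => rw [Clf.run_succ _ y le_rfl, Clf.run_of_le _ y le_rfl]; rfl
  | succ k hk ih =>
    rw [Clf.run_succ _ y (by omega)]
    show some (((brClf has rng).run y i k).1.getD _) = _
    rw [ih]; rfl

theorem brClf_bad (i k : ℕ) (h : i ≤ k) :
    ((brClf has rng).run y i k).2.1 ↔ ∃ j, i ≤ j ∧ j < k ∧ brBad has rng (y j) := by
  induction k, h using Nat.le_induction with
  | base =>
    rw [Clf.run_of_le _ y le_rfl]
    exact ⟨False.elim, fun ⟨j, h1, h2, _⟩ => absurd h1 (by omega)⟩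
  | succ k hk ih =>
    rw [Clf.run_succ _ y (by omega)]
    show ((brClf has rng).run y i k).2.1 ∨ brBad has rng (y k) ↔ _
    rw [ih]
    constructor
    · rintro (⟨j, h1, h2, h3⟩ | h)
      · exact ⟨j, h1, by omega, h3⟩
      · exact ⟨k, hk, by omega, h⟩
    · rintro ⟨j, h1, h2, h3⟩
      by_cases e : j = k
      · subst e; exact Or.inr h3
      · exact Or.inl ⟨j, h1, by omega, h3⟩

theorem brClf_star (i k : ℕ) (h : i ≤ k) :
    ((brClf has rng).run y i k).2.2.2 ↔ ∃ j, i ≤ j ∧ j < k ∧ (y j).2.2 ≠ none := by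
  induction k, h using Nat.le_induction with
  | base =>
    rw [Clf.run_of_le _ y le_rfl]
    exact ⟨False.elim, fun ⟨j, h1, h2, _⟩ => absurd h1 (by omega)⟩
  | succ k hk ih =>
    rw [Clf.run_succ _ y (by omega)]
    show ((brClf has rng).run y i k).2.2.2 ∨ (y k).2.2 ≠ none ↔ _
    rw [ih]
    constructor
    · rintro (⟨j, h1, h2, h3⟩ | h)
      · exact ⟨j, h1, by omega, h3⟩
      · exact ⟨k, hk, by omega, h⟩
    · rintro ⟨j, h1, h2, h3⟩
      by_cases e : j = k
      · subst e; exact Or.inr h3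
      · exact Or.inl ⟨j, h1, by omega, h3⟩

theorem brClf_pend (i k : ℕ) (h : i ≤ k) :
    ((brClf has rng).run y i k).2.2.1 ↔ ∃ j, i ≤ j ∧ j < k ∧ brPend has (y j) ∧
      ∀ l, j < l → l < k → (y l).2.2 = none := by
  induction k, h using Nat.le_induction with
  | base =>
    rw [Clf.run_of_le _ y le_rfl]
    exact ⟨False.elim, fun ⟨j, h1, h2, _⟩ => absurd h1 (by omega)⟩
  | succ k hk ih =>
    rw [Clf.run_succ _ y (by omega)]
    show ((y k).2.2 = none ∧ ((brClf has rng).run y i k).2.2.1) ∨ brPend has (y k) ↔ _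
    rw [ih]
    constructor
    · rintro (⟨h0, j, h1, h2, h3, h4⟩ | h)
      · refine ⟨j, h1, by omega, h3, fun l hl hl' => ?_⟩
        by_cases e : l = k
        · subst e; exact h0
        · exact h4 l hl (by omega)
      · exact ⟨k, hk, by omega, h, fun l hl hl' => by omega⟩
    · rintro ⟨j, h1, h2, h3, h4⟩
      by_cases e : j = k
      · subst e; exact Or.inr h3
      · exact Or.inl ⟨h4 k (by omega) (by omega), j, h1, by omega, h3,
          fun l hl hl' => h4 l hl (by omega)⟩

theorem block_of {c : ℕ → ℕ} (hc : StrictMono c) (i : ℕ) (hi : c 0 ≤ i) :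
    ∃ a, c a ≤ i ∧ i < c (a + 1) := by
  classical
  have hex : ∃ b, i < c b := ⟨i + 1, lt_of_lt_of_le (Nat.lt_succ_self i) (hc.id_le _)⟩
  have h1 := Nat.find_spec hex
  cases h : Nat.find hex with
  | zero => rw [h] at h1; omega
  | succ a =>
    refine ⟨a, ?_, by rwa [h] at h1⟩
    have := Nat.find_min hex (m := a) (by omega)
    omega

theorem brJ_iff {y : ℕ → (Q → Prop) × (Λ × Option Q)} {s m : BrSt Λ}
    (h : (brClf has rng).HasType y s m) :
    y ∈ brJ has rng a0 ↔ s.1 = some a0 ∧ ¬ s.2.1 ∧ ¬ m.2.1 ∧ (s.2.2.1 → m.2.2.2) := by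
  obtain ⟨c, hc, h0, hs, hm⟩ := h
  have hlt : ∀ a, c a < c (a + 1) := fun a => hc (Nat.lt_succ_self a)
  have e1 : s.1 = some (y 0).2.1 := by rw [← hs]; exact brClf_first has rng y 0 _ h0
  have e2 := brClf_bad has rng y 0 _ h0.le
  have e3 := fun a => brClf_bad has rng y _ _ (hlt a).le
  have e4 := brClf_pend has rng y 0 _ h0.le
  have e5 := fun a => brClf_star has rng y _ _ (hlt a).le
  rw [hs] at e2 e4
  simp only [hm] at e3 e5
  constructor
  · rintro ⟨h1, h2, h3⟩
    refine ⟨by rw [e1, h1], ?_, ?_, ?_⟩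
    · rw [e2]; rintro ⟨j, -, -, h⟩; exact h2 j h
    · rw [e3 0]; rintro ⟨j, -, -, h⟩; exact h2 j h
    · rw [e4]
      rintro ⟨j, -, hj, hp, hn⟩
      obtain ⟨l, hl, hne⟩ := h3 j hp
      have hl2 : c 0 ≤ l := by
        by_contra hcon
        exact hne (hn l hl (by omega))
      obtain ⟨a, ha, ha'⟩ := block_of hc l hl2
      exact (e5 a).2 ⟨l, ha, ha', hne⟩
  · rintro ⟨h1, h2, h3, h4⟩
    refine ⟨?_, ?_, ?_⟩
    · rw [e1] at h1; exact Option.some.inj h1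
    · intro i hb
      by_cases hi : i < c 0
      · exact h2 (e2.2 ⟨i, by omega, hi, hb⟩)
      · obtain ⟨a, ha, ha'⟩ := block_of hc i (by omega)
        exact h3 ((e3 a).2 ⟨i, ha, ha', hb⟩)
    · intro i hp
      by_contra hcon
      push Not at hcon
      by_cases hi : i < c 0
      · have := h4 (e4.2 ⟨i, by omega, hi, hp, fun l hl _ => hcon l hl⟩)
        obtain ⟨l, hl, hl', hne⟩ := (e5 0).1 this
        exact hne (hcon l (by omega))
      · obtain ⟨a, ha, ha'⟩ := block_of hc i (by omega)
        have hst : m.2.2.2 := (e5 a).2 ⟨i, ha, ha', by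
          obtain ⟨q, hq, -⟩ := hp; rw [hq]; simp⟩
        obtain ⟨l, hl, hl', hne⟩ := (e5 (a + 1)).1 hst
        exact hne (hcon l (by omega))

theorem brJ_recog : (brClf has rng).Recog (brJ has rng a0) := by
  intro x y s m hx hy hxJ
  rw [brJ_iff has rng a0 hx] at hxJ
  rwa [brJ_iff has rng a0 hy]

/-- The language of correct branches. -/
def brL (K : Q → Set (ℕ → Λ)) : Set (ℕ → Λ × Option Q) :=
  {x | (x 0).1 = a0 ∧ (∀ i, (x i).1 ∈ rng) ∧
    (∀ i q, (fun j => (x (j + i)).1) ∈ K q → has (x i).1 q) ∧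
    ∀ i q, has (x i).1 q → (x i).2 = some q → (∀ j, i < j → (x j).2 = none) →
      (fun j => (x (j + i)).1) ∈ K q}

abbrev BrS (Λ Q S : Type) := S × ((S → Q → Prop) → BrSt Λ)

theorem brL_recog {S : Type} (C : Clf Λ S) (K : Q → Set (ℕ → Λ)) (hK : ∀ q, C.Recog (K q)) :
    ∃ C' : Clf (Λ × Option Q) (BrS Λ Q S), C'.Recog (brL has rng a0 K) := by
  let C1 : Clf (Λ × Option Q) S := ⟨C.ini, fun s a => C.step s a.1⟩
  let K1 : Q → Set (ℕ → Λ × Option Q) := fun q => {x | (fun i => (x i).1) ∈ K q}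
  have hK1 : ∀ q, C1.Recog (K1 q) := fun q =>
    (hK q).sim (C' := C1) (fun a => a.1) id rfl (fun _ _ => rfl)
  refine ⟨C1.comp (brClf has rng), ?_⟩
  have := C1.comp_recog (brClf has rng) K1 hK1 _ (brJ_recog has rng a0)
  convert this using 1
  ext x
  constructor
  · rintro ⟨h1, h2, h3, h4⟩
    refine ⟨h1, ?_, ?_⟩
    · rintro i (h | ⟨q, h, h'⟩)
      · exact h (h2 i)
      · exact h' (h3 i q h)
    · rintro i ⟨q, h5, h6, h7⟩
      by_contra hcon
      push Not at hcon
      exact h7 (h4 i q h6 h5 hcon)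
  · rintro ⟨h1, h2, h3⟩
    refine ⟨h1, ?_, ?_, ?_⟩
    · intro i
      by_contra h
      exact h2 i (Or.inl h)
    · intro i q h
      by_contra h'
      exact h2 i (Or.inr ⟨q, h, h'⟩)
    · intro i q h4 h5 h6
      by_contra h7
      obtain ⟨j, hj, hne⟩ := h3 i ⟨q, h5, h4, h7⟩
      exact hne (h6 j hj)

end branch
end Stmt9

namespace Stmt9

theorem ParLim.half {c : ℕ → ℕ} {p : ℕ} (h : ParLim c p) : ParLim (fun k => c (k / 2)) p := by
  obtain ⟨h1, N, h2⟩ := h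
  refine ⟨fun M => ?_, 2 * N, fun k hk => h2 _ (by omega)⟩
  obtain ⟨k, hk, e⟩ := h1 M
  exact ⟨2 * k, by omega, by show c (2 * k / 2) = p; rw [Nat.mul_div_cancel_left _ (by omega)]; exact e⟩

section fmp
variable {Λ Q S : Type}

/-- Labelled structures in which the names in labels are correct. -/
def NameOK (has : Λ → Q → Prop) (K : Q → Set (ℕ → Λ)) {U : Type} (M : KStruct ℕ U)
    (lam : U → Λ) : Prop :=
  ∀ w q, has (lam w) q ↔ ∃ π, IsFullpath M π ∧ π 0 = w ∧ (fun i => lam (π i)) ∈ K q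

/-- Words produced by following witnesses are correct branches. -/
theorem branch_mem (has : Λ → Q → Prop) (K : Q → Set (ℕ → Λ)) {U : Type} (M : KStruct ℕ U)
    (lam : U → Λ) (hok : NameOK has K M lam) (tl : (ℕ → U) → Option Q → ℕ → U)
    (htn : ∀ π, tl π none = suffix π 1)
    (hts : ∀ π q, IsFullpath M π → ∃ ρ, IsFullpath M ρ ∧ ρ 0 = π 0 ∧
      (has (lam (π 0)) q → (fun i => lam (ρ i)) ∈ K q) ∧ tl π (some q) = suffix ρ 1)
    (P : ℕ → ℕ → U) (b : ℕ → Option Q) (h0 : IsFullpath M (P 0))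
    (hP : ∀ k, P (k + 1) = tl (P k) (b k)) :
    (fun k => (lam (P k 0), b k)) ∈ brL has (Set.range lam) (lam (P 0 0)) K := by
  have hsuf : ∀ π : ℕ → U, IsFullpath M π → ∀ n, IsFullpath M (suffix π n) := by
    intro π hπ n i
    have := hπ (i + n)
    show M.rel (π (i + n)) (π (i + 1 + n))
    rwa [show i + 1 + n = i + n + 1 by omega]
  have hfull : ∀ k, IsFullpath M (P k) := by
    intro k
    induction k with
    | zero => exact h0
    | succ k ih =>
      rw [hP]
      cases hb : b k with
      | none => rw [htn]; exact hsuf _ ih 1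
      | some q =>
        obtain ⟨ρ, h1, -, -, h4⟩ := hts _ q ih
        rw [h4]; exact hsuf _ h1 1
  have hω : IsFullpath M (fun k => P k 0) := by
    intro k
    show M.rel (P k 0) (P (k + 1) 0)
    rw [hP]
    cases hb : b k with
    | none => rw [htn]; exact hfull k 0
    | some q =>
      obtain ⟨ρ, h1, h2, -, h4⟩ := hts _ q (hfull k)
      rw [h4, ← h2]; exact h1 0
  refine ⟨rfl, fun i => ⟨_, rfl⟩, ?_, ?_⟩
  · intro i q h
    exact (hok (P i 0) q).2 ⟨suffix (fun k => P k 0) i, hsuf _ hω i, by simp [suffix], h⟩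
  · intro i q h1 h2 h3
    simp only at h1 h2 h3
    obtain ⟨ρ, h4, h5, h6, h7⟩ := hts _ q (hfull i)
    have hρ : ∀ j, P (i + 1 + j) = suffix ρ (j + 1) := by
      intro j
      induction j with
      | zero => show P (i + 1) = _; rw [hP, h2, h7]
      | succ j ih =>
        show P (i + 1 + j + 1) = _
        rw [hP, ih, h3 (i + 1 + j) (by omega), htn]
        funext l
        show ρ (l + 1 + (j + 1)) = ρ (l + (j + 1 + 1))
        congr 1; omega
    have : (fun j => lam (P (j + i) 0)) = fun j => lam (ρ j) := by
      funext j
      cases j with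
      | zero => rw [h5, Nat.zero_add]
      | succ j =>
        rw [show j + 1 + i = i + 1 + j by omega, hρ]
        show lam (ρ (0 + (j + 1))) = _
        rw [Nat.zero_add]
    show (fun j => lam (P (j + i) 0)) ∈ K q
    rw [this]
    exact h6 h1

abbrev FmpD (Λ Q S : Type) := Clf.DSt (BrS Λ Q S)

instance FmpD.fin [Finite Λ] [Finite Q] [Finite S] : Finite (FmpD Λ Q S) :=
  have : Finite (BrS Λ Q S) := inferInstance
  inferInstanceAs (Finite (Clf.DSt (BrS Λ Q S)))

def dseq {D : Type} (E : Clf (Λ × Option Q) D) (g : D → Λ) (b : ℕ → Option Q) : ℕ → D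
  | 0 => E.ini
  | k + 1 => E.step (dseq E g b k) (g (dseq E g b k), b k)

theorem dseq_run {D : Type} (E : Clf (Λ × Option Q) D) (g : D → Λ) (b : ℕ → Option Q) (k : ℕ) :
    E.run (fun k => (g (dseq E g b k), b k)) 0 k = dseq E g b k := by
  induction k with
  | zero => rfl
  | succ k ih => rw [Clf.run_succ _ _ (Nat.zero_le k), ih]; rfl

theorem dseq_congr {D : Type} (E : Clf (Λ × Option Q) D) (g : D → Λ) (b b' : ℕ → Option Q) (k : ℕ)
    (h : ∀ j, j < k → b j = b' j) : dseq E g b k = dseq E g b' k := by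
  induction k with
  | zero => rfl
  | succ k ih =>
    simp only [dseq]
    rw [ih (fun j hj => h j (by omega)), h k (by omega)]

/-- Positional choice of labels. -/
theorem fmp_choice [Finite Λ] [Finite Q] [Finite S] (C : Clf Λ S) (K : Q → Set (ℕ → Λ))
    (hK : ∀ q, C.Recog (K q)) (has : Λ → Q → Prop) {U : Type} (M : KStruct ℕ U) (hser : M.Serial)
    (lam : U → Λ) (hok : NameOK has K M lam) (w0 : U) :
    ∃ (E : Clf (Λ × Option Q) (FmpD Λ Q S)) (g : FmpD Λ Q S → Λ),
      ∀ b : ℕ → Option Q, (fun k => (g (dseq E g b k), b k)) ∈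
        brL has (Set.range lam) (lam w0) K := by
  classical
  obtain ⟨C', hC'⟩ := brL_recog has (Set.range lam) (lam w0) C K hK
  obtain ⟨E, pr, hE⟩ := C'.determinize _ hC'
  refine ⟨E, ?_⟩
  let D := FmpD Λ Q S
  have hFD : Finite D := FmpD.fin
  let own : D ⊕ (D × Λ) → Bool := fun v => match v with
    | .inl _ => true
    | .inr _ => false
  let R : D ⊕ (D × Λ) → D ⊕ (D × Λ) → Prop := fun v v' => match v, v' with
    | .inl d, .inr e => e.1 = d
    | .inr e, .inl d => ∃ b, d = E.step e.1 (e.2, b)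
    | _, _ => False
  let prg : D ⊕ (D × Λ) → ℕ := fun v => match v with
    | .inl d => pr d
    | .inr e => pr e.1
  obtain ⟨w, s, H⟩ := zielonka own R prg _ Set.univ le_rfl (by
    rintro (d | e) -
    · exact ⟨.inr (d, lam w0), trivial, rfl⟩
    · exact ⟨.inl (E.step e.1 (e.2, none)), trivial, none, rfl⟩)
  -- a play built from a sequence of states and letters
  have play : ∀ (x : ℕ → Λ × Option Q),
      (∀ k, w (.inl (E.run x 0 k)) = true → s (.inl (E.run x 0 k)) = .inr (E.run x 0 k, (x k).1)) →
      (∀ k, w (.inr (E.run x 0 k, (x k).1)) = false →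
        s (.inr (E.run x 0 k, (x k).1)) = .inl (E.run x 0 (k + 1))) →
      (x ∈ brL has (Set.range lam) (lam w0) K ↔ w (.inl E.ini) = true) := by
    intro x h1 h2
    obtain ⟨p, hp, hlim⟩ := hE x
    rw [← hp]
    let c : ℕ → D ⊕ (D × Λ) := fun k =>
      if k % 2 = 0 then .inl (E.run x 0 (k / 2)) else .inr (E.run x 0 (k / 2), (x (k / 2)).1)
    have hev : ∀ k, c (2 * k) = .inl (E.run x 0 k) := by
      intro k
      simp only [c]
      rw [if_pos (by omega), Nat.mul_div_cancel_left _ (by omega)]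
    have hod : ∀ k, c (2 * k + 1) = .inr (E.run x 0 k, (x k).1) := by
      intro k
      simp only [c]
      rw [if_neg (by omega), show (2 * k + 1) / 2 = k by omega]
    have := H.win c (fun _ => trivial) ?_ ?_ p ?_
    · rw [this]
      show w (c (2 * 0)) = true ↔ _
      rw [hev]; rfl
    · intro k
      rcases Nat.even_or_odd' k with ⟨j, rfl | rfl⟩
      · rw [hev, hod]
      · rw [hod, show 2 * j + 1 + 1 = 2 * (j + 1) by omega, hev]
        refine ⟨(x j).2, ?_⟩
        rw [Clf.run_succ _ _ (Nat.zero_le j)]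
    · intro k
      rcases Nat.even_or_odd' k with ⟨j, rfl | rfl⟩
      · rw [hev, hod]; intro ho; exact (h1 j ho.symm).symm
      · rw [hod, show 2 * j + 1 + 1 = 2 * (j + 1) by omega, hev]
        intro ho; exact (h2 j ho.symm).symm
    · convert hlim.half using 1
      funext k
      rcases Nat.even_or_odd' k with ⟨j, rfl | rfl⟩
      · rw [hev, Nat.mul_div_cancel_left _ (by omega)]
      · rw [hod, show (2 * j + 1) / 2 = j by omega]
  -- successor words from strategies
  have hA : ∀ d a, ∃ b, w (.inr (d, a)) = false →
      s (.inr (d, a)) = .inl (E.step d (a, b)) := by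
    intro d a
    by_cases h : w (.inr (d, a)) = false
    · have := (H.mine (.inr (d, a)) trivial h.symm).1
      cases hs : s (.inr (d, a)) with
      | inl d' =>
        rw [hs] at this
        obtain ⟨b, hb⟩ := this
        exact ⟨b, fun _ => by rw [hb]⟩
      | inr e => rw [hs] at this; exact absurd this id
    · exact ⟨none, fun h' => absurd h' h⟩
  have hG : ∀ d, ∃ a, w (.inl d) = true → s (.inl d) = .inr (d, a) := by
    intro d
    by_cases h : w (.inl d) = true
    · have := (H.mine (.inl d) trivial h.symm).1
      cases hs : s (.inl d) with
      | inl d' => rw [hs] at this; exact absurd this id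
      | inr e =>
        rw [hs] at this
        have h' : e.1 = d := this
        exact ⟨e.2, fun _ => by rw [← h']⟩
    · exact ⟨lam w0, fun h' => absurd h' h⟩
  choose β hβ using hA
  choose g hg using hG
  -- the even player wins
  have hwin : w (.inl E.ini) = true := by
    by_contra hlose
    have hlose' : w (.inl E.ini) = false := by simpa using hlose
    have hwit : ∀ (π : ℕ → U) (q : Q), ∃ ρ, IsFullpath M π → IsFullpath M ρ ∧ ρ 0 = π 0 ∧
        (has (lam (π 0)) q → (fun i => lam (ρ i)) ∈ K q) := by
      intro π q
      by_cases h : has (lam (π 0)) q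
      · obtain ⟨ρ, h1, h2, h3⟩ := (hok _ _).1 h
        exact ⟨ρ, fun _ => ⟨h1, h2, fun _ => h3⟩⟩
      · exact ⟨π, fun hπ => ⟨hπ, rfl, fun h' => absurd h' h⟩⟩
    choose wit hwit using hwit
    let tl : (ℕ → U) → Option Q → ℕ → U := fun π o => match o with
      | none => suffix π 1
      | some q => suffix (wit π q) 1
    choose nx hnx using hser
    let π0 : ℕ → U := fun n => Nat.rec w0 (fun _ v => nx v) n
    have hπ0 : IsFullpath M π0 := fun i => hnx _
    let st : ℕ → (ℕ → U) × D := fun n => Nat.rec (π0, E.ini)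
      (fun _ p => (tl p.1 (β p.2 (lam (p.1 0))),
        E.step p.2 (lam (p.1 0), β p.2 (lam (p.1 0))))) n
    let x : ℕ → Λ × Option Q := fun k =>
      (lam ((st k).1 0), β (st k).2 (lam ((st k).1 0)))
    have hrun : ∀ k, E.run x 0 k = (st k).2 := by
      intro k
      induction k with
      | zero => rfl
      | succ k ih => rw [Clf.run_succ _ _ (Nat.zero_le k), ih]
    have hxL : x ∈ brL has (Set.range lam) (lam w0) K :=
      branch_mem has K M lam hok tl (fun _ => rfl)
        (fun π q hπ => ⟨wit π q, (hwit π q hπ).1, (hwit π q hπ).2.1, (hwit π q hπ).2.2, rfl⟩)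
        (fun k => (st k).1) (fun k => (x k).2) hπ0 (fun k => rfl)
    have hfalse : ∀ k, w (.inl (st k).2) = false ∧
        w (.inr ((st k).2, (x k).1)) = false := by
      intro k
      have hstep : ∀ k, w (.inl (st k).2) = false → w (.inr ((st k).2, (x k).1)) = false := by
        intro k hk
        rw [H.other (.inl (st k).2) trivial (by rw [hk]; simp [own]) (.inr ((st k).2, (x k).1))
          trivial rfl, hk]
      induction k with
      | zero => exact ⟨hlose', hstep 0 hlose'⟩
      | succ k ih =>
        have h1 := (H.mine (.inr ((st k).2, (x k).1)) trivial ih.2.symm).2.2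
        rw [hβ _ _ ih.2, ih.2] at h1
        have h2 : w (.inl (st (k + 1)).2) = false := h1
        exact ⟨h2, hstep (k + 1) h2⟩
    have := (play x (fun k hk => by rw [hrun, (hfalse k).1] at hk; exact absurd hk (by simp))
      (fun k hk => by
        rw [hrun] at hk ⊢
        rw [hrun (k + 1), hβ _ _ hk])).1 hxL
    exact hlose this
  refine ⟨g, fun b => ?_⟩
  have htrue : ∀ k, w (.inl (dseq E g b k)) = true ∧
      w (.inr (dseq E g b k, g (dseq E g b k))) = true := by
    have hstep : ∀ d, w (.inl d) = true → w (.inr (d, g d)) = true := by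
      intro d hd
      have := (H.mine (.inl d) trivial hd.symm).2.2
      rwa [hg d hd, hd] at this
    intro k
    induction k with
    | zero => exact ⟨hwin, hstep _ hwin⟩
    | succ k ih =>
      have h1 := H.other (.inr (dseq E g b k, g (dseq E g b k))) trivial
        (by rw [ih.2]; simp [own]) (.inl (dseq E g b (k + 1))) trivial ⟨b k, rfl⟩
      rw [ih.2] at h1
      exact ⟨h1, hstep _ h1⟩
  refine (play _ ?_ ?_).2 hwin
  · intro k hk
    rw [dseq_run] at hk ⊢
    exact hg _ hk
  · intro k hk
    rw [dseq_run, (htrue k).2] at hk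
    exact absurd hk (by simp)

/-- Finite model property, abstractly. -/
theorem fmp [Finite Λ] [Finite Q] [Finite S] (C : Clf Λ S) (K : Q → Set (ℕ → Λ))
    (hK : ∀ q, C.Recog (K q)) (has : Λ → Q → Prop) {U : Type} (M : KStruct ℕ U) (hser : M.Serial)
    (lam : U → Λ) (hok : NameOK has K M lam) (w0 : U) :
    ∃ (D : Type) (_ : Finite D) (M' : KStruct ℕ D) (lam' : D → Λ) (r : D),
      Nat.card D ≤ Nat.card (FmpD Λ Q S) ∧ M'.Serial ∧ NameOK has K M' lam' ∧
      lam' r = lam w0 ∧ ∀ d, ∃ u, lam u = lam' d ∧ M'.val d = M.val u := by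
  obtain ⟨E, g, hg⟩ := fmp_choice C K hK has M hser lam hok w0
  let D := {d : FmpD Λ Q S // ∃ b k, d = dseq E g b k}
  have hrng : ∀ d : D, ∃ u, lam u = g d.1 := by
    rintro ⟨d, b, k, rfl⟩
    exact (hg b).2.1 k
  choose v hv using hrng
  let M' : KStruct ℕ D := ⟨fun d d' => ∃ o, d'.1 = E.step d.1 (g d.1, o), fun d => M.val (v d)⟩
  have hsucc : ∀ (d : D) (o : Option Q), ∃ b k, E.step d.1 (g d.1, o) = dseq E g b k := by
    rintro ⟨d, b, k, rfl⟩ o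
    refine ⟨fun j => if j < k then b j else o, k + 1, ?_⟩
    simp only [dseq]
    rw [dseq_congr E g (fun j => if j < k then b j else o) b k (fun j hj => by simp [hj])]
    simp
  have hpath : ∀ (b : ℕ → Option Q) (k : ℕ) (π : ℕ → FmpD Λ Q S) (o : ℕ → Option Q),
      π 0 = dseq E g b k → (∀ j, π (j + 1) = E.step (π j) (g (π j), o j)) →
      ∃ b' : ℕ → Option Q, (∀ j, b' (j + k) = o j) ∧ ∀ j, dseq E g b' (j + k) = π j := by
    intro b k π o h0 hs
    have hb : ∀ j, (fun j => if j < k then b j else o (j - k)) (j + k) = o j := by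
      intro j; simp
    refine ⟨fun j => if j < k then b j else o (j - k), hb, fun j => ?_⟩
    induction j with
    | zero =>
      rw [h0, Nat.zero_add]
      exact dseq_congr E g _ b k (fun j hj => by simp [hj])
    | succ j ih =>
      rw [show j + 1 + k = j + k + 1 by omega]
      simp only [dseq]
      rw [ih, hs]
      simp
  have hFD : Finite D := Subtype.finite
  refine ⟨D, hFD, M', fun d => g d.1, ⟨E.ini, fun _ => none, 0, rfl⟩, ?_, ?_, ?_, ?_, ?_⟩
  · exact Nat.card_le_card_of_injective _ Subtype.val_injective
  · intro d
    exact ⟨⟨_, hsucc d none⟩, none, rfl⟩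
  · rintro ⟨d, b, k, rfl⟩ q
    constructor
    · intro hq
      let o : ℕ → Option Q := fun j => if j = 0 then some q else none
      let π : ℕ → D := fun n => Nat.rec ⟨dseq E g b k, b, k, rfl⟩
        (fun j p => ⟨E.step p.1 (g p.1, o j), hsucc p (o j)⟩) n
      obtain ⟨b', h1, h2⟩ := hpath b k (fun n => (π n).1) o rfl (fun j => rfl)
      refine ⟨π, fun i => ⟨o i, rfl⟩, rfl, ?_⟩
      have := (hg b').2.2.2 k q ?_ ?_ ?_
      · convert this using 1
        funext i
        show g (π i).1 = g (dseq E g b' (i + k))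
        rw [h2]
      · have := h2 0
        rw [Nat.zero_add] at this
        simp only
        rw [this]; exact hq
      · have := h1 0
        rw [Nat.zero_add] at this
        simp only
        rw [this]; rfl
      · intro j hj
        have := h1 (j - k)
        rw [Nat.sub_add_cancel hj.le] at this
        simp only
        rw [this]
        simp only [o]
        rw [if_neg (by omega)]
    · rintro ⟨π, hπ, h0, hin⟩
      choose o ho using hπ
      obtain ⟨b', h1, h2⟩ := hpath b k (fun n => (π n).1) o (by rw [h0]) ho
      have := (hg b').2.2.1 k q ?_
      · have h3 := h2 0
        rw [Nat.zero_add] at h3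
        simp only at this
        rw [h3, h0] at this; exact this
      · convert hin using 1
        funext i
        simp only
        rw [h2]
  · exact (hg (fun _ => none)).1
  · intro d
    exact ⟨v d, hv d, rfl⟩

end fmp
end Stmt9

namespace Stmt9

/-! ## Systems of labels -/

structure Sys where
  L : Type
  Q : Type
  S : Type
  has : L → Q → Prop
  K : Q → Set (ℕ → L)
  C : Clf L S
  hK : ∀ q, C.Recog (K q)
  vrel : L → Set ℕ → Prop

def Sys.Con (Y : Sys) {U : Type} (M : KStruct ℕ U) (lam : U → Y.L) : Prop :=
  (∀ w, Y.vrel (lam w) (M.val w)) ∧ NameOK Y.has Y.K M lam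

structure Sys.Good (Y : Sys) (m : ℕ) : Prop where
  finL : Finite Y.L
  finQ : Finite Y.Q
  finS : Finite Y.S
  cardL : Nat.card Y.L ≤ m
  cardQ : Nat.card Y.Q ≤ m
  cardS : Nat.card Y.S ≤ m
  ex : ∀ (U : Type) (M : KStruct ℕ U), ∃ lam, Y.Con M lam

/-- Path properties. -/
abbrev PP := ∀ U : Type, KStruct ℕ U → (ℕ → U) → Prop

structure Rep (Y : Sys) (Φ : PP) (K : Set (ℕ → Y.L)) : Prop where
  rcg : Y.C.Recog K
  iff : ∀ (U : Type) (M : KStruct ℕ U) (lam : U → Y.L), Y.Con M lam → ∀ σ, IsFullpath M σ →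
    (Φ U M σ ↔ (fun i => lam (σ i)) ∈ K)

def RepB (m : ℕ) (Φ : PP) : Prop := ∃ Y : Sys, Y.Good m ∧ ∃ K, Rep Y Φ K
def RepB2 (m : ℕ) (Φ Ψ : PP) : Prop := ∃ Y : Sys, Y.Good m ∧ ∃ K K', Rep Y Φ K ∧ Rep Y Ψ K'

theorem Sys.Good.mono {Y : Sys} {m n : ℕ} (h : Y.Good m) (hmn : m ≤ n) : Y.Good n :=
  ⟨h.finL, h.finQ, h.finS, h.cardL.trans hmn, h.cardQ.trans hmn, h.cardS.trans hmn, h.ex⟩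

theorem RepB.mono {m n : ℕ} {Φ : PP} (h : RepB m Φ) (hmn : m ≤ n) : RepB n Φ := by
  obtain ⟨Y, h1, h2⟩ := h
  exact ⟨Y, h1.mono hmn, h2⟩

theorem Rep.neg {Y : Sys} {Φ : PP} {K : Set (ℕ → Y.L)} (h : Rep Y Φ K) :
    Rep Y (fun U M σ => ¬ Φ U M σ) Kᶜ :=
  ⟨h.rcg.compl, fun U M lam hc σ hσ => not_congr (h.iff U M lam hc σ hσ)⟩

theorem Rep.and {Y : Sys} {Φ Ψ : PP} {K K' : Set (ℕ → Y.L)} (h : Rep Y Φ K) (h' : Rep Y Ψ K') :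
    Rep Y (fun U M σ => Φ U M σ ∧ Ψ U M σ) (K ∩ K') :=
  ⟨h.rcg.inter h'.rcg, fun U M lam hc σ hσ =>
    and_congr (h.iff U M lam hc σ hσ) (h'.iff U M lam hc σ hσ)⟩

/-- Extension of a system. -/
def Sys.ext (Y : Sys) {L' X S' : Type} (g : L' → Y.L) (C' : Clf L' S') (p : S' → Y.S)
    (h0 : p C'.ini = Y.C.ini) (h1 : ∀ s a, p (C'.step s a) = Y.C.step (p s) (g a))
    (hasX : L' → X → Prop) (KX : X → Set (ℕ → L')) (hKX : ∀ x, C'.Recog (KX x)) : Sys where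
  L := L'
  Q := Y.Q ⊕ X
  S := S'
  has := fun l q => Sum.elim (Y.has (g l)) (hasX l) q
  K := fun q => Sum.elim (fun q => {x | (fun i => g (x i)) ∈ Y.K q}) KX q
  C := C'
  hK := by
    rintro (q | x)
    · exact (Y.hK q).sim g p h0 h1
    · exact hKX x
  vrel := fun l v => Y.vrel (g l) v

theorem Sys.ext_con (Y : Sys) {L' X S' : Type} (g : L' → Y.L) (C' : Clf L' S') (p : S' → Y.S)
    (h0 : p C'.ini = Y.C.ini) (h1 : ∀ s a, p (C'.step s a) = Y.C.step (p s) (g a))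
    (hasX : L' → X → Prop) (KX : X → Set (ℕ → L')) (hKX : ∀ x, C'.Recog (KX x))
    {U : Type} (M : KStruct ℕ U) (lam : U → L') :
    (Y.ext g C' p h0 h1 hasX KX hKX).Con M lam ↔
      Y.Con M (fun w => g (lam w)) ∧ NameOK hasX KX M lam := by
  constructor
  · rintro ⟨h, h'⟩
    exact ⟨⟨h, fun w q => h' w (.inl q)⟩, fun w x => h' w (.inr x)⟩
  · rintro ⟨⟨h, h'⟩, h''⟩
    refine ⟨h, ?_⟩
    rintro w (q | x)
    · exact h' w q
    · exact h'' w x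

theorem Sys.ext_rep (Y : Sys) {L' X S' : Type} (g : L' → Y.L) (C' : Clf L' S') (p : S' → Y.S)
    (h0 : p C'.ini = Y.C.ini) (h1 : ∀ s a, p (C'.step s a) = Y.C.step (p s) (g a))
    (hasX : L' → X → Prop) (KX : X → Set (ℕ → L')) (hKX : ∀ x, C'.Recog (KX x))
    {Φ : PP} {K : Set (ℕ → Y.L)} (h : Rep Y Φ K) :
    Rep (Y.ext g C' p h0 h1 hasX KX hKX) Φ {x | (fun i => g (x i)) ∈ K} :=
  ⟨h.rcg.sim g p h0 h1, fun U M lam hc σ hσ =>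
    h.iff U M (fun w => g (lam w)) ((Y.ext_con g C' p h0 h1 hasX KX hKX M lam).1 hc).1 σ hσ⟩

/-! ### Size bounds -/

def FF (m : ℕ) : ℕ :=
  m * m + 3 * m + m * 7 ^ ((2 ^ 2) ^ m) + m * 2 ^ m + (m * 2) ^ m + 3

theorem FF_mono {m n : ℕ} (h : m ≤ n) : FF m ≤ FF n := by
  unfold FF
  have h1 : m * m ≤ n * n := Nat.mul_le_mul h h
  have h2 : m * 7 ^ ((2 ^ 2) ^ m) ≤ n * 7 ^ ((2 ^ 2) ^ n) := Nat.mul_le_mul h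
    (Nat.pow_le_pow_right (by omega) (Nat.pow_le_pow_right (by omega) h))
  have h3 : m * 2 ^ m ≤ n * 2 ^ n := Nat.mul_le_mul h (Nat.pow_le_pow_right (by omega) h)
  have h4 : (m * 2) ^ m ≤ (n * 2) ^ n := by
    rcases Nat.eq_zero_or_pos n with rfl | hn
    · have : m = 0 := by omega
      subst this; exact le_rfl
    · exact (Nat.pow_le_pow_left (by omega) m).trans (Nat.pow_le_pow_right (by omega) h)
  omega

theorem le_FF (m : ℕ) : m ≤ FF m := by
  unfold FF
  have : m ≤ 3 * m := by omega
  have h1 := Nat.zero_le (m * m)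
  have h2 := Nat.zero_le (m * 7 ^ ((2 ^ 2) ^ m))
  have h3 := Nat.zero_le (m * 2 ^ m)
  have h4 := Nat.zero_le ((m * 2) ^ m)
  omega

def Bnd (k : ℕ) : ℕ := FF^[k] 3

theorem Bnd_succ (k : ℕ) : Bnd (k + 1) = FF (Bnd k) := Function.iterate_succ_apply' FF k 3

theorem Bnd_mono : Monotone Bnd := by
  apply monotone_nat_of_le_succ
  intro n
  rw [Bnd_succ]; exact le_FF _

/-! ### Product -/

def Sys.prod (Y Z : Sys) : Sys where
  L := Y.L × Z.L
  Q := Y.Q ⊕ Z.Q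
  S := Y.S × Z.S
  has := fun l q => Sum.elim (Y.has l.1) (Z.has l.2) q
  K := fun q => Sum.elim (fun q => {x | (fun i => (x i).1) ∈ Y.K q})
    (fun q => {x | (fun i => (x i).2) ∈ Z.K q}) q
  C := ⟨(Y.C.ini, Z.C.ini), fun s a => (Y.C.step s.1 a.1, Z.C.step s.2 a.2)⟩
  hK := by
    rintro (q | q)
    · exact (Y.hK q).sim (fun a : Y.L × Z.L => a.1) (fun s : Y.S × Z.S => s.1) rfl (fun _ _ => rfl)
    · exact (Z.hK q).sim (fun a : Y.L × Z.L => a.2) (fun s : Y.S × Z.S => s.2) rfl (fun _ _ => rfl)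
  vrel := fun l v => Y.vrel l.1 v ∧ Z.vrel l.2 v

theorem Sys.prod_con (Y Z : Sys) {U : Type} (M : KStruct ℕ U) (lam : U → Y.L × Z.L) :
    (Y.prod Z).Con M lam ↔ Y.Con M (fun w => (lam w).1) ∧ Z.Con M (fun w => (lam w).2) := by
  constructor
  · rintro ⟨h, h'⟩
    exact ⟨⟨fun w => (h w).1, fun w q => h' w (.inl q)⟩, fun w => (h w).2, fun w q => h' w (.inr q)⟩
  · rintro ⟨⟨h, h'⟩, h1, h2⟩
    refine ⟨fun w => ⟨h w, h1 w⟩, ?_⟩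
    rintro w (q | q)
    · exact h' w q
    · exact h2 w q

theorem Sys.prod_repl (Y Z : Sys) {Φ : PP} {K : Set (ℕ → Y.L)} (h : Rep Y Φ K) :
    Rep (Y.prod Z) Φ {x | (fun i => (x i).1) ∈ K} :=
  ⟨h.rcg.sim (fun a : Y.L × Z.L => a.1) (fun s : Y.S × Z.S => s.1) rfl (fun _ _ => rfl),
    fun U M lam hc σ hσ => h.iff U M (fun w => (lam w).1) ((Y.prod_con Z M lam).1 hc).1 σ hσ⟩

theorem Sys.prod_repr (Y Z : Sys) {Φ : PP} {K : Set (ℕ → Z.L)} (h : Rep Z Φ K) :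
    Rep (Y.prod Z) Φ {x | (fun i => (x i).2) ∈ K} :=
  ⟨h.rcg.sim (fun a : Y.L × Z.L => a.2) (fun s : Y.S × Z.S => s.2) rfl (fun _ _ => rfl),
    fun U M lam hc σ hσ => h.iff U M (fun w => (lam w).2) ((Y.prod_con Z M lam).1 hc).2 σ hσ⟩

theorem Sys.prod_good {Y Z : Sys} {m : ℕ} (hY : Y.Good m) (hZ : Z.Good m) :
    (Y.prod Z).Good (FF m) := by
  have := hY.finL; have := hY.finQ; have := hY.finS
  have := hZ.finL; have := hZ.finQ; have := hZ.finS
  have hb : m * m ≤ FF m ∧ m + m ≤ FF m := by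
    unfold FF
    have h2 := Nat.zero_le (m * 7 ^ ((2 ^ 2) ^ m))
    have h3 := Nat.zero_le (m * 2 ^ m)
    have h4 := Nat.zero_le ((m * 2) ^ m)
    have h5 := Nat.zero_le (m * m)
    constructor <;> omega
  refine ⟨inferInstanceAs (Finite (Y.L × Z.L)), inferInstanceAs (Finite (Y.Q ⊕ Z.Q)),
    inferInstanceAs (Finite (Y.S × Z.S)), ?_, ?_, ?_, ?_⟩
  · show Nat.card (Y.L × Z.L) ≤ _
    rw [Nat.card_prod]
    exact (Nat.mul_le_mul hY.cardL hZ.cardL).trans hb.1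
  · show Nat.card (Y.Q ⊕ Z.Q) ≤ _
    rw [Nat.card_sum]
    exact (Nat.add_le_add hY.cardQ hZ.cardQ).trans hb.2
  · show Nat.card (Y.S × Z.S) ≤ _
    rw [Nat.card_prod]
    exact (Nat.mul_le_mul hY.cardS hZ.cardS).trans hb.1
  · intro U M
    obtain ⟨l1, h1⟩ := hY.ex U M
    obtain ⟨l2, h2⟩ := hZ.ex U M
    exact ⟨fun w => (l1 w, l2 w), (Y.prod_con Z M _).2 ⟨h1, h2⟩⟩

theorem RepB.pair {m : ℕ} {Φ Ψ : PP} (h : RepB m Φ) (h' : RepB m Ψ) : RepB2 (FF m) Φ Ψ := by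
  obtain ⟨Y, hY, K, hK⟩ := h
  obtain ⟨Z, hZ, K', hK'⟩ := h'
  exact ⟨Y.prod Z, Sys.prod_good hY hZ, _, _, Y.prod_repl Z hK, Y.prod_repr Z hK'⟩


/-- Classifier remembering a property of the first letter. -/
def fstClf (A : Type) (f : A → Prop) : Clf A (Option Prop) where
  ini := none
  step := fun s a => match s with
    | none => some (f a)
    | some b => some b

theorem fstClf_run {A : Type} (f : A → Prop) (x : ℕ → A) (i k : ℕ) (h : i < k) :
    (fstClf A f).run x i k = some (f (x i)) := by
  induction k, h using Nat.le_induction with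
  | base => rw [Clf.run_succ _ _ le_rfl, Clf.run_of_le _ _ le_rfl]; rfl
  | succ k hk ih => rw [Clf.run_succ _ _ (by omega), ih]; rfl

theorem fstClf_recog {A : Type} (f : A → Prop) : (fstClf A f).Recog {x | f (x 0)} := by
  rintro x y s m ⟨c, -, h1, h2, -⟩ ⟨c', -, h1', h2', -⟩ hx
  rw [fstClf_run f x 0 _ h1] at h2
  rw [fstClf_run f y 0 _ h1', ← h2] at h2'
  simp only [Option.some.injEq] at h2'
  show f (y 0)
  rw [h2']; exact hx

theorem RepB.atom (p : ℕ) : RepB (Bnd 0) (fun _ M σ => p ∈ M.val (σ 0)) := by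
  refine ⟨⟨Prop, Empty, Option Prop, fun _ _ => False, fun _ => ∅, fstClf Prop id,
    fun q => q.elim, fun l v => l ↔ p ∈ v⟩, ?_, _, fstClf_recog id, ?_⟩
  · refine ⟨inferInstanceAs (Finite Prop), inferInstanceAs (Finite Empty),
      inferInstanceAs (Finite (Option Prop)), ?_, ?_, ?_, ?_⟩
    · show Nat.card Prop ≤ 3
      simp
    · show Nat.card Empty ≤ 3
      simp
    · show Nat.card (Option Prop) ≤ 3
      simp
    · intro U M
      exact ⟨fun w => p ∈ M.val w, fun w => Iff.rfl, fun w q => Empty.elim q⟩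
  · intro U M lam hc σ _
    exact (hc.1 (σ 0)).symm

end Stmt9

namespace Stmt9

theorem Clf.run_pres {A S : Type} (C : Clf A S) (P : S → Prop) (habs : ∀ s a, P s → P (C.step s a))
    (x : ℕ → A) {k l : ℕ} (hkl : k ≤ l) (h : P (C.run x 0 k)) : P (C.run x 0 l) := by
  induction l, hkl using Nat.le_induction with
  | base => exact h
  | succ l _ ih => rw [C.run_succ _ (Nat.zero_le l)]; exact habs _ _ ih

theorem Clf.recog_reach {A S : Type} (C : Clf A S) (mul : S → S → S)
    (hmul : ∀ x i j k, i ≤ j → j ≤ k → C.run x i k = mul (C.run x i j) (C.run x j k))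
    (P : S → Prop) (habs : ∀ s a, P s → P (C.step s a)) :
    C.Recog {x | ∃ k, P (C.run x 0 k)} := by
  intro x y s m hx hy hxK
  let t : ℕ → S := fun a => Nat.rec s (fun _ r => mul r m) a
  have key : ∀ z c, StrictMono c → C.run z 0 (c 0) = s →
      (∀ a, C.run z (c a) (c (a + 1)) = m) → ∀ a, C.run z 0 (c a) = t a := by
    intro z c hc h1 h2 a
    induction a with
    | zero => exact h1
    | succ a ih =>
      rw [hmul z 0 (c a) (c (a + 1)) (Nat.zero_le _) (hc (Nat.lt_succ_self a)).le, ih, h2]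
  obtain ⟨c, hc, -, h1, h2⟩ := hx
  obtain ⟨c', hc', -, h1', h2'⟩ := hy
  obtain ⟨k, hk⟩ := hxK
  have := C.run_pres P habs x (hc.id_le k) hk
  rw [key x c hc h1 h2, ← key y c' hc' h1' h2'] at this
  exact ⟨_, this⟩

/-! ### Until and next -/

def mulO {B : Type} : Option B → Option B → Option B
  | none, b => b
  | some a, _ => some a

open Classical in
noncomputable def untilClf (A : Type) : Clf ((Bool → Prop) × A) (Option Bool) where
  ini := none
  step := fun s a => mulO s (if a.1 false then some true else if a.1 true then none else some false)

open Classical in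
theorem untilClf_recog (A : Type) : (untilClf A).Recog
    {z | ∃ i, (z i).1 false ∧ ∀ j < i, (z j).1 true} := by
  have hmul : ∀ x i j k, i ≤ j → j ≤ k → (untilClf A).run x i k =
      mulO ((untilClf A).run x i j) ((untilClf A).run x j k) := by
    intro x i j k hij hjk
    induction k, hjk using Nat.le_induction with
    | base =>
      rw [(untilClf A).run_of_le x (le_refl j)]
      cases (untilClf A).run x i j <;> rfl
    | succ k hk ih =>
      rw [Clf.run_succ _ _ (hij.trans hk), Clf.run_succ _ _ hk, ih]
      cases (untilClf A).run x i j <;> cases (untilClf A).run x j k <;> rfl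
  have := (untilClf A).recog_reach mulO hmul (fun s => s = some true) (by
    rintro s a rfl; rfl)
  convert this using 1
  ext z
  show (∃ i, (z i).1 false ∧ ∀ j < i, (z j).1 true) ↔ ∃ k, (untilClf A).run z 0 k = some true
  constructor
  · intro h
    let i := Nat.find h
    have hi := Nat.find_spec h
    have hmin : ∀ j, j < i → ¬ (z j).1 false := by
      intro j hj hf
      exact Nat.find_min h hj ⟨hf, fun l hl => hi.2 l (by omega)⟩
    have hnone : ∀ j, j ≤ i → (untilClf A).run z 0 j = none := by
      intro j
      induction j with
      | zero => intro _; rfl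
      | succ j ih =>
        intro hj
        rw [Clf.run_succ _ _ (Nat.zero_le j), ih (by omega)]
        show (if _ then _ else if _ then _ else _) = _
        rw [if_neg (hmin j (by omega)), if_pos (hi.2 j (by omega))]
    refine ⟨i + 1, ?_⟩
    rw [Clf.run_succ _ _ (Nat.zero_le i), hnone i le_rfl]
    show (if _ then _ else if _ then _ else _) = _
    rw [if_pos hi.1]
  · rintro ⟨k, hk⟩
    have key : ∀ k, ((untilClf A).run z 0 k = none → ∀ j < k, (z j).1 true) ∧
        ((untilClf A).run z 0 k = some true → ∃ i, (z i).1 false ∧ ∀ j < i, (z j).1 true) := by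
      intro k
      induction k with
      | zero => exact ⟨fun _ j hj => by omega, fun h => by cases h⟩
      | succ k ih =>
        rw [Clf.run_succ _ _ (Nat.zero_le k)]
        cases hr : (untilClf A).run z 0 k with
        | some b =>
          refine ⟨fun h => (by cases h), fun h => ?_⟩
          have : some b = some true := h
          exact ih.2 (hr.trans this)
        | none =>
          have h0 := ih.1 hr
          show ((if _ then _ else if _ then _ else _) = _ → _) ∧
            ((if _ then _ else if _ then _ else _) = _ → _)
          by_cases h1 : (z k).1 false
          · rw [if_pos h1]
            exact ⟨fun h => by (cases h), fun _ => ⟨k, h1, h0⟩⟩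
          · rw [if_neg h1]
            by_cases h2 : (z k).1 true
            · rw [if_pos h2]
              refine ⟨fun _ j hj => ?_, fun h => by cases h⟩
              rcases Nat.lt_succ_iff_lt_or_eq.1 hj with h | rfl
              · exact h0 j h
              · exact h2
            · rw [if_neg h2]
              exact ⟨fun h => by (cases h), fun h => by simp at h⟩
    exact (key k).2 hk

/-- Classifier remembering the first two verdicts. -/
abbrev NxS := Option (Prop × Option Prop)

def nmul : NxS → NxS → NxS
  | none, b => b
  | some (a, none), none => some (a, none)
  | some (a, none), some (b, _) => some (a, some b)
  | some (a, some b), _ => some (a, some b)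

def nextClf (A : Type) : Clf ((Bool → Prop) × A) NxS where
  ini := none
  step := fun s a => nmul s (some (a.1 true, none))

theorem nextClf_recog (A : Type) : (nextClf A).Recog {z | (z 1).1 true} := by
  have hmul : ∀ x i j k, i ≤ j → j ≤ k → (nextClf A).run x i k =
      nmul ((nextClf A).run x i j) ((nextClf A).run x j k) := by
    intro x i j k hij hjk
    induction k, hjk using Nat.le_induction with
    | base =>
      rw [(nextClf A).run_of_le x (le_refl j)]
      rcases (nextClf A).run x i j with _ | ⟨a, _ | b⟩ <;> rfl
    | succ k hk ih =>
      rw [Clf.run_succ _ _ (hij.trans hk), Clf.run_succ _ _ hk, ih]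
      rcases (nextClf A).run x i j with _ | ⟨a, _ | b⟩ <;>
        rcases (nextClf A).run x j k with _ | ⟨a', _ | b'⟩ <;> rfl
  have habs : ∀ (s : NxS) (a : (Bool → Prop) × A), (∃ p : Prop × Prop, p.2 ∧ s = some (p.1, some p.2)) →
      ∃ p : Prop × Prop, p.2 ∧ (nextClf A).step s a = some (p.1, some p.2) := by
    rintro s a ⟨p, hp, rfl⟩
    exact ⟨p, hp, rfl⟩
  have := (nextClf A).recog_reach nmul hmul _ habs
  convert this using 1
  ext z
  have h2 : (nextClf A).run z 0 2 = some ((z 0).1 true, some ((z 1).1 true)) := rfl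
  constructor
  · intro h
    exact ⟨2, ((z 0).1 true, (z 1).1 true), h, h2⟩
  · rintro ⟨k, hk⟩
    have hk' := (nextClf A).run_pres _ habs z (Nat.le_add_right k 2) hk
    have h3 := (nextClf A).run_pres (fun s => s = some ((z 0).1 true, some ((z 1).1 true)))
      (by rintro s a rfl; rfl) z (Nat.le_add_left 2 k) h2
    obtain ⟨p, hp, e⟩ := hk'
    rw [h3] at e
    simp only [Option.some.injEq, Prod.mk.injEq] at e
    show (z 1).1 true
    rw [e.2]; exact hp

theorem fullpath_suffix {U : Type} {M : KStruct ℕ U} {π : ℕ → U} (h : IsFullpath M π) (n : ℕ) :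
    IsFullpath M (suffix π n) := by
  intro i
  have := h (i + n)
  show M.rel (π (i + n)) (π (i + 1 + n))
  rwa [show i + 1 + n = i + n + 1 by omega]

/-- Extension by composition. -/
def Sys.cmp (Y : Sys) {SJ : Type} (CJ : Clf ((Bool → Prop) × Y.L) SJ) : Sys :=
  Y.ext (X := Empty) id (Y.C.comp CJ) Prod.fst rfl (fun _ _ => rfl) (fun _ _ => False)
    (fun _ => ∅) (fun x => x.elim)

theorem Sys.cmp_good {Y : Sys} {SJ : Type} (CJ : Clf ((Bool → Prop) × Y.L) SJ) {m : ℕ}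
    (h : Y.Good m) [Finite SJ] (hc : Nat.card SJ ≤ 7) : (Y.cmp CJ).Good (FF m) := by
  have := h.finL; have := h.finQ; have := h.finS
  have hb : m ≤ FF m ∧ m * 7 ^ ((2 ^ 2) ^ m) ≤ FF m := by
    unfold FF
    have h2 := Nat.zero_le (m * 7 ^ ((2 ^ 2) ^ m))
    have h3 := Nat.zero_le (m * 2 ^ m)
    have h4 := Nat.zero_le ((m * 2) ^ m)
    have h5 := Nat.zero_le (m * m)
    constructor <;> omega
  refine ⟨inferInstanceAs (Finite Y.L), inferInstanceAs (Finite (Y.Q ⊕ Empty)),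
    inferInstanceAs (Finite (Y.S × ((Y.S → Bool → Prop) → SJ))), ?_, ?_, ?_, ?_⟩
  · exact h.cardL.trans hb.1
  · show Nat.card (Y.Q ⊕ Empty) ≤ _
    rw [Nat.card_sum]
    simpa using h.cardQ.trans hb.1
  · show Nat.card (Y.S × ((Y.S → Bool → Prop) → SJ)) ≤ _
    rw [Nat.card_prod, Nat.card_fun, Nat.card_fun, Nat.card_fun]
    refine le_trans (Nat.mul_le_mul h.cardS ?_) hb.2
    have e : Nat.card Prop ^ Nat.card Bool = 2 ^ 2 := by simp
    rw [e]
    refine (Nat.pow_le_pow_left hc _).trans (Nat.pow_le_pow_right (by omega) ?_)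
    exact Nat.pow_le_pow_right (by omega) h.cardS
  · intro U M
    obtain ⟨lam, hl⟩ := h.ex U M
    exact ⟨lam, (Y.ext_con id _ _ _ _ _ _ _ M lam).2 ⟨hl, fun _ x => x.elim⟩⟩

theorem RepB2.untl {m : ℕ} {Φ Ψ : PP} (h : RepB2 m Φ Ψ) : RepB (FF m) (fun U M σ =>
    ∃ i, Ψ U M (suffix σ i) ∧ ∀ j < i, Φ U M (suffix σ j)) := by
  obtain ⟨Y, hY, K, K', hK, hK'⟩ := h
  refine ⟨Y.cmp (untilClf Y.L), Sys.cmp_good _ hY (by simp),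
    {x | verd (fun b => cond b K K') x ∈ {z | ∃ i, (z i).1 false ∧ ∀ j < i, (z j).1 true}}, ?_, ?_⟩
  · exact Y.C.comp_recog (untilClf Y.L) (fun b => cond b K K')
      (by rintro (_ | _); exacts [hK'.rcg, hK.rcg]) _ (untilClf_recog Y.L)
  · intro U M lam hc σ hσ
    have hc' := ((Y.ext_con id _ _ _ _ _ _ _ M lam).1 hc).1
    refine exists_congr fun i => and_congr ?_ (forall_congr' fun j => forall_congr' fun _ => ?_)
    · exact hK'.iff U M lam hc' _ (fullpath_suffix hσ i)
    · exact hK.iff U M lam hc' _ (fullpath_suffix hσ j)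

theorem RepB.next {m : ℕ} {Φ : PP} (h : RepB m Φ) : RepB (FF m) (fun U M σ =>
    Φ U M (suffix σ 1)) := by
  obtain ⟨Y, hY, K, hK⟩ := h
  refine ⟨Y.cmp (nextClf Y.L), Sys.cmp_good _ hY (by simp),
    {x | verd (fun _ => K) x ∈ {z | (z 1).1 true}}, ?_, ?_⟩
  · exact Y.C.comp_recog (nextClf Y.L) (fun b => K)
      (by rintro _; exact hK.rcg) _ (nextClf_recog Y.L)
  · intro U M lam hc σ hσ
    have hc' := ((Y.ext_con id _ _ _ _ _ _ _ M lam).1 hc).1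
    exact hK.iff U M lam hc' _ (fullpath_suffix hσ 1)

theorem RepB.neg {m : ℕ} {Φ : PP} (h : RepB m Φ) : RepB m (fun U M σ => ¬ Φ U M σ) := by
  obtain ⟨Y, hY, K, hK⟩ := h
  exact ⟨Y, hY, _, hK.neg⟩

theorem RepB2.and {m : ℕ} {Φ Ψ : PP} (h : RepB2 m Φ Ψ) :
    RepB m (fun U M σ => Φ U M σ ∧ Ψ U M σ) := by
  obtain ⟨Y, hY, K, K', hK, hK'⟩ := h
  exact ⟨Y, hY, _, hK.and hK'⟩


/-- A universal path property determined by labels. -/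
structure RepP (Y : Sys) (Φ : PP) (P : Y.L → Prop) : Prop where
  rcg : Y.C.Recog {x | P (x 0)}
  iff : ∀ (U : Type) (M : KStruct ℕ U) (lam : U → Y.L), Y.Con M lam → ∀ w,
    (P (lam w) ↔ ∀ π, IsFullpath M π → π 0 = w → Φ U M π)

theorem RepB.all {m : ℕ} {Φ : PP} (h : RepB m Φ) : ∃ Y : Sys, Y.Good (FF m) ∧ ∃ P, RepP Y Φ P := by
  obtain ⟨Y, hY, K, hK⟩ := h
  have := hY.finL; have := hY.finQ; have := hY.finS
  let C' : Clf (Y.L × Prop) (Y.S × Option Prop) :=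
    ⟨(Y.C.ini, none), fun s a => (Y.C.step s.1 a.1, (fstClf (Y.L × Prop) (fun a => ¬ a.2)).step s.2 a)⟩
  have hKX : C'.Recog {x | (fun i => (x i).1) ∈ Kᶜ} :=
    hK.rcg.compl.sim (fun a : Y.L × Prop => a.1) (fun s : Y.S × Option Prop => s.1) rfl
      (fun _ _ => rfl)
  let Y' : Sys := Y.ext (X := Unit) (fun a : Y.L × Prop => a.1) C'
    (fun s : Y.S × Option Prop => s.1) rfl (fun _ _ => rfl) (fun a _ => a.2)
    (fun _ => {x | (fun i => (x i).1) ∈ Kᶜ}) (fun _ => hKX)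
  have hcon : ∀ (U : Type) (M : KStruct ℕ U) (lam : U → Y'.L), Y'.Con M lam ↔
      Y.Con M (fun w => (lam w).1) ∧ NameOK (fun (a : Y.L × Prop) (_ : Unit) => a.2)
        (fun _ => {x | (fun i => (x i).1) ∈ Kᶜ}) M lam := fun U M lam =>
    Y.ext_con _ _ _ _ _ _ _ _ M lam
  have hb : 3 * m + 3 ≤ FF m := by
    unfold FF
    have h2 := Nat.zero_le (m * 7 ^ ((2 ^ 2) ^ m))
    have h3 := Nat.zero_le (m * 2 ^ m)
    have h4 := Nat.zero_le ((m * 2) ^ m)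
    have h5 := Nat.zero_le (m * m)
    omega
  have h1 := hY.cardL; have h2 := hY.cardQ; have h3 := hY.cardS
  refine ⟨Y', ⟨inferInstanceAs (Finite (Y.L × Prop)), inferInstanceAs (Finite (Y.Q ⊕ Unit)),
    inferInstanceAs (Finite (Y.S × Option Prop)), ?_, ?_, ?_, ?_⟩, fun a => ¬ a.2, ?_, ?_⟩
  · show Nat.card (Y.L × Prop) ≤ _
    rw [Nat.card_prod]; simp; omega
  · show Nat.card (Y.Q ⊕ Unit) ≤ _
    rw [Nat.card_sum]; simp; omega
  · show Nat.card (Y.S × Option Prop) ≤ _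
    rw [Nat.card_prod]; simp; omega
  · intro U M
    obtain ⟨lam, hl⟩ := hY.ex U M
    refine ⟨fun w => (lam w, ∃ π, IsFullpath M π ∧ π 0 = w ∧ (fun i => lam (π i)) ∈ Kᶜ),
      (hcon U M _).2 ⟨hl, fun w _ => Iff.rfl⟩⟩
  · exact (fstClf_recog (fun a : Y.L × Prop => ¬ a.2)).sim (C' := C') id
      (fun s : Y.S × Option Prop => s.2) rfl (fun _ _ => rfl)
  · intro U M lam hc w
    obtain ⟨hc1, hc2⟩ := (hcon U M lam).1 hc
    have := hc2 w ()
    simp only at this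
    rw [this]
    push Not
    refine forall_congr' fun π => forall_congr' fun h => forall_congr' fun _ => ?_
    have := hK.iff U M _ hc1 π h
    show ¬ (_ ∉ K) ↔ _
    rw [not_not, this]

theorem RepB.fall {m : ℕ} {Φ : PP} (h : RepB m Φ) : RepB (FF m) (fun U M σ =>
    ∀ π, IsFullpath M π → π 0 = σ 0 → Φ U M π) := by
  obtain ⟨Y, hY, P, hP⟩ := h.all
  exact ⟨Y, hY, _, hP.rcg, fun U M lam hc σ _ => (hP.iff U M lam hc (σ 0)).symm⟩

end Stmt9

namespace Stmt9

/-! ### Robustness -/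

def Clf.frm {A S : Type} (C : Clf A S) (t : S) : Clf A S := ⟨t, C.step⟩

theorem Clf.frm_run {A S : Type} (C : Clf A S) (x : ℕ → A) {i j k : ℕ} (hij : i ≤ j) (hjk : j ≤ k) :
    (C.frm (C.run x i j)).run x j k = C.run x i k := by
  induction k, hjk using Nat.le_induction with
  | base => rw [Clf.run_of_le _ _ le_rfl]; rfl
  | succ k hk ih => rw [Clf.run_succ _ _ hk, C.run_succ _ (hij.trans hk), ih]; rfl

theorem Clf.frm_frm {A S : Type} (C : Clf A S) (t u : S) : (C.frm t).frm u = C.frm u := rfl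

/-- put the first `n` letters of `y` before `x` -/
def splice {A : Type} (y : ℕ → A) (n : ℕ) (x : ℕ → A) : ℕ → A :=
  fun j => if j < n then y j else x (j - n)

theorem Clf.run_splice {A S : Type} (C : Clf A S) (x y : ℕ → A) (n i k : ℕ) :
    C.run (splice y n x) (i + n) (k + n) = C.run x i k := by
  rw [← C.run_shift]
  congr 1
  funext j
  simp [splice]

theorem Clf.run_splice0 {A S : Type} (C : Clf A S) (x y : ℕ → A) (n k : ℕ) :
    C.run (splice y n x) 0 (k + n) = (C.frm (C.run y 0 n)).run x 0 k := by
  rw [← C.frm_run (splice y n x) (Nat.zero_le n) (Nat.le_add_left n k)]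
  have h : C.run (splice y n x) 0 n = C.run y 0 n := by
    apply C.run_congr
    intro j _ hj
    simp [splice, hj]
  rw [h]
  have := (C.frm (C.run y 0 n)).run_splice x y n 0 k
  rwa [Nat.zero_add] at this

/-- Transition-function classifier with flags. -/
def robClf {A S : Type} (C : Clf A S) : Clf (A × (S → Prop)) (S → S × Prop) where
  ini := fun t => (t, False)
  step := fun f a t => (C.step (f t).1 a.1, (f t).2 ∨ a.2 (f t).1)

theorem robClf_fst {A S : Type} (C : Clf A S) (x : ℕ → A × (S → Prop)) (i k : ℕ) (t : S) :
    ((robClf C).run x i k t).1 = (C.frm t).run (fun j => (x j).1) i k := by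
  induction k with
  | zero => rfl
  | succ k ih =>
    by_cases hk : i ≤ k
    · rw [Clf.run_succ _ _ hk, Clf.run_succ _ _ hk, ← ih]; rfl
    · rw [Clf.run_of_le _ _ (by omega), Clf.run_of_le _ _ (by omega)]; rfl

theorem robClf_snd {A S : Type} (C : Clf A S) (x : ℕ → A × (S → Prop)) (k : ℕ) (t : S) :
    ((robClf C).run x 0 k t).2 ↔
      ∃ j < k, (x j).2 ((C.frm t).run (fun j => (x j).1) 0 j) := by
  induction k with
  | zero => constructor
            · intro h; exact h.elim
            · rintro ⟨j, hj, -⟩; omega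
  | succ k ih =>
    rw [Clf.run_succ _ _ (Nat.zero_le k)]
    show (_ ∨ _) ↔ _
    rw [ih, robClf_fst]
    constructor
    · rintro (⟨j, hj, h⟩ | h)
      · exact ⟨j, by omega, h⟩
      · exact ⟨k, by omega, h⟩
    · rintro ⟨j, hj, h⟩
      rcases Nat.lt_succ_iff_lt_or_eq.1 hj with h' | rfl
      · exact .inl ⟨j, h', h⟩
      · exact .inr h

theorem robClf_mul {A S : Type} (C : Clf A S) (x : ℕ → A × (S → Prop)) (i j k : ℕ) (hij : i ≤ j)
    (hjk : j ≤ k) : (robClf C).run x i k = fun t =>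
      (((robClf C).run x j k ((robClf C).run x i j t).1).1,
        ((robClf C).run x i j t).2 ∨ ((robClf C).run x j k ((robClf C).run x i j t).1).2) := by
  induction k, hjk using Nat.le_induction with
  | base =>
    rw [(robClf C).run_of_le x (le_refl j)]
    funext t
    ext
    · rfl
    · show _ ↔ _ ∨ False
      simp
  | succ k hk ih =>
    rw [Clf.run_succ _ _ (hij.trans hk), Clf.run_succ _ _ hk, ih]
    funext t
    ext
    · rfl
    · show (_ ∨ _) ∨ _ ↔ _ ∨ (_ ∨ _)
      rw [or_assoc]

theorem robClf_flag {A S : Type} (C : Clf A S) : (robClf C).Recog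
    {x | ∃ j, (x j).2 (C.run (fun j => (x j).1) 0 j)} := by
  have := (robClf C).recog_reach (fun f g t => ((g (f t).1).1, (f t).2 ∨ (g (f t).1).2))
    (fun x i j k hij hjk => robClf_mul C x i j k hij hjk) (fun f => (f C.ini).2)
    (fun f a h => Or.inl h)
  convert this using 1
  ext x
  constructor
  · rintro ⟨j, hj⟩
    exact ⟨j + 1, (robClf_snd C x (j + 1) C.ini).2 ⟨j, by omega, hj⟩⟩
  · rintro ⟨k, hk⟩
    obtain ⟨j, -, hj⟩ := (robClf_snd C x k C.ini).1 hk
    exact ⟨j, hj⟩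

theorem splice_mem_iff {A S : Type} [Finite S] (C : Clf A S) {K : Set (ℕ → A)} (hK : C.Recog K)
    (x y y' : ℕ → A) (n n' : ℕ) (h : C.run y 0 n = C.run y' 0 n') (hx : splice y n x ∈ K) :
    splice y' n' x ∈ K := by
  obtain ⟨c, m, _, hc, h0, h1, -⟩ := C.exists_type x (fun _ => ())
  refine hK _ _ ((C.frm (C.run y 0 n)).run x 0 (c 0)) m ?_ ?_ hx
  · refine ⟨fun a => c a + n, fun a b hab => Nat.add_lt_add_right (hc hab) n, Nat.add_pos_left h0 _, ?_, fun a => ?_⟩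
    · exact C.run_splice0 x y n (c 0)
    · exact (C.run_splice x y n _ _).trans (h1 a)
  · refine ⟨fun a => c a + n', fun a b hab => Nat.add_lt_add_right (hc hab) n', Nat.add_pos_left h0 _, ?_, fun a => ?_⟩
    · rw [h]; exact C.run_splice0 x y' n' (c 0)
    · exact (C.run_splice x y' n' _ _).trans (h1 a)

theorem robClf_splice {A S : Type} (C : Clf A S) {K : Set (ℕ → A)} (hK : C.Recog K)
    (y : ℕ → A) (n : ℕ) :
    (robClf C).Recog {x | splice y n (fun i => (x i).1) ∈ K} := by
  rintro x x' f m ⟨c, hc, h0, h1, h2⟩ ⟨c', hc', h0', h1', h2'⟩ hx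
  refine hK _ _ (f (C.run y 0 n)).1 (m C.ini).1 ?_ ?_ hx
  · refine ⟨fun a => c a + n, fun a b hab => Nat.add_lt_add_right (hc hab) n, Nat.add_pos_left h0 _, ?_, fun a => ?_⟩
    · rw [← h1, robClf_fst]; exact C.run_splice0 _ y n (c 0)
    · rw [← h2 a, robClf_fst]; exact (C.run_splice _ y n _ _)
  · refine ⟨fun a => c' a + n, fun a b hab => Nat.add_lt_add_right (hc' hab) n, Nat.add_pos_left h0' _, ?_, fun a => ?_⟩
    · rw [← h1', robClf_fst]; exact C.run_splice0 _ y n (c' 0)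
    · rw [← h2' a, robClf_fst]; exact (C.run_splice _ y n _ _)

theorem RepB2.robust {m : ℕ} {Φ Ψ : PP}
    (h : RepB2 m Φ Ψ) : RepB (FF m) (fun U M σ => Φ U M σ ∧ ∀ π, IsFullpath M π →
      (∃ i, (∀ j ≤ i, π j = σ j) ∧ Ψ U M (suffix π i)) → Φ U M π) := by
  obtain ⟨Y, hY, K, K', hK, hK'⟩ := h
  have := hY.finL; have := hY.finQ; have := hY.finS
  let KX : Y.S → Set (ℕ → Y.L × (Y.S → Prop)) := fun s =>
    {x | (fun i => (x i).1) ∈ K' ∧ ∃ y n, Y.C.run y 0 n = s ∧ splice y n (fun i => (x i).1) ∉ K}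
  have hsim : ∀ s a, ((robClf Y.C).step s a Y.C.ini).1 = Y.C.step (s Y.C.ini).1 a.1 :=
    fun _ _ => rfl
  have hKX : ∀ s, (robClf Y.C).Recog (KX s) := by
    intro s
    refine Clf.Recog.inter (hK'.rcg.sim (fun a : Y.L × (Y.S → Prop) => a.1)
      (fun f : Y.S → Y.S × Prop => (f Y.C.ini).1) rfl hsim) ?_
    rintro x x' f m hx hx' ⟨y, n, h1, h2⟩
    exact ⟨y, n, h1, (robClf_splice Y.C hK.rcg y n).compl x x' f m hx hx' h2⟩
  let Y' : Sys := Y.ext (fun a : Y.L × (Y.S → Prop) => a.1) (robClf Y.C)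
    (fun f : Y.S → Y.S × Prop => (f Y.C.ini).1) rfl hsim (fun a s => a.2 s) KX hKX
  have hcon : ∀ (U : Type) (M : KStruct ℕ U) (lam : U → Y'.L), Y'.Con M lam ↔
      Y.Con M (fun w => (lam w).1) ∧ NameOK (fun (a : Y.L × (Y.S → Prop)) s => a.2 s) KX M lam :=
    fun U M lam => Y.ext_con _ _ _ _ _ _ _ _ M lam
  have hb : m * 2 ^ m ≤ FF m ∧ m + m ≤ FF m ∧ (m * 2) ^ m ≤ FF m := by
    unfold FF
    have h2 := Nat.zero_le (m * 7 ^ ((2 ^ 2) ^ m))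
    have h3 := Nat.zero_le (m * 2 ^ m)
    have h4 := Nat.zero_le ((m * 2) ^ m)
    have h5 := Nat.zero_le (m * m)
    refine ⟨?_, ?_, ?_⟩ <;> omega
  have h1 := hY.cardL; have h2 := hY.cardQ; have h3 := hY.cardS
  refine ⟨Y', ⟨inferInstanceAs (Finite (Y.L × (Y.S → Prop))), inferInstanceAs (Finite (Y.Q ⊕ Y.S)),
    inferInstanceAs (Finite (Y.S → Y.S × Prop)), ?_, ?_, ?_, ?_⟩,
    {x | (fun i => (x i).1) ∈ K} ∩ {x | ∃ j, (x j).2 (Y.C.run (fun j => (x j).1) 0 j)}ᶜ, ?_, ?_⟩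
  · show Nat.card (Y.L × (Y.S → Prop)) ≤ _
    rw [Nat.card_prod, Nat.card_fun, show Nat.card Prop = 2 by simp]
    exact (Nat.mul_le_mul h1 (Nat.pow_le_pow_right (by omega) h3)).trans hb.1
  · show Nat.card (Y.Q ⊕ Y.S) ≤ _
    rw [Nat.card_sum]; omega
  · show Nat.card (Y.S → Y.S × Prop) ≤ _
    rw [Nat.card_fun, Nat.card_prod, show Nat.card Prop = 2 by simp]
    have hpos : 0 < Nat.card Y.S := by
      have : Nonempty Y.S := ⟨Y.C.ini⟩
      exact Nat.card_pos
    refine le_trans ?_ hb.2.2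
    exact (Nat.pow_le_pow_left (by omega) _).trans (Nat.pow_le_pow_right (by omega) h3)
  · intro U M
    obtain ⟨lam, hl⟩ := hY.ex U M
    refine ⟨fun w => (lam w, fun s => ∃ π, IsFullpath M π ∧ π 0 = w ∧
      ((fun i => lam (π i)) ∈ K' ∧
        ∃ y n, Y.C.run y 0 n = s ∧ splice y n (fun i => lam (π i)) ∉ K)),
      (hcon U M _).2 ⟨hl, fun w _ => Iff.rfl⟩⟩
  · exact Clf.Recog.inter (hK.rcg.sim (fun a : Y.L × (Y.S → Prop) => a.1)
      (fun f : Y.S → Y.S × Prop => (f Y.C.ini).1) rfl hsim) (robClf_flag Y.C).compl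
  · intro U M lam hc σ hσ
    obtain ⟨hc1, hc2⟩ := (hcon U M lam).1 hc
    refine and_congr (hK.iff U M _ hc1 σ hσ) ?_
    show _ ↔ ¬ ∃ j, (lam (σ j)).2 (Y.C.run (fun j => (lam (σ j)).1) 0 j)
    constructor
    · rintro hall ⟨j, hj⟩
      obtain ⟨ρ, hρ, hρ0, hρ1, y, n, hyn, hy⟩ := (hc2 (σ j) _).1 hj
      have hsp : splice (fun j => (lam (σ j)).1) j (fun i => (lam (ρ i)).1) ∉ K := by
        intro hin
        exact hy (splice_mem_iff Y.C hK.rcg _ _ _ _ _ hyn.symm hin)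
      let π : ℕ → U := splice σ j ρ
      have hπ : IsFullpath M π := by
        intro i
        show M.rel (if _ then _ else _) (if _ then _ else _)
        by_cases h1 : i + 1 < j
        · rw [if_pos (by omega), if_pos h1]; exact hσ i
        · rw [if_neg h1]
          by_cases h2 : i < j
          · rw [if_pos h2, show i + 1 - j = 0 by omega, hρ0]
            have : j = i + 1 := by omega
            rw [this]; exact hσ i
          · rw [if_neg h2, show i + 1 - j = i - j + 1 by omega]
            exact hρ _
      have hsuf : suffix π j = ρ := by
        funext i
        simp [suffix, π, splice]
      have := hall π hπ ⟨j, ?_, ?_⟩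
      · rw [hK.iff U M _ hc1 π hπ] at this
        apply hsp
        convert this using 1
        funext i
        simp only [splice, π]
        split <;> rfl
      · intro i hi
        show (if _ then _ else _) = _
        by_cases h : i < j
        · rw [if_pos h]
        · rw [if_neg h, show i - j = 0 by omega, hρ0, show i = j by omega]
      · rw [hsuf, hK'.iff U M _ hc1 ρ hρ]; exact hρ1
    · intro hno π hπ ⟨i, hi, hΨ⟩
      rw [hK.iff U M _ hc1 π hπ]
      by_contra hnot
      apply hno
      refine ⟨i, (hc2 (σ i) _).2 ⟨suffix π i, fullpath_suffix hπ i, ?_, ?_,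
        fun j => (lam (σ j)).1, i, rfl, ?_⟩⟩
      · show π (0 + i) = σ i
        rw [Nat.zero_add]; exact hi i le_rfl
      · exact (hK'.iff U M _ hc1 _ (fullpath_suffix hπ i)).1 hΨ
      · have e : splice (fun j => (lam (σ j)).1) i (fun j => (lam (suffix π i j)).1) =
            fun j => (lam (π j)).1 := by
          funext j
          show (if _ then _ else _) = _
          by_cases h : j < i
          · rw [if_pos h, hi j h.le]
          · rw [if_neg h]
            show (lam (π (j - i + i))).1 = _
            rw [Nat.sub_add_cancel (by omega)]
        rw [e]; exact hnot

/-! ### All formulas -/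

def ffPP : PP := fun _ M σ => FailureFree M 0 σ

theorem RepB.ff : RepB (Bnd 4) ffPP := by
  have h0 := RepB.atom 0
  have h1 : RepB (Bnd 1) (fun U M σ => 0 ∈ M.val (σ 0) ∧ ¬ 0 ∈ M.val (σ 0)) := by
    rw [Bnd_succ]
    exact (h0.pair h0.neg).and
  have h2 := (h1.neg.pair (h0.mono (Bnd_mono (by omega)))).untl
  rw [← Bnd_succ, ← Bnd_succ] at h2
  have h3 := h2.neg.next
  rw [← Bnd_succ] at h3
  convert h3 using 1
  funext U M σ
  apply propext
  show (∀ i, 0 < i → 0 ∉ M.val (σ i)) ↔ _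
  constructor
  · rintro h ⟨i, hi, -⟩
    exact h (0 + i + 1) (by omega) hi
  · intro h i hi h'
    refine h ⟨i - 1, ?_, fun j _ h'' => h''.2 h''.1⟩
    show 0 ∈ M.val (σ (0 + (i - 1) + 1))
    rwa [show 0 + (i - 1) + 1 = i by omega]

theorem Bnd_comb {a k n : ℕ} (h : a + k ≤ n) : FF^[k] (Bnd a) ≤ Bnd n := by
  have : FF^[k] (Bnd a) = Bnd (k + a) := by
    show FF^[k] (FF^[a] 3) = _
    rw [← Function.iterate_add_apply]; rfl
  rw [this]; exact Bnd_mono (by omega)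

theorem Bnd_comb1 {a n : ℕ} (h : a + 1 ≤ n) : FF (Bnd a) ≤ Bnd n := Bnd_comb (k := 1) h

theorem Bnd_comb2 {a n : ℕ} (h : a + 2 ≤ n) : FF (FF (Bnd a)) ≤ Bnd n := Bnd_comb (k := 2) h

theorem RepB.form (φ : Form ℕ) : RepB (Bnd (5 + enc φ)) (fun _ M σ => sat M 0 φ σ) := by
  induction φ with
  | atom p => exact (RepB.atom p).mono (Bnd_mono (by omega))
  | neg φ ih =>
    exact ih.neg.mono (Bnd_mono (by have := Nat.add_le_pair 1 (enc φ); simp only [enc]; omega))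
  | conj φ ψ ih1 ih2 =>
    have h1 := Nat.add_le_pair (enc φ) (enc ψ)
    have h2 := Nat.add_le_pair 2 (Nat.pair (enc φ) (enc ψ))
    exact (((ih1.mono (Bnd_mono (by omega : _ ≤ 5 + (enc φ + enc ψ)))).pair
      (ih2.mono (Bnd_mono (by omega)))).and).mono
      (Bnd_comb1 (by simp only [enc]; omega))
  | untl φ ψ ih1 ih2 =>
    have h1 := Nat.add_le_pair (enc φ) (enc ψ)
    have h2 := Nat.add_le_pair 3 (Nat.pair (enc φ) (enc ψ))
    exact (((ih1.mono (Bnd_mono (by omega : _ ≤ 5 + (enc φ + enc ψ)))).pair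
      (ih2.mono (Bnd_mono (by omega)))).untl).mono
      (Bnd_comb2 (by simp only [enc]; omega))
  | next φ ih =>
    have h2 := Nat.add_le_pair 4 (enc φ)
    exact ih.next.mono (Bnd_comb1 (by simp only [enc]; omega))
  | fall φ ih =>
    have h2 := Nat.add_le_pair 5 (enc φ)
    exact ih.fall.mono (Bnd_comb1 (by simp only [enc]; omega))
  | oblig φ ih =>
    have h2 := Nat.add_le_pair 6 (enc φ)
    have := ((RepB.ff.mono (Bnd_mono (by omega))).pair ih.neg).and.neg.fall.mono
      (Bnd_comb2 (n := 5 + enc (Form.oblig φ)) (by simp only [enc]; omega))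
    convert this using 1
    funext U M σ
    apply propext
    refine forall_congr' fun π => forall_congr' fun _ => forall_congr' fun _ => ?_
    show (FailureFree M 0 π → _) ↔ ¬ (FailureFree M 0 π ∧ ¬ _)
    tauto
  | robust φ ih =>
    have h2 := Nat.add_le_pair 7 (enc φ)
    have := ((ih.mono (Bnd_mono (by omega))).pair (RepB.ff.next.mono (n := Bnd (5 + enc φ))
      (Bnd_comb1 (by omega)))).robust.mono
      (Bnd_comb2 (n := 5 + enc (Form.robust φ)) (by simp only [enc]; omega))
    convert this using 1
    funext U M σ
    apply propext
    refine and_congr Iff.rfl (forall_congr' fun π => forall_congr' fun _ => ?_)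
    refine imp_congr (exists_congr fun i => and_congr Iff.rfl ?_) Iff.rfl
    show FailureFree M 0 (suffix π (i + 1)) ↔ FailureFree M 0 (suffix (suffix π i) 1)
    have : suffix (suffix π i) 1 = suffix π (i + 1) := by
      funext j
      show π (j + 1 + i) = π (j + (i + 1))
      congr 1; omega
    rw [this]

/-! ### Finite models -/

def GG (m : ℕ) : ℕ := m * ((m + 1) * 8) ^ ((2 ^ m) ^ m)
def HH (b : ℕ) : ℕ := 2 ^ (b * (b * (2 * (b * b)))) * (b * (2 * b + 3))

theorem card_FmpD {Λ Q S : Type} [Finite Λ] [Finite Q] [Finite S] {m : ℕ}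
    (h1 : Nat.card Λ ≤ m) (h2 : Nat.card Q ≤ m) (h3 : Nat.card S ≤ m) :
    Nat.card (FmpD Λ Q S) ≤ HH (GG m) := by
  have hP : Nat.card Prop = 2 := by simp
  have hb : Nat.card (BrS Λ Q S) ≤ GG m := by
    show Nat.card (S × ((S → Q → Prop) → Option Λ × Prop × Prop × Prop)) ≤ _
    rw [Nat.card_prod, Nat.card_fun, Nat.card_fun, Nat.card_fun, Nat.card_prod, Nat.card_prod,
      Nat.card_prod, hP, show Nat.card (Option Λ) = Nat.card Λ + 1 from Finite.card_option]
    refine Nat.mul_le_mul h3 ?_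
    refine (Nat.pow_le_pow_left (Nat.mul_le_mul (Nat.add_le_add_right h1 1) le_rfl) _).trans
      (Nat.pow_le_pow_right (by omega) ?_)
    refine (Nat.pow_le_pow_left (Nat.pow_le_pow_right (by omega) h2) _).trans
      (Nat.pow_le_pow_right (Nat.pos_of_ne_zero (by positivity)) h3)
  have hbf : Finite (BrS Λ Q S) := inferInstance
  generalize hB : BrS Λ Q S = B at hb hbf
  show Nat.card (Clf.DSt (BrS Λ Q S)) ≤ _
  rw [hB]
  show Nat.card ((B × B × Prop × B × B → Prop) × B × Fin (2 * Nat.card B + 3)) ≤ _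
  rw [Nat.card_prod, Nat.card_prod, Nat.card_fun, Nat.card_prod, Nat.card_prod, Nat.card_prod,
    Nat.card_prod, hP, Nat.card_fin]
  unfold HH
  gcongr
  omega

end Stmt9

namespace Stmt9

/-! ## Lassos -/

/-- Walks in a finite graph can be shortened. -/
theorem short_walk {Z : Type} [Finite Z] (E : Z → Z → Prop) (y : ℕ → Z) (T : ℕ)
    (h : ∀ t < T, E (y t) (y (t + 1))) :
    ∃ (y' : ℕ → Z) (T' : ℕ), T' < Nat.card Z ∧ y' 0 = y 0 ∧ y' T' = y T ∧
      ∀ t < T', E (y' t) (y' (t + 1)) := by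
  classical
  have hex : ∃ T', ∃ y' : ℕ → Z, y' 0 = y 0 ∧ y' T' = y T ∧ ∀ t < T', E (y' t) (y' (t + 1)) :=
    ⟨T, y, rfl, rfl, h⟩
  obtain ⟨y', h0, h1, h2⟩ := Nat.find_spec hex
  have hmin := fun m => Nat.find_min hex (m := m)
  generalize Nat.find hex = T' at h1 h2 hmin
  refine ⟨y', T', ?_, h0, h1, h2⟩
  by_contra hcard
  have : ¬ Function.Injective (fun i : Fin (T' + 1) => y' i) := by
    intro hinj
    have := Nat.card_le_card_of_injective _ hinj
    rw [Nat.card_fin] at this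
    omega
  rw [Function.Injective] at this
  push Not at this
  obtain ⟨a, b, hab, hne⟩ := this
  wlog hlt : a.1 < b.1 generalizing a b
  · exact this b a hab.symm hne.symm
      (by have : a.1 ≠ b.1 := fun h => hne (Fin.ext h)
          omega)
  replace hab : y' a.1 = y' b.1 := hab
  have hb := b.2
  refine hmin (T' - (b.1 - a.1)) (by omega)
    ⟨fun t => if t ≤ a.1 then y' t else y' (t + (b.1 - a.1)), by simpa using h0, ?_, ?_⟩
  · simp only
    split
    · rename_i hle
      have : T' = b.1 := by omega
      rw [show T' - (b.1 - a.1) = a.1 by omega, hab, ← this]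
      exact h1
    · rw [show T' - (b.1 - a.1) + (b.1 - a.1) = T' by omega]
      exact h1
  · intro t ht
    simp only
    by_cases h3 : t + 1 ≤ a.1
    · rw [if_pos (by omega), if_pos h3]; exact h2 t (by omega)
    · rw [if_neg h3]
      by_cases h4 : t ≤ a.1
      · rw [if_pos h4]
        have : t = a.1 := by omega
        rw [this, hab, show a.1 + 1 + (b.1 - a.1) = b.1 + 1 by omega]
        exact h2 _ (by omega)
      · rw [if_neg h4, show t + 1 + (b.1 - a.1) = t + (b.1 - a.1) + 1 by omega]
        exact h2 _ (by omega)

theorem short_walk_pos {Z : Type} [Finite Z] (E : Z → Z → Prop) (y : ℕ → Z) (T : ℕ) (hT : 0 < T)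
    (h : ∀ t < T, E (y t) (y (t + 1))) :
    ∃ (y' : ℕ → Z) (T' : ℕ), 0 < T' ∧ T' ≤ Nat.card Z ∧ y' 0 = y 0 ∧ y' T' = y T ∧
      ∀ t < T', E (y' t) (y' (t + 1)) := by
  obtain ⟨y', T', h1, h2, h3, h4⟩ := short_walk E (fun t => y (t + 1)) (T - 1)
    (fun t ht => h _ (by omega))
  refine ⟨fun t => if t = 0 then y 0 else y' (t - 1), T' + 1, by omega, by omega, by simp, ?_, ?_⟩
  · simp only [Nat.add_eq_zero_iff, one_ne_zero, and_false, if_false, Nat.add_sub_cancel]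
    rw [h3, Nat.sub_add_cancel (by omega)]
  · intro t ht
    simp only [Nat.add_eq_zero_iff, one_ne_zero, and_false, if_false, Nat.add_sub_cancel]
    by_cases h0 : t = 0
    · rw [if_pos h0, h0, h2]
      exact h 0 hT
    · rw [if_neg h0]
      have := h4 (t - 1) (by omega)
      rwa [Nat.sub_add_cancel (by omega)] at this

/-- Replacing a path by a lasso of the same type, keeping an initial part. -/
theorem lasso_pre {L S : Type} [Finite S] (C : Clf L S) (N : KStruct ℕ ℕ) (lam : ℕ → L) (n m : ℕ)
    (hS : Nat.card S ≤ m) (π : ℕ → ℕ) (hπ : IsFullpath N π) (hn : ∀ i, π i < n) (d : ℕ) :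
    ∃ (l k : ℕ) (ρ : ℕ → ℕ), l + k + 1 ≤ d + 2 * (n * (m * m)) ∧ (∀ t, l ≤ t → ρ (t + (k + 1)) = ρ t) ∧
      IsFullpath N ρ ∧ (∀ j ≤ d, ρ j = π j) ∧ (∀ t, ρ t < n) ∧
      (∃ s s', C.HasType (fun i => lam (π i)) s s' ∧ C.HasType (fun i => lam (ρ i)) s s') ∧
      (∃ s s', C.HasType (fun i => lam (suffix π d i)) s s' ∧
        C.HasType (fun i => lam (suffix ρ d i)) s s') := by
  obtain ⟨c0, mm, z, hc0, -, hm0, hz0⟩ := C.exists_type (fun i => lam (π i))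
    (fun i => (⟨π i, hn i⟩ : Fin n))
  let x : ℕ → L := fun i => lam (π i)
  let c : ℕ → ℕ := fun a => c0 (a + (d + 1))
  have hc : StrictMono c := fun a b hab => hc0 (by omega)
  have hcd : d < c 0 := lt_of_lt_of_le (show d < 0 + (d + 1) by omega) (hc0.le_apply (x := 0 + (d + 1)))
  have hm : ∀ a, C.run x (c a) (c (a + 1)) = mm := by
    intro a
    have := hm0 (a + (d + 1))
    rwa [show a + (d + 1) + 1 = a + 1 + (d + 1) by omega] at this
  have hz : ∀ a, π (c a) = z.1 := fun a => congrArg Fin.val (hz0 (a + (d + 1)))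
  let Z := Fin n × S × S
  let E : Z → Z → Prop := fun p q => N.rel p.1.1 q.1.1 ∧ q.2.1 = C.step p.2.1 (lam p.1.1) ∧
    q.2.2 = C.step p.2.2 (lam p.1.1)
  have hZ : Nat.card Z ≤ n * (m * m) := by
    show Nat.card (Fin n × S × S) ≤ _
    rw [Nat.card_prod, Nat.card_prod, Nat.card_fin]
    exact Nat.mul_le_mul le_rfl (Nat.mul_le_mul hS hS)
  obtain ⟨y1, T1, h11, h12, h13, h14, h15⟩ := short_walk_pos E
    (fun t => (⟨π (d + t), hn _⟩, C.run x 0 (d + t), C.run x d (d + t))) (c 0 - d) (by omega)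
    (by
      intro t _
      refine ⟨hπ (d + t), ?_, ?_⟩
      · show C.run x 0 (d + t + 1) = _
        rw [C.run_succ x (Nat.zero_le _)]
      · show C.run x d (d + t + 1) = _
        rw [C.run_succ x (by omega)])
  have hc01 : c 0 < c 1 := hc (by omega)
  obtain ⟨y2, T2, h21, h22, h23, h24, h25⟩ := short_walk_pos E
    (fun t => (⟨π (c 0 + t), hn _⟩, C.run x (c 0) (c 0 + t), C.run x (c 0) (c 0 + t))) (c 1 - c 0)
    (by omega)
    (by
      intro t _
      refine ⟨hπ (c 0 + t), ?_, ?_⟩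
      · show C.run x (c 0) (c 0 + t + 1) = _
        rw [C.run_succ x (by omega)]
      · show C.run x (c 0) (c 0 + t + 1) = _
        rw [C.run_succ x (by omega)])
  beta_reduce at h13 h14 h23 h24
  rw [show d + (c 0 - d) = c 0 by omega] at h14
  rw [show c 0 + (c 1 - c 0) = c 1 by omega] at h24
  rw [Nat.add_zero, C.run_of_le x le_rfl] at h13 h23
  let l := d + T1
  let ρ : ℕ → ℕ := fun t => if t < d then π t else if t < l then (y1 (t - d)).1.1
    else (y2 ((t - l) % T2)).1.1
  have hρ1 : ∀ t, t ≤ T1 → ρ (d + t) = (y1 t).1.1 := by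
    intro t ht
    simp only [ρ]
    rw [if_neg (by omega)]
    by_cases h : t < T1
    · rw [if_pos (by omega), Nat.add_sub_cancel_left]
    · rw [if_neg (by omega)]
      have : t = T1 := by omega
      rw [show d + t - l = 0 by omega, Nat.zero_mod, h23, this, h14]
  have hρ0 : ∀ t, t ≤ d → ρ t = π t := by
    intro t ht
    by_cases h : t < d
    · simp only [ρ]; rw [if_pos h]
    · have : t = d + 0 := by omega
      rw [this, hρ1 0 (Nat.zero_le _), h13]; rfl
  have hρ2 : ∀ a t, t ≤ T2 → ρ (l + a * T2 + t) = (y2 t).1.1 := by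
    intro a t ht
    simp only [ρ]
    rw [if_neg (by omega), if_neg (by omega), show l + a * T2 + t - l = t + a * T2 by omega,
      Nat.add_mul_mod_self_right]
    by_cases h : t < T2
    · rw [Nat.mod_eq_of_lt h]
    · have : t = T2 := by omega
      rw [this, Nat.mod_self, h23, h24]
      show π (c 0) = π (c 1)
      rw [hz, hz]
  have hdecomp : ∀ t, l ≤ t → ∃ a j, j < T2 ∧ t = l + a * T2 + j := by
    intro t ht
    refine ⟨(t - l) / T2, (t - l) % T2, Nat.mod_lt _ h21, ?_⟩
    have := Nat.div_add_mod (t - l) T2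
    rw [Nat.mul_comm] at this
    omega
  have hfull : IsFullpath N ρ := by
    intro t
    by_cases h1 : t < d
    · rw [hρ0 t h1.le, hρ0 (t + 1) h1]; exact hπ t
    · by_cases h2 : t < l
      · have e1 := hρ1 (t - d) (by omega)
        have e2 := hρ1 (t - d + 1) (by omega)
        rw [show d + (t - d) = t by omega] at e1
        rw [show d + (t - d + 1) = t + 1 by omega] at e2
        rw [e1, e2]
        exact (h15 (t - d) (by omega)).1
      · obtain ⟨a, j, hj, rfl⟩ := hdecomp t (by omega)
        rw [hρ2 a j hj.le, Nat.add_assoc _ j 1, hρ2 a (j + 1) hj]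
        exact (h25 j hj).1
  let x' : ℕ → L := fun i => lam (ρ i)
  have hr1 : ∀ t, t ≤ T1 → C.run x' 0 (d + t) = (y1 t).2.1 ∧ C.run x' d (d + t) = (y1 t).2.2 := by
    intro t
    induction t with
    | zero =>
      intro _
      rw [h13, Nat.add_zero, C.run_of_le x' le_rfl]
      refine ⟨C.run_congr x' x 0 d ?_, rfl⟩
      intro j _ hj
      show lam (ρ j) = lam (π j)
      rw [hρ0 j hj.le]
    | succ t ih =>
      intro ht
      obtain ⟨i1, i2⟩ := ih (by omega)
      obtain ⟨-, e1, e2⟩ := h15 t (by omega)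
      have hx : x' (d + t) = lam (y1 t).1.1 := by
        show lam (ρ (d + t)) = _
        rw [hρ1 t (by omega)]
      rw [← Nat.add_assoc, C.run_succ x' (Nat.zero_le _), C.run_succ x' (by omega), i1, i2, e1, e2, hx]
      exact ⟨rfl, rfl⟩
  have hr2 : ∀ a t, t ≤ T2 → C.run x' (l + a * T2) (l + a * T2 + t) = (y2 t).2.1 := by
    intro a t
    induction t with
    | zero =>
      intro _
      rw [h23, C.run_of_le x' (by omega)]
    | succ t ih =>
      intro ht
      obtain ⟨-, e1, -⟩ := h25 t (by omega)
      have hx : x' (l + a * T2 + t) = lam (y2 t).1.1 := by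
        show lam (ρ (l + a * T2 + t)) = _
        rw [hρ2 a t (by omega)]
      rw [← Nat.add_assoc, C.run_succ x' (by omega), ih (by omega), hx, e1]
  have hblk : ∀ a, C.run x' (l + a * T2) (l + (a + 1) * T2) = mm := by
    intro a
    have := hr2 a T2 le_rfl
    rw [h24] at this
    rw [show l + (a + 1) * T2 = l + a * T2 + T2 by ring, this]
    exact hm 0
  have hl1 := hr1 T1 le_rfl
  rw [h14] at hl1
  have hmonoL : StrictMono (fun a => l + a * T2) := by
    apply strictMono_nat_of_lt_succ
    intro a
    have : (a + 1) * T2 = a * T2 + T2 := by ring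
    show l + a * T2 < l + (a + 1) * T2
    omega
  refine ⟨l, T2 - 1, ρ, ?_, ?_, hfull, hρ0, ?_, ?_, ?_⟩
  · omega
  · intro t ht
    obtain ⟨a, j, hj, rfl⟩ := hdecomp t ht
    rw [hρ2 a j hj.le, show l + a * T2 + j + (T2 - 1 + 1) = l + (a + 1) * T2 + j by
      have : (a + 1) * T2 = a * T2 + T2 := by ring
      omega, hρ2 (a + 1) j hj.le]
  · intro t
    simp only [ρ]
    split
    · exact hn t
    · split
      · exact (y1 _).1.2
      · exact (y2 _).1.2
  · refine ⟨C.run x 0 (c 0), mm, ⟨c, hc, by omega, rfl, hm⟩, fun a => l + a * T2, hmonoL, ?_, ?_, hblk⟩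
    · show 0 < l + 0 * T2
      omega
    · show C.run x' 0 (l + 0 * T2) = _
      rw [Nat.zero_mul, Nat.add_zero]
      exact hl1.1
  · have hsx : ∀ (y : ℕ → L) a b, d ≤ a → d ≤ b →
        C.run (fun i => y (i + d)) (a - d) (b - d) = C.run y a b := by
      intro y a b ha hb
      rw [C.run_shift, Nat.sub_add_cancel ha, Nat.sub_add_cancel hb]
    have hge : ∀ a, d < c a := fun a => lt_of_lt_of_le hcd (hc.monotone (Nat.zero_le a))
    refine ⟨C.run x d (c 0), mm, ⟨fun a => c a - d, ?_, ?_, ?_, ?_⟩,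
      fun a => l + a * T2 - d, ?_, ?_, ?_, ?_⟩
    · intro a b hab
      have := hc hab
      have := hge a
      show c a - d < c b - d
      omega
    · show 0 < c 0 - d
      omega
    · have := hsx x d (c 0) le_rfl hcd.le
      rw [Nat.sub_self] at this
      exact this
    · intro a
      exact (hsx x (c a) (c (a + 1)) (hge a).le (hge _).le).trans (hm a)
    · intro a b hab
      have := hmonoL hab
      simp only at this
      show l + a * T2 - d < l + b * T2 - d
      omega
    · show 0 < l + 0 * T2 - d
      omega
    · have := hsx x' d l le_rfl (by omega)
      rw [Nat.sub_self] at this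
      show C.run (fun i => x' (i + d)) 0 (l + 0 * T2 - d) = _
      rw [Nat.zero_mul, Nat.add_zero, this]
      exact hl1.2
    · intro a
      exact (hsx x' (l + a * T2) (l + (a + 1) * T2) (by omega) (by omega)).trans (hblk a)

end Stmt9

namespace Stmt9

/-! ## Finite models -/

def NN (e : ℕ) : ℕ := HH (GG (Bnd (7 + e)))

theorem finite_model (φ : Form ℕ) {U : Type} (M : KStruct ℕ U) (hM : IsRoCTL M 0) (σ : ℕ → U)
    (hσ : IsFullpath M σ) (hs : sat M 0 φ σ) :
    ∃ (D : Type) (_ : Finite D) (N : KStruct ℕ D) (π : ℕ → D), Nat.card D ≤ NN (enc φ) ∧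
      IsRoCTL N 0 ∧ IsFullpath N π ∧ sat N 0 φ π := by
  obtain ⟨Y, hY, P, hP⟩ := (RepB.form φ).neg.all
  obtain ⟨Z, hZ, P', hP'⟩ := ((RepB.ff.mono (Bnd_mono (by omega : 4 ≤ 5 + enc φ)))).neg.all
  have hG := (Sys.prod_good hY hZ).mono (Bnd_comb2 (a := 5 + enc φ) (n := 7 + enc φ) (by omega))
  obtain ⟨lam, hlam⟩ := hG.ex U M
  have := hG.finL; have := hG.finQ; have := hG.finS
  obtain ⟨D, hD, N, lam', r, h1, h2, h3, h4, h5⟩ :=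
    fmp (Y.prod Z).C (Y.prod Z).K (Y.prod Z).hK (Y.prod Z).has M hM.1 lam hlam.2 (σ 0)
  have hcon : (Y.prod Z).Con N lam' := by
    refine ⟨fun d => ?_, h3⟩
    obtain ⟨u, hu, hv⟩ := h5 d
    rw [← hu, hv]
    exact hlam.1 u
  obtain ⟨cY, cZ⟩ := (Y.prod_con Z N lam').1 hcon
  obtain ⟨mY, mZ⟩ := (Y.prod_con Z M lam).1 hlam
  have hr : ¬ P (lam' r).1 := by
    rw [h4]
    intro hh
    exact (hP.iff U M _ mY (σ 0)).1 hh σ hσ rfl hs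
  have := mt (hP.iff D N _ cY r).2 hr
  push Not at this
  obtain ⟨π, hπ, -, hsat⟩ := this
  refine ⟨D, hD, N, π, h1.trans (card_FmpD hG.cardL hG.cardQ hG.cardS), ⟨h2, ?_⟩, hπ, hsat⟩
  intro d
  have hd : ¬ P' (lam' d).2 := by
    obtain ⟨u, hu, -⟩ := h5 d
    rw [← hu]
    intro hh
    obtain ⟨τ, t1, t2, t3⟩ := hM.2 u
    exact (hP'.iff U M _ mZ u).1 hh τ t1 t2 t3
  have := mt (hP'.iff D N _ cZ d).2 hd
  push Not at this
  exact this

/-! ### Transport -/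

structure Emb {U U' : Type} (A : ℕ) (M : KStruct ℕ U) (N : KStruct ℕ U') (f : U → U') : Prop where
  inj : Function.Injective f
  rel : ∀ a b', N.rel (f a) b' ↔ ∃ b, b' = f b ∧ M.rel a b
  val : ∀ p ≤ A, ∀ a, p ∈ M.val a ↔ p ∈ N.val (f a)

theorem Emb.rel' {U U' : Type} {A : ℕ} {M : KStruct ℕ U} {N : KStruct ℕ U'} {f : U → U'}
    (h : Emb A M N f) (a b : U) : N.rel (f a) (f b) ↔ M.rel a b := by
  rw [h.rel]
  constructor
  · rintro ⟨c, hc, hr⟩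
    rwa [h.inj hc]
  · intro hr
    exact ⟨b, rfl, hr⟩

theorem Emb.full {U U' : Type} {A : ℕ} {M : KStruct ℕ U} {N : KStruct ℕ U'} {f : U → U'}
    (h : Emb A M N f) (π : ℕ → U) : IsFullpath N (fun i => f (π i)) ↔ IsFullpath M π :=
  forall_congr' fun i => h.rel' _ _

theorem Emb.lift {U U' : Type} {A : ℕ} {M : KStruct ℕ U} {N : KStruct ℕ U'} {f : U → U'}
    (h : Emb A M N f) (π' : ℕ → U') (hπ : IsFullpath N π') (a : U) (ha : π' 0 = f a) :
    ∃ π, π' = (fun i => f (π i)) ∧ IsFullpath M π ∧ π 0 = a := by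
  have key : ∀ i, ∃ b, π' i = f b := by
    intro i
    induction i with
    | zero => exact ⟨a, ha⟩
    | succ i ih =>
      obtain ⟨b, hb⟩ := ih
      have := hπ i
      rw [hb, h.rel] at this
      obtain ⟨c, hc, -⟩ := this
      exact ⟨c, hc⟩
  choose π hπ' using key
  have e : π' = (fun i => f (π i)) := funext hπ'
  refine ⟨π, e, ?_, ?_⟩
  · rw [e] at hπ
    exact (h.full π).1 hπ
  · apply h.inj
    rw [← hπ', ha]

theorem Emb.ff {U U' : Type} {A : ℕ} {M : KStruct ℕ U} {N : KStruct ℕ U'} {f : U → U'}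
    (h : Emb A M N f) (π : ℕ → U) : FailureFree N 0 (fun i => f (π i)) ↔ FailureFree M 0 π :=
  forall_congr' fun i => forall_congr' fun _ => not_congr (h.val 0 (Nat.zero_le _) _).symm

theorem Emb.sat {U U' : Type} {A : ℕ} {M : KStruct ℕ U} {N : KStruct ℕ U'} {f : U → U'}
    (h : Emb A M N f) (φ : Form ℕ) : enc φ ≤ A → ∀ σ : ℕ → U,
    (sat N 0 φ (fun i => f (σ i)) ↔ sat M 0 φ σ) := by
  induction φ with
  | atom p =>
    intro hA σ
    have := Nat.right_le_pair 0 p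
    exact (h.val p (by simp only [enc] at hA; omega) _).symm
  | neg φ ih =>
    intro hA σ
    have := Nat.right_le_pair 1 (enc φ)
    exact not_congr (ih (by simp only [enc] at hA; omega) σ)
  | conj φ ψ ih1 ih2 =>
    intro hA σ
    have := Nat.right_le_pair 2 (Nat.pair (enc φ) (enc ψ))
    have := Nat.add_le_pair (enc φ) (enc ψ)
    simp only [enc] at hA
    exact and_congr (ih1 (by omega) σ) (ih2 (by omega) σ)
  | untl φ ψ ih1 ih2 =>
    intro hA σ
    have := Nat.right_le_pair 3 (Nat.pair (enc φ) (enc ψ))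
    have := Nat.add_le_pair (enc φ) (enc ψ)
    simp only [enc] at hA
    exact exists_congr fun i => and_congr (ih2 (by omega) (suffix σ i))
      (forall_congr' fun j => forall_congr' fun _ => ih1 (by omega) (suffix σ j))
  | next φ ih =>
    intro hA σ
    have := Nat.right_le_pair 4 (enc φ)
    exact ih (by simp only [enc] at hA; omega) (suffix σ 1)
  | fall φ ih =>
    intro hA σ
    have := Nat.right_le_pair 5 (enc φ)
    have ih := ih (by simp only [enc] at hA; omega)
    constructor
    · intro hh π h1 h2
      exact (ih π).1 (hh _ ((h.full π).2 h1) (congrArg f h2))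
    · intro hh π' h1 h2
      obtain ⟨π, rfl, h3, h4⟩ := h.lift π' h1 _ h2
      exact (ih π).2 (hh π h3 h4)
  | oblig φ ih =>
    intro hA σ
    have := Nat.right_le_pair 6 (enc φ)
    have ih := ih (by simp only [enc] at hA; omega)
    constructor
    · intro hh π h1 h2 h5
      exact (ih π).1 (hh _ ((h.full π).2 h1) (congrArg f h2) ((h.ff π).2 h5))
    · intro hh π' h1 h2 h5
      obtain ⟨π, rfl, h3, h4⟩ := h.lift π' h1 _ h2
      exact (ih π).2 (hh π h3 h4 ((h.ff π).1 h5))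
  | robust φ ih =>
    intro hA σ
    have := Nat.right_le_pair 7 (enc φ)
    have ih := ih (by simp only [enc] at hA; omega)
    refine and_congr (ih σ) ?_
    have hdev : ∀ π, IsDeviation N 0 (fun i => f (σ i)) (fun i => f (π i)) ↔ IsDeviation M 0 σ π :=
      fun π => exists_congr fun i => and_congr
        (forall_congr' fun j => forall_congr' fun _ => h.inj.eq_iff) (h.ff (suffix π (i + 1)))
    constructor
    · intro hh π h1 h2
      exact (ih π).1 (hh _ ((h.full π).2 h1) ((hdev π).2 h2))
    · intro hh π' h1 h2
      have h0 : π' 0 = f (σ 0) := by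
        obtain ⟨i, hi, -⟩ := h2
        exact hi 0 (Nat.zero_le _)
      obtain ⟨π, rfl, h3, h4⟩ := h.lift π' h1 _ h0
      exact (ih π).2 (hh π h3 ((hdev π).1 h2))

end Stmt9

namespace Stmt9

/-! ## Coding of finite models and lassos -/

def bit (r x : ℕ) : Prop := r / 2 ^ x % 2 = 1

theorem digits_exist (b : ℕ) (hb : 0 < b) (f : ℕ → ℕ) (hf : ∀ i, f i < b) (len : ℕ) :
    ∃ u < b ^ len, ∀ i < len, u / b ^ i % b = f i := by
  induction len with
  | zero => exact ⟨0, by simp, fun i hi => by omega⟩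
  | succ len ih =>
    obtain ⟨u, hu, h⟩ := ih
    refine ⟨u + b ^ len * f len, ?_, ?_⟩
    · rw [Nat.pow_succ]
      calc u + b ^ len * f len < b ^ len + b ^ len * f len := by omega
        _ = b ^ len * (f len + 1) := by ring
        _ ≤ b ^ len * b := Nat.mul_le_mul le_rfl (hf len)
    · intro i hi
      by_cases h1 : i = len
      · subst h1
        rw [Nat.add_mul_div_left _ _ (Nat.pow_pos hb), Nat.div_eq_of_lt hu, Nat.zero_add,
          Nat.mod_eq_of_lt (hf i)]
      · have h2 : i < len := by omega
        have e : b ^ len * f len = b ^ i * (b * (b ^ (len - i - 1) * f len)) := by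
          have : b ^ len = b ^ i * (b * b ^ (len - i - 1)) := by
            rw [← Nat.pow_succ', ← Nat.pow_add]
            congr 1; omega
          rw [this]; ring
        rw [e, Nat.add_mul_div_left _ _ (Nat.pow_pos hb), Nat.add_mul_mod_self_left]
        exact h i h2

theorem bits_exist (p : ℕ → Prop) (len : ℕ) : ∃ r < 2 ^ len, ∀ i < len, (bit r i ↔ p i) := by
  classical
  obtain ⟨r, h1, h2⟩ := digits_exist 2 (by omega) (fun i => if p i then 1 else 0)
    (fun i => by split <;> omega) len
  refine ⟨r, h1, fun i hi => ?_⟩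
  rw [bit, h2 i hi]
  split <;> simp_all

def mn (M : ℕ) : ℕ := M.unpair.1
def mr (M : ℕ) : ℕ := M.unpair.2.unpair.1
def mv (M : ℕ) : ℕ := M.unpair.2.unpair.2
def mdl (M : ℕ) : KStruct ℕ ℕ where
  rel := fun a b => a < mn M ∧ b < mn M ∧ bit (mr M) (Nat.pair a b)
  val := fun a => {p | bit (mv M) (Nat.pair a p)}

def cl (c : ℕ) : ℕ := c.unpair.1
def ck (c : ℕ) : ℕ := c.unpair.2.unpair.1
def cu (c : ℕ) : ℕ := c.unpair.2.unpair.2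
def cL (c : ℕ) : ℕ := cl c + ck c + 1
def idx (c i : ℕ) : ℕ := if i < cl c then i else cl c + (i - cl c) % (ck c + 1)
def pth (M c i : ℕ) : ℕ := cu c / (mn M) ^ (idx c i) % mn M

def Valid (M c : ℕ) : Prop :=
  0 < mn M ∧ ∀ i < cL c, bit (mr M) (Nat.pair (pth M c i) (pth M c (i + 1)))

def FFL (M c s : ℕ) : Prop := ∀ j < cL c, ¬ bit (mv M) (Nat.pair (pth M c (s + 1 + j)) 0)

theorem idx_lt (c i : ℕ) : idx c i < cL c := by
  unfold idx cL
  split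
  · omega
  · have := Nat.mod_lt (i - cl c) (show ck c + 1 > 0 by omega)
    omega

theorem idx_per (c x : ℕ) (h : cl c ≤ x) : idx c (x + (ck c + 1)) = idx c x := by
  unfold idx
  rw [if_neg (by omega), if_neg (by omega), show x + (ck c + 1) - cl c = (x - cl c) + (ck c + 1) by omega,
    Nat.add_mod_right]

theorem idx_of_lt (c x : ℕ) (h : x < cL c) : idx c x = x := by
  unfold cL at h
  unfold idx
  split
  · rfl
  · rw [Nat.mod_eq_of_lt (by omega)]; omega

theorem idx_succ (c x y : ℕ) (h : idx c x = idx c y) : idx c (x + 1) = idx c (y + 1) := by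
  have key : ∀ x, idx c (idx c x + 1) = idx c (x + 1) := by
    intro x
    induction x using Nat.strong_induction_on with
    | _ x ih =>
      by_cases hx : x < cL c
      · rw [idx_of_lt c x hx]
      · unfold cL at hx
        have h1 := idx_per c (x - (ck c + 1)) (by omega)
        have h2 := idx_per c (x + 1 - (ck c + 1)) (by omega)
        have h3 := ih (x - (ck c + 1)) (by omega)
        rw [show x - (ck c + 1) + (ck c + 1) = x by omega] at h1
        rw [show x + 1 - (ck c + 1) + (ck c + 1) = x + 1 by omega] at h2
        rw [h1, h2, h3]
        congr 1; omega
  rw [← key x, ← key y, h]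

theorem idx_add (c x y t : ℕ) (h : idx c x = idx c y) : idx c (t + x) = idx c (t + y) := by
  induction t with
  | zero => simpa using h
  | succ t ih =>
    rw [show t + 1 + x = t + x + 1 by omega, show t + 1 + y = t + y + 1 by omega]
    exact idx_succ c _ _ ih

theorem suffix_idx (M c x y : ℕ) (h : idx c x = idx c y) :
    suffix (pth M c) x = suffix (pth M c) y := by
  funext t
  show pth M c (t + x) = pth M c (t + y)
  unfold pth
  rw [idx_add c x y t h]

theorem idx_red (c s j : ℕ) : ∃ j' ≤ j, j' < cL c ∧ idx c (s + j') = idx c (s + j) := by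
  induction j using Nat.strong_induction_on with
  | _ j ih =>
    by_cases hj : j < cL c
    · exact ⟨j, le_rfl, hj, rfl⟩
    · unfold cL at hj
      obtain ⟨j', h1, h2, h3⟩ := ih (j - (ck c + 1)) (by omega)
      refine ⟨j', by omega, h2, h3.trans ?_⟩
      have := idx_per c (s + (j - (ck c + 1))) (by omega)
      rw [← this]
      congr 1; omega

theorem pth_lt {M c : ℕ} (h : Valid M c) (i : ℕ) : pth M c i < mn M := Nat.mod_lt _ h.1

theorem Valid.full {M c : ℕ} (h : Valid M c) : IsFullpath (mdl M) (pth M c) := by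
  intro i
  refine ⟨pth_lt h _, pth_lt h _, ?_⟩
  have h1 := idx_lt c i
  have h2 := h.2 _ h1
  have e : idx c (idx c i) = idx c i := idx_of_lt c _ h1
  have e2 := idx_succ c _ _ e
  unfold pth at h2 ⊢
  rwa [e, e2] at h2

theorem FFL_iff (M c s : ℕ) : FFL M c s ↔ FailureFree (mdl M) 0 (suffix (pth M c) s) := by
  constructor
  · intro h i hi
    show ¬ bit (mv M) (Nat.pair (pth M c (i + s)) 0)
    obtain ⟨j, -, h1, h2⟩ := idx_red c (s + 1) (i - 1)
    have := h j h1
    unfold pth at this ⊢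
    rwa [h2, show s + 1 + (i - 1) = i + s by omega] at this
  · intro h j _
    have := h (j + 1) (by omega)
    rw [show s + 1 + j = j + 1 + s by omega]
    exact this

/-- Every ultimately periodic sequence has a code. -/
theorem lasso_code (M l k : ℕ) (ρ : ℕ → ℕ) (h0 : 0 < mn M) (h1 : ∀ t, l ≤ t → ρ (t + (k + 1)) = ρ t)
    (h2 : ∀ t, ρ t < mn M) : ∃ u < (mn M) ^ (l + k + 1), ∀ i,
      pth M (Nat.pair l (Nat.pair k u)) i = ρ i := by
  obtain ⟨u, hu, hd⟩ := digits_exist (mn M) h0 ρ h2 (l + k + 1)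
  refine ⟨u, hu, ?_⟩
  intro i
  have e1 : cl (Nat.pair l (Nat.pair k u)) = l := by simp [cl]
  have e2 : ck (Nat.pair l (Nat.pair k u)) = k := by simp [ck]
  have e3 : cu (Nat.pair l (Nat.pair k u)) = u := by simp [cu]
  have e4 : cL (Nat.pair l (Nat.pair k u)) = l + k + 1 := by simp [cL, e1, e2]
  induction i using Nat.strong_induction_on with
  | _ i ih =>
    by_cases hi : i < l + k + 1
    · unfold pth
      rw [idx_of_lt _ _ (by rw [e4]; exact hi), e3, hd i hi]
    · have a1 := ih (i - (k + 1)) (by omega)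
      have a2 := idx_per (Nat.pair l (Nat.pair k u)) (i - (k + 1)) (by rw [e1]; omega)
      have a3 := h1 (i - (k + 1)) (by omega)
      rw [e2] at a2
      rw [show i - (k + 1) + (k + 1) = i by omega] at a2 a3
      rw [a3, ← a1]
      unfold pth
      rw [a2]

theorem Valid_of_eq {M c : ℕ} {ρ : ℕ → ℕ} (h0 : 0 < mn M) (h : ∀ i, pth M c i = ρ i)
    (hρ : IsFullpath (mdl M) ρ) : Valid M c := by
  refine ⟨h0, fun i _ => ?_⟩
  rw [h, h]
  exact (hρ i).2.2

def beta (n p : ℕ) : ℕ := Nat.pair p (Nat.pair p (n ^ p)) + 1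

theorem pair_mono {a b a' b' : ℕ} (h : a ≤ a') (h' : b ≤ b') : Nat.pair a b ≤ Nat.pair a' b' := by
  rcases h.lt_or_eq with h | rfl
  · rcases h'.lt_or_eq with h' | rfl
    · exact ((Nat.pair_lt_pair_left _ h).trans (Nat.pair_lt_pair_right _ h')).le
    · exact (Nat.pair_lt_pair_left _ h).le
  · rcases h'.lt_or_eq with h' | rfl
    · exact (Nat.pair_lt_pair_right _ h').le
    · exact le_rfl

theorem lt_beta {n p l k u : ℕ} (hn : 0 < n) (h : l + k + 1 ≤ p) (hu : u < n ^ (l + k + 1)) :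
    Nat.pair l (Nat.pair k u) < beta n p := by
  unfold beta
  have : n ^ (l + k + 1) ≤ n ^ p := Nat.pow_le_pow_right hn h
  have := pair_mono (show l ≤ p by omega) (pair_mono (show k ≤ p by omega) (show u ≤ n ^ p by omega))
  omega

/-- Bound for lengths of lassos. -/
def PB (n e q : ℕ) : ℕ := q + 2 * (n * (Bnd (6 + e) * Bnd (6 + e)))

theorem path_lasso (φ : Form ℕ) (e M : ℕ) (he : enc φ ≤ e) (π : ℕ → ℕ)
    (hπ : IsFullpath (mdl M) π) (d p : ℕ) (hp : PB (mn M) e d ≤ p) :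
    ∃ c < beta (mn M) p, Valid M c ∧ (∀ j ≤ d, pth M c j = π j) ∧
      (sat (mdl M) 0 φ (pth M c) ↔ sat (mdl M) 0 φ π) ∧
      (FailureFree (mdl M) 0 (suffix (pth M c) d) ↔ FailureFree (mdl M) 0 (suffix π d)) := by
  obtain ⟨Y, hY, K, K', hK, hK'⟩ := ((RepB.form φ).mono (Bnd_mono (by omega : _ ≤ 5 + e))).pair
    (RepB.ff.mono (Bnd_mono (by omega)))
  rw [← Bnd_succ, show 5 + e + 1 = 6 + e by omega] at hY
  obtain ⟨lam, hlam⟩ := hY.ex ℕ (mdl M)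
  have := hY.finS
  have hn : ∀ i, π i < mn M := fun i => (hπ i).1
  have h0 : 0 < mn M := by have := hn 0; omega
  obtain ⟨l, k, ρ, h1, h2, h3, h4, h5, ⟨s, s', h6, h6'⟩, ⟨r, r', h7, hs7⟩⟩ :=
    lasso_pre Y.C (mdl M) lam (mn M) _ hY.cardS π hπ hn d
  obtain ⟨u, hu, hc⟩ := lasso_code M l k ρ h0 h2 h5
  have hcf : pth M (Nat.pair l (Nat.pair k u)) = ρ := funext hc
  refine ⟨_, lt_beta h0 (h1.trans hp) hu, Valid_of_eq h0 hc h3, ?_, ?_, ?_⟩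
  · rw [hcf]; exact h4
  · rw [hcf]
    have i1 := hK.iff ℕ (mdl M) lam hlam ρ h3
    have i2 := hK.iff ℕ (mdl M) lam hlam π hπ
    beta_reduce at i1 i2
    rw [i1, i2]
    exact ⟨fun h => hK.rcg _ _ _ _ h6' h6 h, fun h => hK.rcg _ _ _ _ h6 h6' h⟩
  · rw [hcf]
    have i1 := hK'.iff ℕ (mdl M) lam hlam (suffix ρ d) (fullpath_suffix h3 d)
    have i2 := hK'.iff ℕ (mdl M) lam hlam (suffix π d) (fullpath_suffix hπ d)
    show ffPP _ _ _ ↔ ffPP _ _ _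
    rw [i1, i2]
    exact ⟨fun h => hK'.rcg _ _ _ _ hs7 h7 h, fun h => hK'.rcg _ _ _ _ h7 hs7 h⟩

/-- Deviations can be assumed to branch off early. -/
theorem dev_early (φ : Form ℕ) (e M c i : ℕ) (he : enc φ ≤ e) (π : ℕ → ℕ)
    (hπ : IsFullpath (mdl M) π)
    (hd : IsDeviation (mdl M) 0 (suffix (pth M c) i) π) :
    ∃ π' d, d < cL c * Bnd (6 + e) ∧ IsFullpath (mdl M) π' ∧
      (∀ j ≤ d, π' j = suffix (pth M c) i j) ∧ FailureFree (mdl M) 0 (suffix π' (d + 1)) ∧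
      (sat (mdl M) 0 φ π' ↔ sat (mdl M) 0 φ π) := by
  classical
  obtain ⟨Y, hY, K, hK⟩ := (RepB.form φ).mono (Bnd_mono (by omega : _ ≤ 6 + e))
  obtain ⟨lam, hlam⟩ := hY.ex ℕ (mdl M)
  have := hY.finS
  obtain ⟨d0, hd1, hd2⟩ := hd
  have hex : ∃ d, ∃ π', IsFullpath (mdl M) π' ∧
      (∀ j ≤ d, π' j = suffix (pth M c) i j) ∧ FailureFree (mdl M) 0 (suffix π' (d + 1)) ∧
      (sat (mdl M) 0 φ π' ↔ sat (mdl M) 0 φ π) := ⟨d0, π, hπ, hd1, hd2, Iff.rfl⟩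
  obtain ⟨π', g1, g2, g3, g4⟩ := Nat.find_spec hex
  have hmin := fun m => Nat.find_min hex (m := m)
  generalize Nat.find hex = d at g2 g3 hmin
  refine ⟨π', d, ?_, g1, g2, g3, g4⟩
  by_contra hcard
  let x : ℕ → Y.L := fun t => lam (π' t)
  let F : Fin (d + 1) → Fin (cL c) × Y.S := fun j => (⟨idx c (j.1 + i), idx_lt _ _⟩, Y.C.run x 0 j.1)
  have hni : ¬ Function.Injective F := by
    intro hinj
    have h := Nat.card_le_card_of_injective _ hinj
    rw [Nat.card_fin, Nat.card_prod, Nat.card_fin] at h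
    have := Nat.mul_le_mul (le_refl (cL c)) hY.cardS
    omega
  rw [Function.Injective] at hni
  push Not at hni
  obtain ⟨a, b, hab, hne⟩ := hni
  wlog hlt : a.1 < b.1 generalizing a b
  · exact this b a hab.symm hne.symm
      (by have : a.1 ≠ b.1 := fun h => hne (Fin.ext h)
          omega)
  have hi : idx c (a.1 + i) = idx c (b.1 + i) := congrArg (fun z => z.1.1) hab
  have hr : Y.C.run x 0 a.1 = Y.C.run x 0 b.1 := congrArg (fun z => z.2) hab
  have hb := b.2
  have hper : ∀ t, suffix (pth M c) i (t + a.1) = suffix (pth M c) i (t + b.1) := by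
    intro t
    have := congrFun (suffix_idx M c _ _ hi) t
    show pth M c (t + a.1 + i) = pth M c (t + b.1 + i)
    rw [Nat.add_assoc, Nat.add_assoc]
    exact this
  let ρ := splice π' a.1 (suffix π' b.1)
  have hρ1 : ∀ t, t < a.1 → ρ t = π' t := fun t ht => by
    show (if t < a.1 then _ else _) = _
    rw [if_pos ht]
  have hρ2 : ∀ t, a.1 ≤ t → ρ t = π' (t + (b.1 - a.1)) := fun t ht => by
    show (if t < a.1 then _ else π' (t - a.1 + b.1)) = _
    rw [if_neg (by omega)]
    congr 1; omega
  have hρa : ρ a.1 = π' a.1 := by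
    rw [hρ2 _ le_rfl, show a.1 + (b.1 - a.1) = b.1 by omega, g2 _ (by omega), g2 _ (by omega)]
    simpa using (hper 0).symm
  have hρfull : IsFullpath (mdl M) ρ := by
    intro t
    by_cases h1 : t + 1 < a.1
    · rw [hρ1 t (by omega), hρ1 _ h1]; exact g1 t
    · by_cases h2 : t + 1 = a.1
      · rw [hρ1 t (by omega), h2, hρa, ← h2]; exact g1 t
      · rw [hρ2 t (by omega), hρ2 (t + 1) (by omega),
          show t + 1 + (b.1 - a.1) = t + (b.1 - a.1) + 1 by omega]
        exact g1 _
  refine hmin (d - (b.1 - a.1)) (by omega) ⟨ρ, hρfull, ?_, ?_, ?_⟩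
  · intro j hj
    by_cases h1 : j < a.1
    · rw [hρ1 j h1]; exact g2 j (by omega)
    · rw [hρ2 j (by omega), g2 _ (by omega)]
      have := hper (j - a.1)
      rw [show j - a.1 + a.1 = j by omega, show j - a.1 + b.1 = j + (b.1 - a.1) by omega] at this
      exact this.symm
  · intro t ht
    have := g3 t ht
    show 0 ∉ (mdl M).val (ρ (t + (d - (b.1 - a.1) + 1)))
    rw [hρ2 _ (by omega),
      show t + (d - (b.1 - a.1) + 1) + (b.1 - a.1) = t + (d + 1) by omega]
    exact this
  · rw [← g4]
    have i1 := hK.iff ℕ (mdl M) lam hlam ρ hρfull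
    have i2 := hK.iff ℕ (mdl M) lam hlam π' g1
    beta_reduce at i1 i2
    rw [i1, i2]
    have e1 : (fun t => lam (ρ t)) = splice x a.1 (fun t => lam (suffix π' b.1 t)) := by
      funext t
      show lam (if t < a.1 then _ else _) = if t < a.1 then _ else _
      split <;> rfl
    have e2 : (fun t => lam (π' t)) = splice x b.1 (fun t => lam (suffix π' b.1 t)) := by
      funext t
      show lam (π' t) = if t < b.1 then lam (π' t) else lam (π' (t - b.1 + b.1))
      split
      · rfl
      · rw [Nat.sub_add_cancel (by omega)]
    rw [e1, e2]
    exact ⟨splice_mem_iff Y.C hK.rcg _ _ _ _ _ hr, splice_mem_iff Y.C hK.rcg _ _ _ _ _ hr.symm⟩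

end Stmt9

namespace Stmt9

/-! ## Evaluation tables -/

abbrev Ent := ℕ × ℕ × ℕ × ℕ × ℕ

/-- Length bound for candidate lassos of a quantifier. -/
def PQ (M e c : ℕ) : ℕ := PB (mn M) e (cL c * Bnd (6 + e) + 1)

def Dev (M e c i c' : ℕ) : Prop :=
  ∃ d < PQ M e c, (∀ j < d + 1, pth M c' j = pth M c (j + i)) ∧ FFL M c' (d + 1)

def Cand (M e c i c' : ℕ) : Prop :=
  Valid M c' ∧ ((e.unpair.1 = 5 ∧ pth M c' 0 = pth M c i) ∨
    (e.unpair.1 = 6 ∧ pth M c' 0 = pth M c i ∧ FFL M c' 0) ∨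
    (e.unpair.1 = 7 ∧ Dev M e c i c'))

def BQ (M e c : ℕ) : ℕ := beta (mn M) (PQ M e c)

def J0 (M e c i b : ℕ) : Prop :=
  (b = 1 ∧ bit (mv M) (Nat.pair (pth M c i) e.unpair.2)) ∨
  (b = 0 ∧ ¬ bit (mv M) (Nat.pair (pth M c i) e.unpair.2))

def J1 (t : List Ent) (M e c i b : ℕ) : Prop :=
  (b = 1 ∧ (M, e.unpair.2, c, i, 0) ∈ t) ∨ (b = 0 ∧ (M, e.unpair.2, c, i, 1) ∈ t)

def J2 (t : List Ent) (M e c i b : ℕ) : Prop :=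
  (b = 1 ∧ (M, e.unpair.2.unpair.1, c, i, 1) ∈ t ∧ (M, e.unpair.2.unpair.2, c, i, 1) ∈ t) ∨
  (b = 0 ∧ ((M, e.unpair.2.unpair.1, c, i, 0) ∈ t ∨ (M, e.unpair.2.unpair.2, c, i, 0) ∈ t))

def J3 (t : List Ent) (M e c i b : ℕ) : Prop :=
  (b = 1 ∧ ∃ j < cL c, (M, e.unpair.2.unpair.2, c, i + j, 1) ∈ t ∧
    ∀ j' < j, (M, e.unpair.2.unpair.1, c, i + j', 1) ∈ t) ∨
  (b = 0 ∧ ∀ j < cL c, (M, e.unpair.2.unpair.2, c, i + j, 0) ∈ t ∨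
    ∃ j' < j, (M, e.unpair.2.unpair.1, c, i + j', 0) ∈ t)

def J4 (t : List Ent) (M e c i b : ℕ) : Prop :=
  (b = 1 ∧ (M, e.unpair.2, c, i + 1, 1) ∈ t) ∨ (b = 0 ∧ (M, e.unpair.2, c, i + 1, 0) ∈ t)

def J5 (t : List Ent) (M e c i b : ℕ) : Prop :=
  (b = 1 ∧ (e.unpair.1 = 7 → (M, e.unpair.2, c, i, 1) ∈ t) ∧
    ∀ c' < BQ M e c, Cand M e c i c' → (M, e.unpair.2, c', 0, 1) ∈ t) ∨
  (b = 0 ∧ ((e.unpair.1 = 7 ∧ (M, e.unpair.2, c, i, 0) ∈ t) ∨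
    ∃ c' < BQ M e c, Cand M e c i c' ∧ (M, e.unpair.2, c', 0, 0) ∈ t))

def Just (t : List Ent) (M e c i b : ℕ) : Prop :=
  (e.unpair.1 = 0 ∧ J0 M e c i b) ∨ (e.unpair.1 = 1 ∧ J1 t M e c i b) ∨
  (e.unpair.1 = 2 ∧ J2 t M e c i b) ∨ (e.unpair.1 = 3 ∧ J3 t M e c i b) ∨
  (e.unpair.1 = 4 ∧ J4 t M e c i b) ∨
  ((e.unpair.1 = 5 ∨ e.unpair.1 = 6 ∨ e.unpair.1 = 7) ∧ J5 t M e c i b) ∨ 8 ≤ e.unpair.1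

def Closed (t : List Ent) : Prop :=
  ∀ x ∈ t, Just t x.1 x.2.1 x.2.2.1 x.2.2.2.1 x.2.2.2.2

theorem Just.mono {t t' : List Ent} (h : t ⊆ t') {M e c i b : ℕ} (hj : Just t M e c i b) :
    Just t' M e c i b := by
  unfold Just at *
  refine hj.imp id (Or.imp (And.imp id ?_) (Or.imp (And.imp id ?_) (Or.imp (And.imp id ?_)
    (Or.imp (And.imp id ?_) (Or.imp (And.imp id ?_) id)))))
  · exact Or.imp (And.imp id (@h _)) (And.imp id (@h _))
  · exact Or.imp (And.imp id (And.imp (@h _) (@h _))) (And.imp id (Or.imp (@h _) (@h _)))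
  · rintro (⟨h0, j, h1, h2, h3⟩ | ⟨h0, h1⟩)
    · exact Or.inl ⟨h0, j, h1, h h2, fun j' hj' => h (h3 j' hj')⟩
    · refine Or.inr ⟨h0, fun j hj => (h1 j hj).imp (@h _) ?_⟩
      rintro ⟨j', h2, h3⟩
      exact ⟨j', h2, h h3⟩
  · exact Or.imp (And.imp id (@h _)) (And.imp id (@h _))
  · rintro (⟨h0, h1, h2⟩ | ⟨h0, h1⟩)
    · exact Or.inl ⟨h0, fun a => h (h1 a), fun c' hc hd => h (h2 c' hc hd)⟩
    · refine Or.inr ⟨h0, h1.imp (And.imp id (@h _)) ?_⟩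
      rintro ⟨c', h2, h3, h4⟩
      exact ⟨c', h2, h3, h h4⟩

theorem Closed.append {t t' : List Ent} (h : Closed t) (h' : Closed t') : Closed (t ++ t') := by
  intro x hx
  rcases List.mem_append.1 hx with hx | hx
  · exact (h x hx).mono (List.subset_append_left _ _)
  · exact (h' x hx).mono (List.subset_append_right _ _)

theorem Closed.cons {t : List Ent} (h : Closed t) {M e c i b : ℕ} (hj : Just t M e c i b) :
    Closed ((M, e, c, i, b) :: t) := by
  intro x hx
  rcases List.mem_cons.1 hx with rfl | hx
  · exact hj.mono (List.subset_cons_self _ _)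
  · exact (h x hx).mono (List.subset_cons_self _ _)

/-- An entry is decided by a table. -/
def Dcd (t : List Ent) (M e c i : ℕ) : Prop := (M, e, c, i, 0) ∈ t ∨ (M, e, c, i, 1) ∈ t

theorem Dcd.mono {t t' : List Ent} (h : t ⊆ t') {M e c i : ℕ} (hd : Dcd t M e c i) :
    Dcd t' M e c i := hd.imp (@h _) (@h _)

theorem collect (D : List Ent → ℕ → Prop) (hD : ∀ t t' j, t ⊆ t' → D t j → D t' j) (n : ℕ)
    (h : ∀ j < n, ∃ t, Closed t ∧ D t j) : ∃ t, Closed t ∧ ∀ j < n, D t j := by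
  induction n with
  | zero => exact ⟨[], by simp [Closed], by simp⟩
  | succ n ih =>
    obtain ⟨t, h1, h2⟩ := ih (fun j hj => h j (by omega))
    obtain ⟨t', h3, h4⟩ := h n (by omega)
    refine ⟨t ++ t', h1.append h3, fun j hj => ?_⟩
    by_cases hjn : j = n
    · subst hjn
      exact hD _ _ _ (List.subset_append_right _ _) h4
    · exact hD _ _ _ (List.subset_append_left _ _) (h2 j (by omega))

theorem unpair_snd_lt {e : ℕ} (h : e.unpair.1 ≠ 0) : e.unpair.2 < e := by
  have := Nat.add_le_pair e.unpair.1 e.unpair.2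
  rw [Nat.pair_unpair] at this
  omega

theorem table_exists (e : ℕ) : ∀ M c i, Valid M c → ∃ t, Closed t ∧ Dcd t M e c i := by
  classical
  induction e using Nat.strong_induction_on with
  | _ e ih =>
    intro M c i hv
    suffices h : ∃ t, Closed t ∧ (Just t M e c i 0 ∨ Just t M e c i 1) by
      obtain ⟨t, h1, h2⟩ := h
      rcases h2 with h2 | h2
      · exact ⟨_, h1.cons h2, Or.inl (by simp)⟩
      · exact ⟨_, h1.cons h2, Or.inr (by simp)⟩
    have hnil : Closed [] := by simp [Closed]
    have hl : e.unpair.1 ≠ 0 → e.unpair.2.unpair.1 < e := fun h =>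
      (Nat.unpair_left_le _).trans_lt (unpair_snd_lt h)
    have hr : e.unpair.1 ≠ 0 → e.unpair.2.unpair.2 < e := fun h =>
      (Nat.unpair_right_le _).trans_lt (unpair_snd_lt h)
    rcases Nat.lt_or_ge e.unpair.1 8 with h8 | h8
    swap
    · exact ⟨[], hnil, Or.inl (by unfold Just; tauto)⟩
    by_cases t0 : e.unpair.1 = 0
    · refine ⟨[], hnil, ?_⟩
      by_cases hb : bit (mv M) (Nat.pair (pth M c i) e.unpair.2)
      · exact Or.inr (Or.inl ⟨t0, Or.inl ⟨rfl, hb⟩⟩)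
      · exact Or.inl (Or.inl ⟨t0, Or.inr ⟨rfl, hb⟩⟩)
    have hs := unpair_snd_lt t0
    have hl := hl t0
    have hr := hr t0
    by_cases t1 : e.unpair.1 = 1
    · obtain ⟨t, h1, h2⟩ := ih _ hs M c i hv
      refine ⟨t, h1, ?_⟩
      unfold Just J1
      rcases h2 with h2 | h2
      · right; right; left; exact ⟨t1, Or.inl ⟨rfl, h2⟩⟩
      · left; right; left; exact ⟨t1, Or.inr ⟨rfl, h2⟩⟩
    by_cases t2 : e.unpair.1 = 2
    · obtain ⟨t, h1, h2⟩ := ih _ hl M c i hv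
      obtain ⟨t', h1', h2'⟩ := ih _ hr M c i hv
      refine ⟨t ++ t', h1.append h1', ?_⟩
      replace h2 := h2.mono (List.subset_append_left t t')
      replace h2' := h2'.mono (List.subset_append_right t t')
      rcases h2 with h2 | h2
      · exact Or.inl (Or.inr (Or.inr (Or.inl ⟨t2, Or.inr ⟨rfl, Or.inl h2⟩⟩)))
      · rcases h2' with h2' | h2'
        · exact Or.inl (Or.inr (Or.inr (Or.inl ⟨t2, Or.inr ⟨rfl, Or.inr h2'⟩⟩)))
        · exact Or.inr (Or.inr (Or.inr (Or.inl ⟨t2, Or.inl ⟨rfl, h2, h2'⟩⟩)))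
    by_cases t3 : e.unpair.1 = 3
    · obtain ⟨t, h1, h2⟩ := collect (fun t j => Dcd t M e.unpair.2.unpair.1 c (i + j))
        (fun _ _ _ h hd => hd.mono h) (cL c) (fun j _ => ih _ hl M c (i + j) hv)
      obtain ⟨t', h1', h2'⟩ := collect (fun t j => Dcd t M e.unpair.2.unpair.2 c (i + j))
        (fun _ _ _ h hd => hd.mono h) (cL c) (fun j _ => ih _ hr M c (i + j) hv)
      refine ⟨t ++ t', h1.append h1', ?_⟩
      replace h2 := fun j hj => (h2 j hj).mono (List.subset_append_left t t')
      replace h2' := fun j hj => (h2' j hj).mono (List.subset_append_right t t')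
      generalize t ++ t' = T at h2 h2'
      by_cases hb : ∀ j < cL c, (M, e.unpair.2.unpair.2, c, i + j, 0) ∈ T ∨
        ∃ j' < j, (M, e.unpair.2.unpair.1, c, i + j', 0) ∈ T
      · exact Or.inl (Or.inr (Or.inr (Or.inr (Or.inl ⟨t3, Or.inr ⟨rfl, hb⟩⟩))))
      · push Not at hb
        obtain ⟨j, g1, g2, g3⟩ := hb
        refine Or.inr (Or.inr (Or.inr (Or.inr (Or.inl ⟨t3, Or.inl ⟨rfl, j, g1, ?_, ?_⟩⟩))))
        · exact (h2' j g1).resolve_left g2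
        · intro j' hj'
          exact (h2 j' (by omega)).resolve_left (g3 j' hj')
    by_cases t4 : e.unpair.1 = 4
    · obtain ⟨t, h1, h2⟩ := ih _ hs M c (i + 1) hv
      refine ⟨t, h1, ?_⟩
      rcases h2 with h2 | h2
      · exact Or.inl (Or.inr (Or.inr (Or.inr (Or.inr (Or.inl ⟨t4, Or.inr ⟨rfl, h2⟩⟩)))))
      · exact Or.inr (Or.inr (Or.inr (Or.inr (Or.inr (Or.inl ⟨t4, Or.inl ⟨rfl, h2⟩⟩)))))
    have t5 : e.unpair.1 = 5 ∨ e.unpair.1 = 6 ∨ e.unpair.1 = 7 := by omega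
    obtain ⟨t, h1, h2⟩ := ih _ hs M c i hv
    obtain ⟨t', h1', h2'⟩ := collect (fun t c' => Valid M c' → Dcd t M e.unpair.2 c' 0)
      (fun _ _ _ h hd hv => (hd hv).mono h) (BQ M e c) (fun c' _ => by
        by_cases hv' : Valid M c'
        · obtain ⟨t, a, b⟩ := ih _ hs M c' 0 hv'
          exact ⟨t, a, fun _ => b⟩
        · exact ⟨[], hnil, fun h => absurd h hv'⟩)
    refine ⟨t ++ t', h1.append h1', ?_⟩
    replace h2 := h2.mono (List.subset_append_left t t')
    replace h2' := fun j hj hv => (h2' j hj hv).mono (List.subset_append_right t t')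
    generalize t ++ t' = T at h2 h2'
    by_cases hb : ((e.unpair.1 = 7 ∧ (M, e.unpair.2, c, i, 0) ∈ T) ∨
      ∃ c' < BQ M e c, Cand M e c i c' ∧ (M, e.unpair.2, c', 0, 0) ∈ T)
    · exact Or.inl (Or.inr (Or.inr (Or.inr (Or.inr (Or.inr (Or.inl ⟨t5, Or.inr ⟨rfl, hb⟩⟩))))))
    · push Not at hb
      refine Or.inr (Or.inr (Or.inr (Or.inr (Or.inr (Or.inr (Or.inl ⟨t5, Or.inl ⟨rfl, ?_, ?_⟩⟩))))))
      · intro h7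
        exact h2.resolve_left (hb.1 h7)
      · intro c' hc' hcand
        exact (h2' c' hc' hcand.1).resolve_left (hb.2 c' hc' hcand)

/-! ### Soundness -/

theorem until_bound (M c i : ℕ) (φ ψ : Form ℕ)
    (h : sat (mdl M) 0 (.untl φ ψ) (suffix (pth M c) i)) :
    ∃ j < cL c, sat (mdl M) 0 ψ (suffix (pth M c) (i + j)) ∧
      ∀ j' < j, sat (mdl M) 0 φ (suffix (pth M c) (i + j')) := by
  have hss : ∀ j, suffix (suffix (pth M c) i) j = suffix (pth M c) (i + j) := by
    intro j; funext t
    show pth M c (t + j + i) = pth M c (t + (i + j))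
    congr 1; omega
  obtain ⟨j, h1, h2⟩ := h
  rw [hss] at h1
  obtain ⟨j', h3, h4, h5⟩ := idx_red c i j
  refine ⟨j', h4, ?_, ?_⟩
  · rw [suffix_idx M c _ _ h5]; exact h1
  · intro j'' h6
    rw [← hss]; exact h2 j'' (by omega)

theorem Cand.sound {M e c i c' : ℕ} (h : Cand M e c i c') :
    IsFullpath (mdl M) (pth M c') ∧
    (e.unpair.1 = 5 → pth M c' 0 = pth M c i) ∧
    (e.unpair.1 = 6 → pth M c' 0 = pth M c i ∧ FailureFree (mdl M) 0 (pth M c')) ∧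
    (e.unpair.1 = 7 → IsDeviation (mdl M) 0 (suffix (pth M c) i) (pth M c')) := by
  obtain ⟨hv, h⟩ := h
  refine ⟨hv.full, ?_, ?_, ?_⟩
  · intro he
    rcases h with h | h | h
    · exact h.2
    · omega
    · omega
  · intro he
    rcases h with h | h | h
    · omega
    · exact ⟨h.2.1, (FFL_iff M c' 0).1 h.2.2⟩
    · omega
  · intro he
    rcases h with h | h | h
    · omega
    · omega
    · obtain ⟨-, d, -, h1, h2⟩ := h
      exact ⟨d, fun j hj => h1 j (by omega), (FFL_iff M c' _).1 h2⟩

theorem Cand.complete (φ : Form ℕ) {M e c i : ℕ} (he : enc φ ≤ e) (π : ℕ → ℕ)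
    (hπ : IsFullpath (mdl M) π)
    (h : (e.unpair.1 = 5 ∧ π 0 = pth M c i) ∨
      (e.unpair.1 = 6 ∧ π 0 = pth M c i ∧ FailureFree (mdl M) 0 π) ∨
      (e.unpair.1 = 7 ∧ IsDeviation (mdl M) 0 (suffix (pth M c) i) π)) :
    ∃ c' < BQ M e c, Cand M e c i c' ∧
      (sat (mdl M) 0 φ (pth M c') ↔ sat (mdl M) 0 φ π) := by
  have hs0 : ∀ ρ : ℕ → ℕ, suffix ρ 0 = ρ := fun ρ => rfl
  rcases h with ⟨ht, h0⟩ | ⟨ht, h0, h1⟩ | ⟨ht, hd⟩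
  · obtain ⟨c', g1, g2, g3, g4, g5⟩ := path_lasso φ e M he π hπ 0 (PQ M e c)
      (by unfold PQ PB; omega)
    exact ⟨c', g1, ⟨g2, Or.inl ⟨ht, (g3 0 le_rfl).trans h0⟩⟩, g4⟩
  · obtain ⟨c', g1, g2, g3, g4, g5⟩ := path_lasso φ e M he π hπ 0 (PQ M e c)
      (by unfold PQ PB; omega)
    exact ⟨c', g1, ⟨g2, Or.inr (Or.inl ⟨ht, (g3 0 le_rfl).trans h0, (FFL_iff M c' 0).2 (g5.2 h1)⟩)⟩, g4⟩
  · obtain ⟨π', d, a1, a2, a3, a4, a5⟩ := dev_early φ e M c i he π hπ hd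
    obtain ⟨c', g1, g2, g3, g4, g5⟩ := path_lasso φ e M he π' a2 (d + 1) (PQ M e c)
      (by unfold PQ PB; omega)
    refine ⟨c', g1, ⟨g2, Or.inr (Or.inr ⟨ht, d, by unfold PQ PB; omega, ?_, ?_⟩)⟩, g4.trans a5⟩
    · intro j hj
      rw [g3 j (by omega)]
      exact a3 j (by omega)
    · exact (FFL_iff M c' _).2 (g5.2 a4)

theorem table_sound {t : List Ent} (ht : Closed t) (M : ℕ) (φ : Form ℕ) : ∀ c i, Valid M c →
    ((M, enc φ, c, i, 1) ∈ t → sat (mdl M) 0 φ (suffix (pth M c) i)) ∧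
    ((M, enc φ, c, i, 0) ∈ t → ¬ sat (mdl M) 0 φ (suffix (pth M c) i)) := by
  have hss : ∀ c i j, suffix (suffix (pth M c) i) j = suffix (pth M c) (i + j) := by
    intro c i j; funext t
    show pth M c (t + j + i) = pth M c (t + (i + j))
    congr 1; omega
  have h00 : ∀ c i, suffix (pth M c) i 0 = pth M c i := by
    intro c i
    show pth M c (0 + i) = _
    rw [Nat.zero_add]
  induction φ with
  | atom p =>
    intro c i hv
    have key : ∀ b, (M, enc (Form.atom p), c, i, b) ∈ t → J0 M (enc (Form.atom p)) c i b := by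
      intro b hb
      have := ht _ hb
      simpa [Just, enc] using this
    constructor
    · intro h
      have := key _ h
      simp only [J0, enc, Nat.unpair_pair] at this
      show bit _ _
      rw [h00]
      simpa using this
    · intro h
      have := key _ h
      simp only [J0, enc, Nat.unpair_pair] at this
      show ¬ bit _ _
      rw [h00]
      simpa using this
  | neg φ ih =>
    intro c i hv
    have key : ∀ b, (M, enc (Form.neg φ), c, i, b) ∈ t → J1 t M (enc (Form.neg φ)) c i b := by
      intro b hb
      have := ht _ hb
      simpa [Just, enc] using this
    obtain ⟨i1, i2⟩ := ih c i hv
    constructor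
    · intro h
      have := key _ h
      simp only [J1, enc, Nat.unpair_pair] at this
      exact i2 (by simpa using this)
    · intro h
      have := key _ h
      simp only [J1, enc, Nat.unpair_pair] at this
      exact fun hn => hn (i1 (by simpa using this))
  | conj φ ψ ih1 ih2 =>
    intro c i hv
    have key : ∀ b, (M, enc (Form.conj φ ψ), c, i, b) ∈ t → J2 t M (enc (Form.conj φ ψ)) c i b := by
      intro b hb
      have := ht _ hb
      simpa [Just, enc] using this
    obtain ⟨i1, i2⟩ := ih1 c i hv
    obtain ⟨i3, i4⟩ := ih2 c i hv
    constructor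
    · intro h
      have := key _ h
      simp only [J2, enc, Nat.unpair_pair] at this
      simp only [true_and, one_ne_zero, false_and, or_false] at this
      exact ⟨i1 this.1, i3 this.2⟩
    · intro h
      have := key _ h
      simp only [J2, enc, Nat.unpair_pair] at this
      simp only [true_and, zero_ne_one, false_and, false_or] at this
      rintro ⟨h1, h2⟩
      exact this.elim (fun h => i2 h h1) (fun h => i4 h h2)
  | untl φ ψ ih1 ih2 =>
    intro c i hv
    have key : ∀ b, (M, enc (Form.untl φ ψ), c, i, b) ∈ t → J3 t M (enc (Form.untl φ ψ)) c i b := by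
      intro b hb
      have := ht _ hb
      simpa [Just, enc] using this
    constructor
    · intro h
      have := key _ h
      simp only [J3, enc, Nat.unpair_pair] at this
      simp only [true_and, one_ne_zero, false_and, or_false] at this
      obtain ⟨j, -, h1, h2⟩ := this
      refine ⟨j, ?_, fun j' hj' => ?_⟩
      · rw [hss]; exact (ih2 c _ hv).1 h1
      · rw [hss]; exact (ih1 c _ hv).1 (h2 j' hj')
    · intro h
      have := key _ h
      simp only [J3, enc, Nat.unpair_pair] at this
      simp only [true_and, zero_ne_one, false_and, false_or] at this
      intro hs
      obtain ⟨j, h1, h2, h3⟩ := until_bound M c i φ ψ hs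
      rcases this j h1 with h4 | ⟨j', h4, h5⟩
      · exact (ih2 c _ hv).2 h4 h2
      · exact (ih1 c _ hv).2 h5 (h3 j' h4)
  | next φ ih =>
    intro c i hv
    have key : ∀ b, (M, enc (Form.next φ), c, i, b) ∈ t → J4 t M (enc (Form.next φ)) c i b := by
      intro b hb
      have := ht _ hb
      simpa [Just, enc] using this
    obtain ⟨i1, i2⟩ := ih c (i + 1) hv
    rw [← hss] at i1 i2
    constructor
    · intro h
      have := key _ h
      simp only [J4, enc, Nat.unpair_pair] at this
      exact i1 (by simpa using this)
    · intro h
      have := key _ h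
      simp only [J4, enc, Nat.unpair_pair] at this
      exact i2 (by simpa using this)
  | fall φ ih =>
    intro c i hv
    have key : ∀ b, (M, enc (Form.fall φ), c, i, b) ∈ t → J5 t M (enc (Form.fall φ)) c i b := by
      intro b hb
      have := ht _ hb
      simpa [Just, enc] using this
    have ht5 : (enc (Form.fall φ)).unpair.1 = 5 := by simp [enc]
    have ht5' : (enc (Form.fall φ)).unpair.2 = enc φ := by simp [enc]
    have hle : enc φ ≤ enc (Form.fall φ) := Nat.right_le_pair _ _
    constructor
    · intro h
      have := key _ h
      simp only [J5, true_and, one_ne_zero, false_and, or_false, ht5'] at this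
      intro π h1 h2
      rw [h00] at h2
      obtain ⟨c', g1, g2, g3⟩ := Cand.complete φ hle π h1 (Or.inl ⟨ht5, h2⟩)
      exact g3.1 ((ih c' 0 g2.1).1 (this.2 c' g1 g2))
    · intro h
      have := key _ h
      simp only [J5, true_and, zero_ne_one, false_and, false_or, ht5'] at this
      rcases this with ⟨h7, -⟩ | ⟨c', -, g2, g3⟩
      · omega
      · obtain ⟨a1, a2, -⟩ := g2.sound
        intro hs
        exact (ih c' 0 g2.1).2 g3 (hs _ a1 ((a2 ht5).trans (h00 c i).symm))
  | oblig φ ih =>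
    intro c i hv
    have key : ∀ b, (M, enc (Form.oblig φ), c, i, b) ∈ t → J5 t M (enc (Form.oblig φ)) c i b := by
      intro b hb
      have := ht _ hb
      simpa [Just, enc] using this
    have ht5 : (enc (Form.oblig φ)).unpair.1 = 6 := by simp [enc]
    have ht5' : (enc (Form.oblig φ)).unpair.2 = enc φ := by simp [enc]
    have hle : enc φ ≤ enc (Form.oblig φ) := Nat.right_le_pair _ _
    constructor
    · intro h
      have := key _ h
      simp only [J5, true_and, one_ne_zero, false_and, or_false, ht5'] at this
      intro π h1 h2 h3
      rw [h00] at h2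
      obtain ⟨c', g1, g2, g3⟩ := Cand.complete φ hle π h1 (Or.inr (Or.inl ⟨ht5, h2, h3⟩))
      exact g3.1 ((ih c' 0 g2.1).1 (this.2 c' g1 g2))
    · intro h
      have := key _ h
      simp only [J5, true_and, zero_ne_one, false_and, false_or, ht5'] at this
      rcases this with ⟨h7, -⟩ | ⟨c', -, g2, g3⟩
      · omega
      · obtain ⟨a1, -, a2, -⟩ := g2.sound
        intro hs
        exact (ih c' 0 g2.1).2 g3 (hs _ a1 ((a2 ht5).1.trans (h00 c i).symm) (a2 ht5).2)
  | robust φ ih =>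
    intro c i hv
    have key : ∀ b, (M, enc (Form.robust φ), c, i, b) ∈ t → J5 t M (enc (Form.robust φ)) c i b := by
      intro b hb
      have := ht _ hb
      simpa [Just, enc] using this
    have ht5 : (enc (Form.robust φ)).unpair.1 = 7 := by simp [enc]
    have ht5' : (enc (Form.robust φ)).unpair.2 = enc φ := by simp [enc]
    have hle : enc φ ≤ enc (Form.robust φ) := Nat.right_le_pair _ _
    constructor
    · intro h
      have := key _ h
      simp only [J5, true_and, one_ne_zero, false_and, or_false, ht5'] at this
      refine ⟨(ih c i hv).1 (this.1 ht5), ?_⟩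
      intro π h1 h2
      obtain ⟨c', g1, g2, g3⟩ := Cand.complete φ hle π h1 (Or.inr (Or.inr ⟨ht5, h2⟩))
      exact g3.1 ((ih c' 0 g2.1).1 (this.2 c' g1 g2))
    · intro h
      have := key _ h
      simp only [J5, true_and, zero_ne_one, false_and, false_or, ht5'] at this
      rcases this with ⟨-, h7⟩ | ⟨c', -, g2, g3⟩
      · exact fun hs => (ih c i hv).2 h7 hs.1
      · obtain ⟨a1, -, -, a2⟩ := g2.sound
        intro hs
        exact (ih c' 0 g2.1).2 g3 (hs.2 _ a1 (a2 ht5))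

end Stmt9

namespace Stmt9

/-! ## The decision procedure -/

def RoC (M : ℕ) : Prop :=
  ∀ w < mn M, ∃ c < beta (mn M) (PB (mn M) 0 0), Valid M c ∧ pth M c 0 = w ∧ FFL M c 0

def MB (e : ℕ) : ℕ :=
  Nat.pair (NN e) (Nat.pair (2 ^ Nat.pair (NN e) (NN e)) (2 ^ Nat.pair (NN e) (e + 1))) + 1

def CB (e M : ℕ) : ℕ := beta (mn M) (PB (mn M) e 0)

theorem model_code {D : Type} [Finite D] (N : KStruct ℕ D) (e : ℕ) (hc : Nat.card D ≤ NN e) :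
    ∃ M < MB e, ∃ f : D → ℕ, Emb e N (mdl M) f ∧ ∀ w < mn M, ∃ d, f d = w := by
  classical
  let n := Nat.card D
  let E : D ≃ Fin n := Finite.equivFin D
  let f : D → ℕ := fun d => (E d).1
  have hinj : Function.Injective f := fun a b h => E.injective (Fin.ext h)
  have hlt : ∀ d, f d < n := fun d => (E d).2
  obtain ⟨r, hr1, hr2⟩ := bits_exist (fun x => ∃ a b, x = Nat.pair (f a) (f b) ∧ N.rel a b)
    (Nat.pair n n)
  obtain ⟨v, hv1, hv2⟩ := bits_exist (fun x => ∃ a p, x = Nat.pair (f a) p ∧ p ∈ N.val a)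
    (Nat.pair n (e + 1))
  have hpl : ∀ a b a' b', a < a' → b < b' → Nat.pair a b < Nat.pair a' b' := fun a b a' b' h h' =>
    (Nat.pair_lt_pair_left _ h).trans (Nat.pair_lt_pair_right _ h')
  refine ⟨Nat.pair n (Nat.pair r v), ?_, f, ⟨hinj, ?_, ?_⟩, ?_⟩
  · have h1 : 2 ^ Nat.pair n n ≤ 2 ^ Nat.pair (NN e) (NN e) :=
      Nat.pow_le_pow_right (by omega) (pair_mono hc hc)
    have h2 : 2 ^ Nat.pair n (e + 1) ≤ 2 ^ Nat.pair (NN e) (e + 1) :=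
      Nat.pow_le_pow_right (by omega) (pair_mono hc le_rfl)
    exact Nat.lt_succ_of_le (pair_mono hc (pair_mono (by omega) (by omega)))
  · intro a b'
    simp only [mdl, mn, mr, Nat.unpair_pair]
    constructor
    · rintro ⟨-, h1, h2⟩
      rw [hr2 _ (hpl _ _ _ _ (hlt a) h1)] at h2
      obtain ⟨a', b, h3, h4⟩ := h2
      rw [Nat.pair_eq_pair] at h3
      refine ⟨b, h3.2, ?_⟩
      rwa [hinj h3.1]
    · rintro ⟨b, rfl, hb⟩
      exact ⟨hlt a, hlt b, (hr2 _ (hpl _ _ _ _ (hlt a) (hlt b))).2 ⟨a, b, rfl, hb⟩⟩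
  · intro p hp a
    show _ ↔ bit (mv (Nat.pair n (Nat.pair r v))) (Nat.pair (f a) p)
    simp only [mv, Nat.unpair_pair]
    rw [hv2 _ (hpl _ _ _ _ (hlt a) (by omega))]
    constructor
    · intro h
      exact ⟨a, p, rfl, h⟩
    · rintro ⟨a', p', h1, h2⟩
      rw [Nat.pair_eq_pair] at h1
      rw [hinj h1.1, h1.2]; exact h2
  · intro w hw
    simp only [mn, Nat.unpair_pair] at hw
    exact ⟨E.symm ⟨w, hw⟩, by simp [f]⟩

theorem sat_code (φ : Form ℕ) {U : Type} (M : KStruct ℕ U) (hM : IsRoCTL M 0) (σ : ℕ → U)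
    (hσ : IsFullpath M σ) (hs : sat M 0 φ σ) :
    ∃ M' < MB (enc φ), ∃ c < CB (enc φ) M', Valid M' c ∧ RoC M' ∧ sat (mdl M') 0 φ (pth M' c) := by
  obtain ⟨D, hD, N, π, h1, h2, h3, h4⟩ := finite_model φ M hM σ hσ hs
  obtain ⟨M', hM', f, hf, hsur⟩ := model_code N (enc φ) h1
  obtain ⟨c, g1, g2, g3, g4, g5⟩ := path_lasso φ (enc φ) M' le_rfl (fun i => f (π i))
    ((hf.full π).2 h3) 0 _ le_rfl
  refine ⟨M', hM', c, g1, g2, ?_, g4.2 ((hf.sat φ le_rfl π).2 h4)⟩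
  intro w hw
  obtain ⟨d, rfl⟩ := hsur w hw
  obtain ⟨τ, t1, t2, t3⟩ := h2.2 d
  obtain ⟨c, g1, g2, g3, g4, g5⟩ := path_lasso (Form.atom 0) 0 M' (by simp [enc, Nat.pair]) (fun i => f (τ i))
    ((hf.full τ).2 t1) 0 _ le_rfl
  exact ⟨c, g1, g2, by rw [g3 0 le_rfl, t2], (FFL_iff M' c 0).2 (g5.2 ((hf.ff τ).2 t3))⟩

theorem code_sat (φ : Form ℕ) (M c : ℕ) (hv : Valid M c) (hR : RoC M)
    (hs : sat (mdl M) 0 φ (pth M c)) :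
    ∃ (D : Type) (N : KStruct ℕ D) (σ : ℕ → D), IsRoCTL N 0 ∧ IsFullpath N σ ∧ sat N 0 φ σ := by
  let D := {w : ℕ // w < mn M}
  let N : KStruct ℕ D := ⟨fun a b => (mdl M).rel a.1 b.1, fun a => (mdl M).val a.1⟩
  have hE : Emb (enc φ) N (mdl M) (Subtype.val : D → ℕ) := by
    refine ⟨Subtype.val_injective, ?_, fun _ _ _ => Iff.rfl⟩
    intro a b'
    constructor
    · intro h
      exact ⟨⟨b', h.2.1⟩, rfl, h⟩
    · rintro ⟨b, rfl, h⟩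
      exact h
  have hff : ∀ w, ∃ σ, IsFullpath N σ ∧ σ 0 = w ∧ FailureFree N 0 σ := by
    intro w
    obtain ⟨c', -, h1, h2, h3⟩ := hR w.1 w.2
    obtain ⟨π, e, g1, g2⟩ := hE.lift _ h1.full w h2
    refine ⟨π, g1, g2, (hE.ff π).1 ?_⟩
    rw [← e]
    exact (FFL_iff M c' 0).1 h3
  obtain ⟨σ, e, g1, g2⟩ := hE.lift _ hv.full ⟨pth M c 0, pth_lt hv 0⟩ rfl
  refine ⟨D, N, σ, ⟨?_, hff⟩, g1, (hE.sat φ le_rfl σ).1 (by rw [← e]; exact hs)⟩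
  intro w
  obtain ⟨τ, t1, rfl, -⟩ := hff w
  exact ⟨_, t1 0⟩

def GoodT (e : ℕ) (t : List Ent) : Prop :=
  Closed t ∧ ∀ M < MB e, ∀ c < CB e M, Valid M c → Dcd t M e c 0

def Res (e : ℕ) (t : List Ent) : Prop :=
  ∃ M < MB e, ∃ c < CB e M, Valid M c ∧ RoC M ∧ (M, e, c, 0, 1) ∈ t

theorem goodT_exists (e : ℕ) : ∃ t, GoodT e t := by
  refine collect (fun t M => ∀ c < CB e M, Valid M c → Dcd t M e c 0)
    (fun _ _ _ h hd c hc hv => (hd c hc hv).mono h) _ (fun M _ => ?_)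
  refine collect (fun t c => Valid M c → Dcd t M e c 0)
    (fun _ _ _ h hd hv => (hd hv).mono h) _ (fun c _ => ?_)
  by_cases hv : Valid M c
  · obtain ⟨t, h1, h2⟩ := table_exists e M c 0 hv
    exact ⟨t, h1, fun _ => h2⟩
  · exact ⟨[], by simp [Closed], fun h => absurd h hv⟩

theorem res_iff (φ : Form ℕ) (t : List Ent) (ht : GoodT (enc φ) t) :
    Res (enc φ) t ↔ ∃ (D : Type) (N : KStruct ℕ D) (σ : ℕ → D),
      IsRoCTL N 0 ∧ IsFullpath N σ ∧ sat N 0 φ σ := by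
  constructor
  · rintro ⟨M, -, c, -, h1, h2, h3⟩
    exact code_sat φ M c h1 h2 ((table_sound ht.1 M φ c 0 h1).1 h3)
  · rintro ⟨D, N, σ, h1, h2, h3⟩
    obtain ⟨M, g1, c, g2, g3, g4, g5⟩ := sat_code φ N h1 σ h2 h3
    refine ⟨M, g1, c, g2, g3, g4, ?_⟩
    exact (ht.2 M g1 c g2 g3).resolve_left fun h0 => (table_sound ht.1 M φ c 0 g3).2 h0 g5

end Stmt9

namespace Stmt9

/-! ## Primitive recursiveness -/

section Prim

theorem pr_pow' : Primrec₂ (fun a b : ℕ => a ^ b) := by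
  have h : Primrec₂ fun (a : ℕ) (n : ℕ) =>
      n.rec (motive := fun _ => ℕ) 1 fun _ IH => IH * a :=
    Primrec.nat_rec (f := fun _ : ℕ => 1) (g := fun (a : ℕ) (p : ℕ × ℕ) => p.2 * a)
      (Primrec.const 1)
      (Primrec.nat_mul.comp (Primrec.snd.comp Primrec.snd) Primrec.fst)
  refine h.of_eq fun a n => ?_
  induction n with
  | zero => rfl
  | succ n ih => rw [Nat.pow_succ, ← ih]

variable {α : Type} [Primcodable α]

theorem pr_add {f g : α → ℕ} (hf : Primrec f) (hg : Primrec g) : Primrec fun a => f a + g a :=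
  Primrec.nat_add.comp hf hg
theorem pr_mul {f g : α → ℕ} (hf : Primrec f) (hg : Primrec g) : Primrec fun a => f a * g a :=
  Primrec.nat_mul.comp hf hg
theorem pr_sub {f g : α → ℕ} (hf : Primrec f) (hg : Primrec g) : Primrec fun a => f a - g a :=
  Primrec.nat_sub.comp hf hg
theorem pr_div {f g : α → ℕ} (hf : Primrec f) (hg : Primrec g) : Primrec fun a => f a / g a :=
  Primrec.nat_div.comp hf hg
theorem pr_mod {f g : α → ℕ} (hf : Primrec f) (hg : Primrec g) : Primrec fun a => f a % g a :=
  Primrec.nat_mod.comp hf hg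
theorem pr_pow {f g : α → ℕ} (hf : Primrec f) (hg : Primrec g) : Primrec fun a => f a ^ g a :=
  pr_pow'.comp hf hg
theorem pr_pair {f g : α → ℕ} (hf : Primrec f) (hg : Primrec g) :
    Primrec fun a => Nat.pair (f a) (g a) :=
  Primrec₂.natPair.comp hf hg
theorem pr_u1 {f : α → ℕ} (hf : Primrec f) : Primrec fun a => (f a).unpair.1 :=
  Primrec.fst.comp (Primrec.unpair.comp hf)
theorem pr_u2 {f : α → ℕ} (hf : Primrec f) : Primrec fun a => (f a).unpair.2 :=
  Primrec.snd.comp (Primrec.unpair.comp hf)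
theorem pr_c (n : ℕ) : Primrec fun _ : α => n := Primrec.const n
theorem pr_eq {f g : α → ℕ} (hf : Primrec f) (hg : Primrec g) : PrimrecPred fun a => f a = g a :=
  Primrec.eq.comp hf hg
theorem pr_lt {f g : α → ℕ} (hf : Primrec f) (hg : Primrec g) : PrimrecPred fun a => f a < g a :=
  Primrec.nat_lt.comp hf hg
theorem pr_le {f g : α → ℕ} (hf : Primrec f) (hg : Primrec g) : PrimrecPred fun a => f a ≤ g a :=
  Primrec.nat_le.comp hf hg
theorem pr_imp {p q : α → Prop} (hp : PrimrecPred p) (hq : PrimrecPred q) :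
    PrimrecPred fun a => p a → q a :=
  (hp.not.or hq).of_eq fun a => by tauto

theorem pr_exl {β : Type} [Primcodable β] {f : α → List β} (hf : Primrec f) {R : α → β → Prop}
    (hR : PrimrecPred fun p : α × β => R p.1 p.2) : PrimrecPred fun a => ∃ x ∈ f a, R a x := by
  have h : PrimrecRel fun (b : β) (a : α) => R a b :=
    PrimrecPred.comp hR (f := fun p : β × α => (p.2, p.1)) (Primrec.snd.pair Primrec.fst)
  exact PrimrecRel.comp (PrimrecRel.exists_mem_list h) hf Primrec.id

theorem pr_all {β : Type} [Primcodable β] {f : α → List β} (hf : Primrec f) {R : α → β → Prop}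
    (hR : PrimrecPred fun p : α × β => R p.1 p.2) : PrimrecPred fun a => ∀ x ∈ f a, R a x := by
  have h : PrimrecRel fun (b : β) (a : α) => R a b :=
    PrimrecPred.comp hR (f := fun p : β × α => (p.2, p.1)) (Primrec.snd.pair Primrec.fst)
  exact PrimrecRel.comp (PrimrecRel.forall_mem_list h) hf Primrec.id

theorem pr_ex {f : α → ℕ} (hf : Primrec f) {R : α → ℕ → Prop}
    (hR : PrimrecPred fun p : α × ℕ => R p.1 p.2) : PrimrecPred fun a => ∃ x < f a, R a x :=
  (pr_exl (Primrec.list_range.comp hf) hR).of_eq fun a => by simp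

theorem pr_fa {f : α → ℕ} (hf : Primrec f) {R : α → ℕ → Prop}
    (hR : PrimrecPred fun p : α × ℕ => R p.1 p.2) : PrimrecPred fun a => ∀ x < f a, R a x :=
  (pr_all (Primrec.list_range.comp hf) hR).of_eq fun a => by simp

theorem pr_FF {f : α → ℕ} (hf : Primrec f) : Primrec fun a => FF (f a) := by
  unfold FF
  exact pr_add (pr_add (pr_add (pr_add (pr_add (pr_mul hf hf) (pr_mul (pr_c 3) hf))
    (pr_mul hf (pr_pow (pr_c 7) (pr_pow (pr_c (2 ^ 2)) hf)))) (pr_mul hf (pr_pow (pr_c 2) hf)))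
    (pr_pow (pr_mul hf (pr_c 2)) hf)) (pr_c 3)

theorem pr_Bnd {f : α → ℕ} (hf : Primrec f) : Primrec fun a => Bnd (f a) :=
  Primrec.nat_iterate hf (pr_c 3) (h := fun _ n => FF n) (pr_FF Primrec.snd)

theorem pr_GG {f : α → ℕ} (hf : Primrec f) : Primrec fun a => GG (f a) := by
  unfold GG
  exact pr_mul hf (pr_pow (pr_mul (pr_add hf (pr_c 1)) (pr_c 8)) (pr_pow (pr_pow (pr_c 2) hf) hf))

theorem pr_HH {f : α → ℕ} (hf : Primrec f) : Primrec fun a => HH (f a) := by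
  unfold HH
  exact pr_mul (pr_pow (pr_c 2) (pr_mul hf (pr_mul hf (pr_mul (pr_c 2) (pr_mul hf hf)))))
    (pr_mul hf (pr_add (pr_mul (pr_c 2) hf) (pr_c 3)))

theorem pr_NN {f : α → ℕ} (hf : Primrec f) : Primrec fun a => NN (f a) :=
  pr_HH (pr_GG (pr_Bnd (pr_add (pr_c 7) hf)))

theorem pr_MB {f : α → ℕ} (hf : Primrec f) : Primrec fun a => MB (f a) :=
  pr_add (pr_pair (pr_NN hf) (pr_pair (pr_pow (pr_c 2) (pr_pair (pr_NN hf) (pr_NN hf)))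
    (pr_pow (pr_c 2) (pr_pair (pr_NN hf) (pr_add hf (pr_c 1)))))) (pr_c 1)

theorem pr_bit {f g : α → ℕ} (hf : Primrec f) (hg : Primrec g) :
    PrimrecPred fun a => bit (f a) (g a) :=
  pr_eq (pr_mod (pr_div hf (pr_pow (pr_c 2) hg)) (pr_c 2)) (pr_c 1)

theorem pr_mn {f : α → ℕ} (hf : Primrec f) : Primrec fun a => mn (f a) := pr_u1 hf
theorem pr_mr {f : α → ℕ} (hf : Primrec f) : Primrec fun a => mr (f a) := pr_u1 (pr_u2 hf)
theorem pr_mv {f : α → ℕ} (hf : Primrec f) : Primrec fun a => mv (f a) := pr_u2 (pr_u2 hf)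
theorem pr_cl {f : α → ℕ} (hf : Primrec f) : Primrec fun a => cl (f a) := pr_u1 hf
theorem pr_ck {f : α → ℕ} (hf : Primrec f) : Primrec fun a => ck (f a) := pr_u1 (pr_u2 hf)
theorem pr_cu {f : α → ℕ} (hf : Primrec f) : Primrec fun a => cu (f a) := pr_u2 (pr_u2 hf)
theorem pr_cL {f : α → ℕ} (hf : Primrec f) : Primrec fun a => cL (f a) :=
  pr_add (pr_add (pr_cl hf) (pr_ck hf)) (pr_c 1)

theorem pr_idx {f g : α → ℕ} (hf : Primrec f) (hg : Primrec g) :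
    Primrec fun a => idx (f a) (g a) :=
  Primrec.ite (pr_lt hg (pr_cl hf)) hg
    (pr_add (pr_cl hf) (pr_mod (pr_sub hg (pr_cl hf)) (pr_add (pr_ck hf) (pr_c 1))))

theorem pr_pth {m f g : α → ℕ} (hm : Primrec m) (hf : Primrec f) (hg : Primrec g) :
    Primrec fun a => pth (m a) (f a) (g a) :=
  pr_mod (pr_div (pr_cu hf) (pr_pow (pr_mn hm) (pr_idx hf hg))) (pr_mn hm)

theorem pr_beta {f g : α → ℕ} (hf : Primrec f) (hg : Primrec g) :
    Primrec fun a => beta (f a) (g a) :=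
  pr_add (pr_pair hg (pr_pair hg (pr_pow hf hg))) (pr_c 1)

theorem pr_PB {f g h : α → ℕ} (hf : Primrec f) (hg : Primrec g) (hh : Primrec h) :
    Primrec fun a => PB (f a) (g a) (h a) :=
  pr_add hh (pr_mul (pr_c 2) (pr_mul hf (pr_mul (pr_Bnd (pr_add (pr_c 6) hg))
    (pr_Bnd (pr_add (pr_c 6) hg)))))

theorem pr_PQ {M e c : α → ℕ} (hM : Primrec M) (he : Primrec e) (hc : Primrec c) :
    Primrec fun a => PQ (M a) (e a) (c a) :=
  pr_PB (pr_mn hM) he (pr_add (pr_mul (pr_cL hc) (pr_Bnd (pr_add (pr_c 6) he))) (pr_c 1))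

theorem pr_BQ {M e c : α → ℕ} (hM : Primrec M) (he : Primrec e) (hc : Primrec c) :
    Primrec fun a => BQ (M a) (e a) (c a) :=
  pr_beta (pr_mn hM) (pr_PQ hM he hc)

theorem pr_CB {e M : α → ℕ} (he : Primrec e) (hM : Primrec M) :
    Primrec fun a => CB (e a) (M a) :=
  pr_beta (pr_mn hM) (pr_PB (pr_mn hM) he (pr_c 0))

/-- Weakening of a function to a larger context. -/
theorem pr_w {β : Type} [Primcodable β] {γ : Type} [Primcodable γ] {f : α → γ} (hf : Primrec f) :
    Primrec fun p : α × β => f p.1 := hf.comp Primrec.fst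

theorem pr_Valid {M c : α → ℕ} (hM : Primrec M) (hc : Primrec c) :
    PrimrecPred fun a => Valid (M a) (c a) :=
  (pr_lt (pr_c 0) (pr_mn hM)).and (pr_fa (pr_cL hc)
    (R := fun a i => bit (mr (M a)) (Nat.pair (pth (M a) (c a) i) (pth (M a) (c a) (i + 1))))
    (pr_bit (pr_mr (pr_w hM)) (pr_pair (pr_pth (pr_w hM) (pr_w hc) Primrec.snd)
      (pr_pth (pr_w hM) (pr_w hc) (pr_add Primrec.snd (pr_c 1))))))

theorem pr_FFL {M c s : α → ℕ} (hM : Primrec M) (hc : Primrec c) (hs : Primrec s) :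
    PrimrecPred fun a => FFL (M a) (c a) (s a) :=
  pr_fa (pr_cL hc)
    (R := fun a j => ¬ bit (mv (M a)) (Nat.pair (pth (M a) (c a) (s a + 1 + j)) 0))
    (pr_bit (pr_mv (pr_w hM)) (pr_pair (pr_pth (pr_w hM) (pr_w hc)
      (pr_add (pr_add (pr_w hs) (pr_c 1)) Primrec.snd)) (pr_c 0))).not

theorem pr_Dev {M e c i c' : α → ℕ} (hM : Primrec M) (he : Primrec e) (hc : Primrec c)
    (hi : Primrec i) (hc' : Primrec c') :
    PrimrecPred fun a => Dev (M a) (e a) (c a) (i a) (c' a) :=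
  pr_ex (pr_PQ hM he hc)
    (R := fun a d => (∀ j < d + 1, pth (M a) (c' a) j = pth (M a) (c a) (j + i a)) ∧
      FFL (M a) (c' a) (d + 1))
    ((pr_fa (f := fun p : α × ℕ => p.2 + 1) (pr_add Primrec.snd (pr_c 1))
      (R := fun p j => pth (M p.1) (c' p.1) j = pth (M p.1) (c p.1) (j + i p.1))
      (pr_eq (pr_pth (pr_w (pr_w hM)) (pr_w (pr_w hc')) Primrec.snd)
        (pr_pth (pr_w (pr_w hM)) (pr_w (pr_w hc)) (pr_add Primrec.snd (pr_w (pr_w hi)))))).and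
      (pr_FFL (pr_w hM) (pr_w hc') (pr_add Primrec.snd (pr_c 1))))

theorem pr_Cand {M e c i c' : α → ℕ} (hM : Primrec M) (he : Primrec e) (hc : Primrec c)
    (hi : Primrec i) (hc' : Primrec c') :
    PrimrecPred fun a => Cand (M a) (e a) (c a) (i a) (c' a) :=
  (pr_Valid hM hc').and
    (((pr_eq (pr_u1 he) (pr_c 5)).and (pr_eq (pr_pth hM hc' (pr_c 0)) (pr_pth hM hc hi))).or
    (((pr_eq (pr_u1 he) (pr_c 6)).and ((pr_eq (pr_pth hM hc' (pr_c 0)) (pr_pth hM hc hi)).and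
      (pr_FFL hM hc' (pr_c 0)))).or
    ((pr_eq (pr_u1 he) (pr_c 7)).and (pr_Dev hM he hc hi hc'))))

theorem pr_mem {t : α → List Ent} {M e c i b : α → ℕ} (ht : Primrec t) (hM : Primrec M)
    (he : Primrec e) (hc : Primrec c) (hi : Primrec i) (hb : Primrec b) :
    PrimrecPred fun a => (M a, e a, c a, i a, b a) ∈ t a := by
  have h1 : Primrec fun a => ((M a, e a, c a, i a, b a) : Ent) :=
    hM.pair (he.pair (hc.pair (hi.pair hb)))
  have h2 : PrimrecPred fun p : α × Ent => p.2 = ((M p.1, e p.1, c p.1, i p.1, b p.1) : Ent) :=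
    Primrec.eq.comp Primrec.snd (pr_w h1)
  exact (pr_exl ht (R := fun a x => x = ((M a, e a, c a, i a, b a) : Ent)) h2).of_eq
    fun a => by simp

theorem pr_Just {t : α → List Ent} {M e c i b : α → ℕ} (ht : Primrec t) (hM : Primrec M)
    (he : Primrec e) (hc : Primrec c) (hi : Primrec i) (hb : Primrec b) :
    PrimrecPred fun a => Just (t a) (M a) (e a) (c a) (i a) (b a) := by
  have b1 := pr_eq hb (pr_c 1)
  have b0 := pr_eq hb (pr_c 0)
  have tg : ∀ n, PrimrecPred fun a => (e a).unpair.1 = n := fun n => pr_eq (pr_u1 he) (pr_c n)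
  have hs := pr_u2 he
  have hl := pr_u1 hs
  have hr := pr_u2 hs
  have j0 : PrimrecPred fun a => J0 (M a) (e a) (c a) (i a) (b a) := by
    have := pr_bit (pr_mv hM) (pr_pair (pr_pth hM hc hi) hs)
    exact (b1.and this).or (b0.and this.not)
  have j1 : PrimrecPred fun a => J1 (t a) (M a) (e a) (c a) (i a) (b a) :=
    (b1.and (pr_mem ht hM hs hc hi (pr_c 0))).or (b0.and (pr_mem ht hM hs hc hi (pr_c 1)))
  have j2 : PrimrecPred fun a => J2 (t a) (M a) (e a) (c a) (i a) (b a) :=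
    (b1.and ((pr_mem ht hM hl hc hi (pr_c 1)).and (pr_mem ht hM hr hc hi (pr_c 1)))).or
    (b0.and ((pr_mem ht hM hl hc hi (pr_c 0)).or (pr_mem ht hM hr hc hi (pr_c 0))))
  have j3 : PrimrecPred fun a => J3 (t a) (M a) (e a) (c a) (i a) (b a) := by
    refine (b1.and (pr_ex (pr_cL hc)
      (R := fun a j => (M a, (e a).unpair.2.unpair.2, c a, i a + j, 1) ∈ t a ∧
        ∀ j' < j, (M a, (e a).unpair.2.unpair.1, c a, i a + j', 1) ∈ t a) ?_)).or
      (b0.and (pr_fa (pr_cL hc)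
      (R := fun a j => (M a, (e a).unpair.2.unpair.2, c a, i a + j, 0) ∈ t a ∨
        ∃ j' < j, (M a, (e a).unpair.2.unpair.1, c a, i a + j', 0) ∈ t a) ?_))
    · refine (pr_mem (pr_w ht) (pr_w hM) (pr_w hr) (pr_w hc) (pr_add (pr_w hi) Primrec.snd)
        (pr_c 1)).and (pr_fa (f := fun p : α × ℕ => p.2) Primrec.snd
        (R := fun p j' => (M p.1, (e p.1).unpair.2.unpair.1, c p.1, i p.1 + j', 1) ∈ t p.1) ?_)
      exact pr_mem (pr_w (pr_w ht)) (pr_w (pr_w hM)) (pr_w (pr_w hl)) (pr_w (pr_w hc))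
        (pr_add (pr_w (pr_w hi)) Primrec.snd) (pr_c 1)
    · refine (pr_mem (pr_w ht) (pr_w hM) (pr_w hr) (pr_w hc) (pr_add (pr_w hi) Primrec.snd)
        (pr_c 0)).or (pr_ex (f := fun p : α × ℕ => p.2) Primrec.snd
        (R := fun p j' => (M p.1, (e p.1).unpair.2.unpair.1, c p.1, i p.1 + j', 0) ∈ t p.1) ?_)
      exact pr_mem (pr_w (pr_w ht)) (pr_w (pr_w hM)) (pr_w (pr_w hl)) (pr_w (pr_w hc))
        (pr_add (pr_w (pr_w hi)) Primrec.snd) (pr_c 0)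
  have j4 : PrimrecPred fun a => J4 (t a) (M a) (e a) (c a) (i a) (b a) :=
    (b1.and (pr_mem ht hM hs hc (pr_add hi (pr_c 1)) (pr_c 1))).or
      (b0.and (pr_mem ht hM hs hc (pr_add hi (pr_c 1)) (pr_c 0)))
  have j5 : PrimrecPred fun a => J5 (t a) (M a) (e a) (c a) (i a) (b a) := by
    have hcand : PrimrecPred fun p : α × ℕ => Cand (M p.1) (e p.1) (c p.1) (i p.1) p.2 :=
      pr_Cand (pr_w hM) (pr_w he) (pr_w hc) (pr_w hi) Primrec.snd
    refine (b1.and ((pr_imp (tg 7) (pr_mem ht hM hs hc hi (pr_c 1))).and (pr_fa (pr_BQ hM he hc)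
      (R := fun a c' => Cand (M a) (e a) (c a) (i a) c' → (M a, (e a).unpair.2, c', 0, 1) ∈ t a)
      (pr_imp hcand ?_)))).or
      (b0.and (((tg 7).and (pr_mem ht hM hs hc hi (pr_c 0))).or (pr_ex (pr_BQ hM he hc)
      (R := fun a c' => Cand (M a) (e a) (c a) (i a) c' ∧ (M a, (e a).unpair.2, c', 0, 0) ∈ t a)
      (hcand.and ?_))))
    · exact pr_mem (pr_w ht) (pr_w hM) (pr_w hs) Primrec.snd (pr_c 0) (pr_c 1)
    · exact pr_mem (pr_w ht) (pr_w hM) (pr_w hs) Primrec.snd (pr_c 0) (pr_c 0)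
  exact ((tg 0).and j0).or (((tg 1).and j1).or (((tg 2).and j2).or (((tg 3).and j3).or
    (((tg 4).and j4).or ((((tg 5).or ((tg 6).or (tg 7))).and j5).or
      (pr_le (pr_c 8) (pr_u1 he)))))))

theorem pr_Closed {t : α → List Ent} (ht : Primrec t) : PrimrecPred fun a => Closed (t a) := by
  refine pr_all ht (R := fun a x => Just (t a) x.1 x.2.1 x.2.2.1 x.2.2.2.1 x.2.2.2.2) ?_
  have s1 : Primrec fun p : α × Ent => p.2 := Primrec.snd
  have s2 := Primrec.snd.comp s1
  have s3 := Primrec.snd.comp s2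
  have s4 := Primrec.snd.comp s3
  have s5 := Primrec.snd.comp s4
  exact pr_Just (pr_w ht) (Primrec.fst.comp s1) (Primrec.fst.comp s2) (Primrec.fst.comp s3)
    (Primrec.fst.comp s4) s5

theorem pr_RoC {M : α → ℕ} (hM : Primrec M) : PrimrecPred fun a => RoC (M a) := by
  refine pr_fa (pr_mn hM) (R := fun a w => ∃ c < beta (mn (M a)) (PB (mn (M a)) 0 0),
    Valid (M a) c ∧ pth (M a) c 0 = w ∧ FFL (M a) c 0) ?_
  have hM1 : Primrec fun p : α × ℕ => M p.1 := pr_w hM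
  have hM2 : Primrec fun p : (α × ℕ) × ℕ => M p.1.1 := pr_w hM1
  refine pr_ex (f := fun p : α × ℕ => beta (mn (M p.1)) (PB (mn (M p.1)) 0 0))
    (pr_beta (pr_mn hM1) (pr_PB (pr_mn hM1) (pr_c 0) (pr_c 0)))
    (R := fun p c => Valid (M p.1) c ∧ pth (M p.1) c 0 = p.2 ∧ FFL (M p.1) c 0) ?_
  exact (pr_Valid hM2 Primrec.snd).and ((pr_eq (pr_pth hM2 Primrec.snd (pr_c 0))
    (pr_w Primrec.snd)).and (pr_FFL hM2 Primrec.snd (pr_c 0)))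

theorem pr_GoodT {e : α → ℕ} {t : α → List Ent} (he : Primrec e) (ht : Primrec t) :
    PrimrecPred fun a => GoodT (e a) (t a) := by
  refine (pr_Closed ht).and (pr_fa (pr_MB he)
    (R := fun a M => ∀ c < CB (e a) M, Valid M c → Dcd (t a) M (e a) c 0) ?_)
  refine pr_fa (f := fun p : α × ℕ => CB (e p.1) p.2) (pr_CB (pr_w he) Primrec.snd)
    (R := fun p c => Valid p.2 c → Dcd (t p.1) p.2 (e p.1) c 0) ?_
  have hM : Primrec fun p : (α × ℕ) × ℕ => p.1.2 := pr_w Primrec.snd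
  exact pr_imp (pr_Valid hM Primrec.snd)
    ((pr_mem (pr_w (pr_w ht)) hM (pr_w (pr_w he)) Primrec.snd (pr_c 0) (pr_c 0)).or
      (pr_mem (pr_w (pr_w ht)) hM (pr_w (pr_w he)) Primrec.snd (pr_c 0) (pr_c 1)))

theorem pr_Res {e : α → ℕ} {t : α → List Ent} (he : Primrec e) (ht : Primrec t) :
    PrimrecPred fun a => Res (e a) (t a) := by
  refine pr_ex (pr_MB he)
    (R := fun a M => ∃ c < CB (e a) M, Valid M c ∧ RoC M ∧ (M, e a, c, 0, 1) ∈ t a) ?_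
  refine pr_ex (f := fun p : α × ℕ => CB (e p.1) p.2) (pr_CB (pr_w he) Primrec.snd)
    (R := fun p c => Valid p.2 c ∧ RoC p.2 ∧ (p.2, e p.1, c, 0, 1) ∈ t p.1) ?_
  have hM : Primrec fun p : (α × ℕ) × ℕ => p.1.2 := pr_w Primrec.snd
  exact (pr_Valid hM Primrec.snd).and ((pr_RoC hM).and
    (pr_mem (pr_w (pr_w ht)) hM (pr_w (pr_w he)) Primrec.snd (pr_c 0) (pr_c 1)))

end Prim

/-- Decoding of tables. -/
def tbl (k : ℕ) : List Ent := (Encodable.decode (α := List Ent) k).getD []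

theorem pr_tbl : Primrec tbl := Primrec.option_getD.comp Primrec.decode (Primrec.const [])

theorem tbl_surj (t : List Ent) : ∃ k, tbl k = t := ⟨Encodable.encode t, by simp [tbl]⟩

theorem search_general (P Q : ℕ → ℕ → Prop)
    (hP : PrimrecPred fun p : ℕ × ℕ => P p.1 p.2) (hQ : PrimrecPred fun p : ℕ × ℕ => Q p.1 p.2)
    (hex : ∀ e, ∃ k, P e k) :
    ∃ f : ℕ → Bool, Computable f ∧ ∀ e, ∃ k, P e k ∧ (f e = true ↔ Q e k) := by
  classical
  have hp : Primrec fun p : ℕ × ℕ => decide (P p.1 p.2) := hP.decide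
  have hr : Primrec fun p : ℕ × ℕ => decide (Q p.1 p.2) := hQ.decide
  have hg : Computable fun e => Nat.find (hex e) := by
    have h1 : Computable₂ fun (e k : ℕ) => decide (P e k) := hp.to_comp
    have h2 : Partrec₂ fun (e k : ℕ) => (Part.some (decide (P e k)) : Part Bool) :=
      h1.partrec₂
    refine Partrec.of_eq (Partrec.rfind h2) fun e => ?_
    show _ = Part.some (Nat.find (hex e))
    rw [Part.eq_some_iff]
    refine Nat.mem_rfind.2 ⟨?_, fun {m} hm => ?_⟩
    · simpa using Nat.find_spec (hex e)
    · simpa using Nat.find_min (hex e) hm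
  refine ⟨fun e => decide (Q e (Nat.find (hex e))), ?_,
    fun e => ⟨Nat.find (hex e), Nat.find_spec (hex e), decide_eq_true_iff⟩⟩
  exact hr.to_comp.comp (Computable.id.pair hg)

theorem decision : ∃ f : ℕ → Bool, Computable f ∧
    ∀ e, ∃ t, GoodT e t ∧ (f e = true ↔ Res e t) := by
  have hex : ∀ e, ∃ k, GoodT e (tbl k) := by
    intro e
    obtain ⟨t, ht⟩ := goodT_exists e
    obtain ⟨k, rfl⟩ := tbl_surj t
    exact ⟨k, ht⟩
  obtain ⟨f, hf, h⟩ := search_general (fun e k => GoodT e (tbl k)) (fun e k => Res e (tbl k))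
    (pr_GoodT Primrec.fst (pr_tbl.comp Primrec.snd))
    (pr_Res Primrec.fst (pr_tbl.comp Primrec.snd)) hex
  refine ⟨f, hf, fun e => ?_⟩
  obtain ⟨k, h1, h2⟩ := h e
  exact ⟨tbl k, h1, h2⟩

theorem roctl_dec :
    ∃ f : ℕ → Bool, Computable f ∧
      ∀ φ : Form ℕ, ViolFree 0 φ →
        (f (enc φ) = true ↔
          ∃ (W : Type) (M : KStruct ℕ W) (σ : ℕ → W),
            IsRoCTL M 0 ∧ IsFullpath M σ ∧ sat M 0 φ σ) := by
  obtain ⟨f, hf, h⟩ := decision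
  refine ⟨f, hf, fun φ _ => ?_⟩
  obtain ⟨t, h1, h2⟩ := h (enc φ)
  rw [h2]
  exact res_iff φ t h1

end Stmt9

namespace Stmt9

/-- The satisfiability problem for RoCTL* is decidable: some computable function
on codes of formulas decides whether the formula holds on some fullpath of some
RoCTL-structure. -/
theorem roctl_satisfiability_decidable :
    ∃ f : ℕ → Bool, Computable f ∧
      ∀ φ : Form ℕ, ViolFree 0 φ →
        (f (enc φ) = true ↔
          ∃ (W : Type) (M : KStruct ℕ W) (σ : ℕ → W),
            IsRoCTL M 0 ∧ IsFullpath M σ ∧ sat M 0 φ σ) := by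
  exact roctl_dec

end Stmt9
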